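/- arXiv:1503.00955 — 2 statements merged into one kernel-verified Lean document; each statement's English description precedes it below -/
import Mathlib

section
/- Assume the Riemann hypothesis. Then for all sufficiently large t > 0, |S(t)| ≤ (1/4)·(log t)/(log log t) + O((log t · log log log t)/(log log t)^2), where the implied constant is absolute. -/
open Complex Real Filter MeasureTheory


namespace SB

/-- terms of the continuation of `(s-1) ζ(s)`. -/
noncomputable def hterm (n : ℕ) (s : ℂ) : ℂ :=
  (s - 1) * ((n + 1 : ℕ) : ℂ) ^ (-s) + (((n + 2 : ℕ) : ℂ) ^ (1 - s) - ((n + 1 : ℕ) : ℂ) ^ (1 - s))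

lemma cpow_diff_bound {a : ℝ} (ha : 1 ≤ a) {x : ℝ} (hx : x ∈ Set.Icc a (a + 1)) {s : ℂ}
    (hs : 0 < s.re) :
    ‖(x : ℂ) ^ (-s) - (a : ℂ) ^ (-s)‖ ≤ ‖s‖ * a ^ (-s.re - 1) := by
  have hpos : ∀ y ∈ Set.Icc a (a+1), 0 < y := fun y hy => by linarith [hy.1]
  have := norm_image_sub_le_of_norm_deriv_le_segment' (f := fun y : ℝ => (y : ℂ) ^ (-s))
    (f' := fun y : ℝ => (-s) * (y : ℂ) ^ (-s - 1)) (a := a) (b := a + 1)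
    (C := ‖s‖ * a ^ (-s.re - 1)) ?_ ?_ x hx
  · refine this.trans ?_
    have h1 : x - a ≤ 1 := by linarith [hx.2]
    have : 0 ≤ ‖s‖ * a ^ (-s.re - 1) := by positivity
    nlinarith [hx.1]
  · intro y hy
    have hy0 := hpos y hy
    have hs0 : -s ≠ 0 := fun h => by simp at h; simp [h] at hs
    exact (hasDerivAt_ofReal_cpow_const (x := y) hy0.ne' hs0).hasDerivWithinAt
  · intro y hy
    have hy0 := hpos y ⟨hy.1, hy.2.le⟩
    rw [norm_mul, norm_neg, norm_cpow_eq_rpow_re_of_pos hy0]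
    gcongr
    simp only [sub_re, neg_re, one_re]
    exact Real.rpow_le_rpow_of_nonpos (by linarith) hy.1 (by linarith)

lemma hterm_bound (n : ℕ) {s : ℂ} (hs : 0 < s.re) :
    ‖hterm n s‖ ≤ ‖s - 1‖ * ‖s‖ * ((n : ℝ) + 1) ^ (-s.re - 1) := by
  by_cases h1 : s = 1
  · subst h1; simp [hterm]
  set a : ℝ := n + 1 with ha
  have ha1 : 1 ≤ a := by simp [ha]
  have hpos : ∀ y ∈ Set.Icc a (a+1), 0 < y := fun y hy => by linarith [hy.1]
  have := norm_image_sub_le_of_norm_deriv_le_segment'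
    (f := fun y : ℝ => (s - 1) * (y * (a : ℂ) ^ (-s)) + (y : ℂ) ^ (1 - s))
    (f' := fun y : ℝ => (s - 1) * ((a : ℂ) ^ (-s) - (y : ℂ) ^ (-s))) (a := a) (b := a + 1)
    (C := ‖s - 1‖ * ‖s‖ * a ^ (-s.re - 1)) ?_ ?_ (a + 1) (by constructor <;> linarith)
  · have e : hterm n s = ((s - 1) * ((a + 1 : ℝ) * (a : ℂ) ^ (-s)) + ((a + 1 : ℝ) : ℂ) ^ (1 - s))
      - ((s - 1) * (a * (a : ℂ) ^ (-s)) + (a : ℂ) ^ (1 - s)) := by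
      rw [hterm]
      have e1 : ((n + 1 : ℕ) : ℂ) = (a : ℂ) := by simp [ha]
      have e2 : ((n + 2 : ℕ) : ℂ) = ((a + 1 : ℝ) : ℂ) := by simp [ha]; ring
      rw [e1, e2]; push_cast; ring
    rw [e]
    simpa using this
  · intro y hy
    have hy0 := hpos y hy
    have h2 : (1 - s) ≠ 0 := fun h => h1 (by linear_combination -h)
    have d1 := hasDerivAt_ofReal_cpow_const (x := y) hy0.ne' h2
    have d2 : HasDerivAt (fun y : ℝ => (s - 1) * ((y : ℂ) * (a : ℂ) ^ (-s))) ((s - 1) * (1 * (a : ℂ) ^ (-s))) y :=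
      ((HasDerivAt.ofReal_comp (hasDerivAt_id y)).mul_const _).const_mul _
    refine HasDerivAt.hasDerivWithinAt ?_
    convert d2.fun_add d1 using 1
    have : 1 - s - 1 = -s := by ring
    rw [this]; ring
  · intro y hy
    have := cpow_diff_bound ha1 ⟨hy.1, hy.2.le⟩ hs
    rw [norm_sub_rev] at this
    rw [norm_mul, mul_assoc]
    gcongr

lemma hterm_diff (n : ℕ) : Differentiable ℂ (hterm n) := by
  unfold hterm
  have h1 : ((n + 1 : ℕ) : ℂ) ≠ 0 := by exact_mod_cast Nat.succ_ne_zero n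
  have h2 : ((n + 2 : ℕ) : ℂ) ≠ 0 := by exact_mod_cast Nat.succ_ne_zero (n+1)
  intro s
  refine DifferentiableAt.add (DifferentiableAt.mul (by fun_prop) ?_) (DifferentiableAt.sub ?_ ?_)
  · exact DifferentiableAt.const_cpow (by fun_prop) (Or.inl h1)
  · exact DifferentiableAt.const_cpow (by fun_prop) (Or.inl h2)
  · exact DifferentiableAt.const_cpow (by fun_prop) (Or.inl h1)

lemma summable_aux {c : ℝ} (hc : 0 < c) : Summable fun n : ℕ => ((n : ℝ) + 1) ^ (-c - 1) := by
  have := (summable_nat_add_iff 1).2 (Real.summable_nat_rpow (p := -c-1) |>.2 (by linarith))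
  simpa using this

lemma tsum_hterm_of_one_lt {s : ℂ} (hs : 1 < s.re) :
    riemannZeta₁ s = 1 + ∑' n, hterm n s := by
  have h1 : s ≠ 1 := fun h => by simp [h] at hs
  have hz : riemannZeta₁ s = (s - 1) * riemannZeta s := by
    rw [riemannZeta_eq_inv_sub_mul h1, mul_inv_cancel_left₀ (sub_ne_zero.2 h1)]
  rw [hz]
  have hsum : HasSum (fun n : ℕ => 1 / ((n : ℂ) + 1) ^ s) (riemannZeta s) := by
    rw [zeta_eq_tsum_one_div_nat_add_one_cpow hs]
    refine Summable.hasSum ?_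
    have := (summable_nat_add_iff 1).2 (Complex.summable_one_div_nat_cpow.2 hs)
    simpa using this
  have htel : HasSum (fun n : ℕ => (((n + 2 : ℕ) : ℂ) ^ (1 - s) - ((n + 1 : ℕ) : ℂ) ^ (1 - s))) (0 - 1) := by
    have hs2 : Summable (hterm · s) := by
      refine Summable.of_norm_bounded (g := fun n : ℕ => ‖s - 1‖ * ‖s‖ * ((n : ℝ) + 1) ^ (-s.re - 1)) ?_ (fun n => hterm_bound n (by linarith))
      exact (summable_aux (by linarith)).mul_left _
    have hs3 : Summable (fun n : ℕ => (((n + 2 : ℕ) : ℂ) ^ (1 - s) - ((n + 1 : ℕ) : ℂ) ^ (1 - s))) := by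
      have := hs2.sub (hsum.summable.mul_left (s - 1))
      refine this.congr (fun n => ?_)
      rw [hterm, Complex.cpow_neg]; push_cast; ring
    refine (hs3.hasSum_iff_tendsto_nat).2 ?_
    have e : ∀ N : ℕ, ∑ n ∈ Finset.range N, (((n + 2 : ℕ) : ℂ) ^ (1 - s) - ((n + 1 : ℕ) : ℂ) ^ (1 - s)) =
        ((N + 1 : ℕ) : ℂ) ^ (1 - s) - 1 := by
      intro N
      have := Finset.sum_range_sub (fun n : ℕ => ((n + 1 : ℕ) : ℂ) ^ (1 - s)) N
      have e3 : ∀ x : ℕ, (x : ℂ) + 1 + 1 = x + 2 := fun x => by ring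
      simpa [e3] using this
    simp_rw [e]
    refine Tendsto.sub_const ?_ 1
    rw [tendsto_zero_iff_norm_tendsto_zero]
    have e2 : ∀ N : ℕ, ‖((N + 1 : ℕ) : ℂ) ^ (1 - s)‖ = ((N + 1 : ℕ) : ℝ) ^ (-(s.re - 1)) := by
      intro N
      have := norm_cpow_eq_rpow_re_of_pos (x := ((N + 1 : ℕ) : ℝ)) (by positivity) (1 - s)
      simp at this ⊢
      rw [this]
    simp_rw [e2]
    exact (tendsto_rpow_neg_atTop (by linarith)).comp
      ((tendsto_natCast_atTop_atTop).comp (tendsto_add_atTop_nat 1))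
  have := (hsum.mul_left (s - 1)).add htel
  have h3 : ∀ n : ℕ, hterm n s = (s - 1) * (1 / ((n : ℂ) + 1) ^ s) +
      (((n + 2 : ℕ) : ℂ) ^ (1 - s) - ((n + 1 : ℕ) : ℂ) ^ (1 - s)) := by
    intro n; rw [hterm, Complex.cpow_neg]; push_cast; ring
  rw [tsum_congr h3, this.tsum_eq]; ring

lemma zeta1_eq {s : ℂ} (hs : 0 < s.re) : riemannZeta₁ s = 1 + ∑' n, hterm n s := by
  have hU : IsOpen {s : ℂ | 0 < s.re} := isOpen_lt continuous_const continuous_re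
  have hd : DifferentiableOn ℂ (fun s => 1 + ∑' n, hterm n s) {s : ℂ | 0 < s.re} := by
    intro w hw
    have hw' : 0 < w.re := hw
    set V : Set ℂ := {s : ℂ | w.re / 2 < s.re} ∩ Metric.ball w 1
    have hV : IsOpen V := (isOpen_lt continuous_const continuous_re).inter Metric.isOpen_ball
    have hwV : w ∈ V := ⟨by simp only [Set.mem_ofPred_eq]; linarith, by simp⟩
    have : DifferentiableOn ℂ (fun s => ∑' n, hterm n s) V := by
      refine differentiableOn_tsum_of_summable_norm
        (u := fun n : ℕ => (‖w‖ + 2) * (‖w‖ + 2) * ((n : ℝ) + 1) ^ (-(w.re/2) - 1))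
        ((summable_aux (by linarith)).mul_left _) (fun n => (hterm_diff n).differentiableOn) hV ?_
      intro n s hs
      have h1 : ‖s - w‖ < 1 := by simpa [dist_eq_norm] using hs.2
      have h2 : w.re / 2 < s.re := hs.1
      have h3 : ‖s‖ ≤ ‖w‖ + 1 := by
        have := norm_add_le (s - w) w
        simp at this; linarith
      have h4 : ‖s - 1‖ ≤ ‖w‖ + 2 := by
        have := norm_sub_le s 1
        simp at this; linarith
      refine (hterm_bound n (by linarith)).trans ?_
      gcongr
      · linarith
      · linarith
    exact (((this w hwV).differentiableAt (hV.mem_nhds hwV)).const_add 1).differentiableWithinAt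
  have := AnalyticOnNhd.eqOn_of_preconnected_of_eventuallyEq (𝕜 := ℂ)
    (f := riemannZeta₁) (g := fun s => 1 + ∑' n, hterm n s) (U := {s : ℂ | 0 < s.re})
    (differentiable_riemannZeta₁.differentiableOn.analyticOnNhd hU) (hd.analyticOnNhd hU)
    (convex_halfSpace_re_gt 0).isPreconnected (z₀ := 2) (by simp) ?_
  · exact this hs
  · have : {s : ℂ | 1 < s.re} ∈ nhds (2:ℂ) :=
      (isOpen_lt continuous_const continuous_re).mem_nhds (by simp)
    filter_upwards [this] with s hs
    exact tsum_hterm_of_one_lt hs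

lemma zeta1_growth : ∃ C : ℝ, 0 < C ∧ ∀ s : ℂ, 1/4 ≤ s.re → ‖riemannZeta₁ s‖ ≤ C * (1 + ‖s‖) ^ 2 := by
  set A := ∑' n : ℕ, ((n : ℝ) + 1) ^ (-(1/4 : ℝ) - 1) with hA
  have hsA := summable_aux (c := 1/4) (by norm_num)
  have hA0 : 0 ≤ A := tsum_nonneg (fun n => by positivity)
  refine ⟨1 + A, by linarith, fun s hs => ?_⟩
  rw [zeta1_eq (by linarith)]
  have hb : ∀ n, ‖hterm n s‖ ≤ (1 + ‖s‖)^2 * ((n : ℝ) + 1) ^ (-(1/4 : ℝ) - 1) := by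
    intro n
    refine (hterm_bound n (by linarith)).trans ?_
    have h4 : ‖s - 1‖ ≤ 1 + ‖s‖ := by
      have := norm_sub_le s 1
      simp at this; linarith
    rw [pow_two]
    gcongr
    · linarith
    · linarith
  have h1 : ‖∑' n, hterm n s‖ ≤ (1 + ‖s‖)^2 * A := by
    rw [hA, ← tsum_mul_left]
    exact tsum_of_norm_bounded (hsA.mul_left _).hasSum hb
  have h2 : 1 ≤ (1 + ‖s‖)^2 := by nlinarith [norm_nonneg s]
  calc _ ≤ ‖(1:ℂ)‖ + _ := norm_add_le _ _
    _ ≤ 1 + (1 + ‖s‖)^2 * A := by rw [norm_one]; gcongr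
    _ ≤ _ := by nlinarith

end SB


namespace SB

/-- The Riemann hypothesis, as phrased in the statement. -/
def RHyp : Prop := ∀ ρ : ℂ, riemannZeta ρ = 0 → 0 ≤ ρ.re → ρ.re ≤ 1 → ρ.re = 1 / 2

lemma zeta1_eq_mul {s : ℂ} (hs : s ≠ 1) : riemannZeta₁ s = (s - 1) * riemannZeta s := by
  rw [riemannZeta_eq_inv_sub_mul hs, mul_inv_cancel_left₀ (sub_ne_zero.2 hs)]

lemma zeta_ne_zero (RH : RHyp) {s : ℂ} (hs : 1 / 2 < s.re) : riemannZeta s ≠ 0 := by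
  rcases le_or_gt 1 s.re with h | h
  · exact riemannZeta_ne_zero_of_one_le_re h
  · intro h0
    have := RH s h0 (by linarith) h.le
    linarith

lemma zeta1_ne_zero (RH : RHyp) {s : ℂ} (hs : 1 / 2 < s.re) : riemannZeta₁ s ≠ 0 := by
  by_cases h : s = 1
  · rw [h, riemannZeta₁_one]; exact one_ne_zero
  · rw [zeta1_eq_mul h]
    exact mul_ne_zero (sub_ne_zero.2 h) (zeta_ne_zero RH hs)

lemma zeta_lower {s : ℂ} (hs : 2 ≤ s.re) : 1 / 4 ≤ ‖riemannZeta s‖ := by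
  have h1 : 1 < s.re := by linarith
  have hsm : Summable (fun n : ℕ => 1 / (n : ℂ) ^ s) := Complex.summable_one_div_nat_cpow.2 h1
  have hz := zeta_eq_tsum_one_div_nat_cpow h1
  have hs0 : s ≠ 0 := fun h => by simp [h] at h1; linarith
  have h2 := hsm.sum_add_tsum_nat_add 2
  have h3 := hasSum_zeta_two.summable.sum_add_tsum_nat_add 2
  rw [hasSum_zeta_two.tsum_eq] at h3
  rw [← hz] at h2
  simp [Finset.sum_range_succ, hs0] at h2 h3
  have h4 : ‖∑' n : ℕ, (((n : ℂ) + 2) ^ s)⁻¹‖ ≤ ∑' n : ℕ, (((n : ℝ) + 2) ^ 2)⁻¹ := by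
    refine tsum_of_norm_bounded (g := fun n : ℕ => (((n : ℝ) + 2) ^ 2)⁻¹) ?_ ?_
    · refine Summable.hasSum ?_
      have := (summable_nat_add_iff 2).2 hasSum_zeta_two.summable
      simpa using this
    · intro n
      have e : ((n : ℂ) + 2) = (((n : ℝ) + 2 : ℝ) : ℂ) := by push_cast; ring
      have hp : (0:ℝ) < n + 2 := by positivity
      rw [norm_inv, e, norm_cpow_eq_rpow_re_of_pos hp]
      gcongr
      rw [← Real.rpow_natCast]
      apply Real.rpow_le_rpow_of_exponent_le
      · have : (0:ℝ) ≤ n := Nat.cast_nonneg n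
        linarith
      · simpa using hs
  have h5 : π ^ 2 / 6 < 1.66 := by
    have := Real.pi_lt_d2
    have := Real.pi_pos
    nlinarith
  have h6 : ‖(1 : ℂ)‖ ≤ ‖riemannZeta s‖ + ‖∑' n : ℕ, (((n : ℂ) + 2) ^ s)⁻¹‖ := by
    rw [← h2]
    have := norm_sub_le (1 + ∑' n : ℕ, (((n : ℂ) + 2) ^ s)⁻¹) (∑' n : ℕ, (((n : ℂ) + 2) ^ s)⁻¹)
    simpa using this
  simp at h6
  linarith

lemma zeta1_lower {s : ℂ} (hs : 2 ≤ s.re) : 1 / 4 ≤ ‖riemannZeta₁ s‖ := by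
  have h1 : s ≠ 1 := fun h => by simp [h] at hs
  rw [zeta1_eq_mul h1, norm_mul]
  have : 1 ≤ ‖s - 1‖ := by
    have := abs_re_le_norm (s - 1)
    have h2 := le_abs_self (s - 1).re
    simp at this h2; linarith
  nlinarith [zeta_lower hs, norm_nonneg (riemannZeta s)]

lemma logderiv_zeta1 {s : ℂ} (hs : s ≠ 1) (h0 : riemannZeta s ≠ 0) :
    deriv riemannZeta₁ s / riemannZeta₁ s = 1 / (s - 1) + deriv riemannZeta s / riemannZeta s := by
  have he : riemannZeta₁ =ᶠ[nhds s] fun z => (z - 1) * riemannZeta z := by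
    filter_upwards [isOpen_ne.mem_nhds hs] with z hz
    exact zeta1_eq_mul hz
  have hd : HasDerivAt (fun z => (z - 1) * riemannZeta z)
      (1 * riemannZeta s + (s - 1) * deriv riemannZeta s) s :=
    ((hasDerivAt_id s).sub_const 1).mul (differentiableAt_riemannZeta hs).hasDerivAt
  rw [he.deriv_eq, hd.deriv, zeta1_eq_mul hs]
  have := sub_ne_zero.2 hs
  field_simp

lemma logderiv_bound_two : ∃ B : ℝ, 0 < B ∧ ∀ s : ℂ, 2 ≤ s.re →
    ‖deriv riemannZeta₁ s / riemannZeta₁ s‖ ≤ B := by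
  have hsum : LSeriesSummable (fun n => (ArithmeticFunction.vonMangoldt n : ℂ)) 2 :=
    ArithmeticFunction.LSeriesSummable_vonMangoldt (by simp)
  refine ⟨1 + ∑' n, ‖LSeries.term (fun n => (ArithmeticFunction.vonMangoldt n : ℂ)) 2 n‖,
    by positivity, fun s hs => ?_⟩
  have h1 : s ≠ 1 := fun h => by simp [h] at hs
  have hre : 1 < s.re := by linarith
  rw [logderiv_zeta1 h1 (riemannZeta_ne_zero_of_one_lt_re hre)]
  have hL := ArithmeticFunction.LSeries_vonMangoldt_eq_deriv_riemannZeta_div hre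
  have : deriv riemannZeta s / riemannZeta s =
    - LSeries (fun n => (ArithmeticFunction.vonMangoldt n : ℂ)) s := by
    rw [hL]; ring
  rw [this]
  refine (norm_add_le _ _).trans (add_le_add ?_ ?_)
  · have : 1 ≤ ‖s - 1‖ := by
      have := abs_re_le_norm (s - 1)
      have h2 := le_abs_self (s - 1).re
      simp at this h2; linarith
    rw [norm_div, norm_one, div_le_one (by linarith)]
    exact this
  · rw [norm_neg]
    refine tsum_of_norm_bounded hsum.norm.hasSum fun n => ?_
    exact LSeries.norm_term_le_of_re_le_re _ (by simpa using hs) n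

lemma exists_log {F : ℂ → ℂ} {c : ℂ} {r : ℝ} (hr : 0 < r) (hF : DifferentiableOn ℂ F (Metric.ball c r))
    (h0 : ∀ z ∈ Metric.ball c r, F z ≠ 0) : ∃ g : ℂ → ℂ, g c = 0 ∧
      (∀ z ∈ Metric.ball c r, HasDerivAt g (deriv F z / F z) z) ∧
      ∀ z ∈ Metric.ball c r, F z = F c * cexp (g z) := by
  have hd : DifferentiableOn ℂ (fun z => deriv F z / F z) (Metric.ball c r) :=
    (hF.deriv Metric.isOpen_ball).div hF h0
  obtain ⟨g, hg0, hg⟩ := hd.isExactOn_ball.with_val_at c 0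
  refine ⟨g, hg0, hg, ?_⟩
  have hcon : ∀ z ∈ Metric.ball c r, HasDerivAt (fun z => F z * cexp (-g z)) 0 z := by
    intro z hz
    have h1 := (hF.differentiableAt (Metric.isOpen_ball.mem_nhds hz)).hasDerivAt
    have h2 := (hg z hz).fun_neg.cexp
    have h3 : F z * (deriv F z / F z) = deriv F z := mul_div_cancel₀ _ (h0 z hz)
    exact (h1.fun_mul h2).congr_deriv (by linear_combination -cexp (-g z) * h3)
  intro z hz
  have := (convex_ball c r).is_const_of_fderivWithin_eq_zero (𝕜 := ℂ) (f := fun z => F z * cexp (-g z))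
    (fun z hz => (hcon z hz).differentiableAt.differentiableWithinAt) (fun z hz => by
      rw [fderivWithin_of_isOpen Metric.isOpen_ball hz]
      ext; simp [(hcon z hz).deriv]) hz (Metric.mem_ball_self hr)
  simp only [hg0, neg_zero, Complex.exp_zero, mul_one] at this
  rw [← this, mul_assoc, ← Complex.exp_add]; simp

/-- local logarithm of `riemannZeta₁` around `2 + iu`. -/
lemma local_log (RH : RHyp) : ∃ A : ℝ, 0 < A ∧ ∀ u : ℝ, ∃ g : ℂ → ℂ,
    (∀ z ∈ Metric.ball (2 + u * I) (3/2), HasDerivAt g (deriv riemannZeta₁ z / riemannZeta₁ z) z) ∧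
    (∀ z ∈ Metric.ball (2 + u * I) (3/2), riemannZeta₁ z = riemannZeta₁ (2 + u * I) * cexp (g z)) ∧
    ∀ δ : ℝ, 0 < δ → ∀ z : ℂ, ‖z - (2 + u * I)‖ ≤ 3/2 - δ →
      ‖g z‖ ≤ A * (1 + |u|) ^ (1/2 : ℝ) / δ := by
  obtain ⟨C, hC, hgr⟩ := zeta1_growth
  set A0 : ℝ := |Real.log (4 * C)| + 1 with hA0
  have hA0p : 0 < A0 := by positivity
  refine ⟨3 * (A0 + 20), by positivity, fun u => ?_⟩
  set c : ℂ := 2 + u * I with hc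
  have hcre : c.re = 2 := by simp [hc]
  have hball : ∀ z ∈ Metric.ball c (3/2), 1/2 < z.re := by
    intro z hz
    rw [Metric.mem_ball, dist_eq_norm] at hz
    have := (abs_re_le_norm (z - c)).trans_lt hz
    rw [sub_re, hcre] at this
    linarith [(abs_lt.1 this).1]
  obtain ⟨g, hg0, hg, hge⟩ := exists_log (F := riemannZeta₁) (c := c) (r := 3/2) (by norm_num)
    differentiable_riemannZeta₁.differentiableOn (fun z hz => zeta1_ne_zero RH (hball z hz))
  refine ⟨g, hg, hge, fun δ hδ z hz => ?_⟩
  set M := A0 + 2 * Real.log (5 + |u|) with hM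
  have hlog5 : 0 < Real.log (5 + |u|) := Real.log_pos (by linarith [abs_nonneg u])
  have hMp : 0 < M := by positivity
  have hre : ∀ w ∈ Metric.ball c (3/2), (g w).re ≤ M := by
    intro w hw
    have h1 := hge w hw
    have h2 : ‖riemannZeta₁ w‖ = ‖riemannZeta₁ c‖ * Real.exp (g w).re := by
      rw [h1, norm_mul, Complex.norm_exp]
    have h3 := zeta1_lower (s := c) hcre.ge
    have h4 := hgr w (by linarith [hball w hw])
    have h5 : 1 + ‖w‖ ≤ 5 + |u| := by
      rw [Metric.mem_ball, dist_eq_norm] at hw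
      have h6 : ‖c‖ ≤ 2 + |u| := by
        refine (norm_add_le _ _).trans ?_
        simp
      have := norm_add_le (w - c) c
      simp at this
      linarith
    have h6 : Real.exp (g w).re ≤ 4 * C * (5 + |u|) ^ 2 := by
      have : (1/4) * Real.exp (g w).re ≤ C * (5 + |u|) ^ 2 := by
        calc (1/4) * Real.exp (g w).re ≤ ‖riemannZeta₁ c‖ * Real.exp (g w).re := by gcongr
          _ = _ := h2.symm
          _ ≤ _ := h4
          _ ≤ _ := by gcongr
      linarith
    have h7 := Real.log_le_log (Real.exp_pos _) h6
    rw [Real.log_exp, Real.log_mul (by positivity) (by positivity), Real.log_pow] at h7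
    push_cast at h7
    have := le_abs_self (Real.log (4 * C))
    linarith
  have hd : DifferentiableOn ℂ (fun w => g (c + w)) (Metric.ball 0 (3/2)) := by
    intro w hw
    have hw' : c + w ∈ Metric.ball c (3/2) := by simpa [dist_eq_norm] using hw
    have : HasDerivAt (fun w => g (c + w)) _ w := (hg _ hw').comp_const_add c w
    exact this.differentiableAt.differentiableWithinAt
  have hzb : z - c ∈ Metric.ball (0:ℂ) (3/2) := by
    rw [mem_ball_zero_iff]; linarith
  have := borelCaratheodory_zero (f := fun w => g (c + w)) (z := z - c) hMp hd (fun w hw => by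
    have hw' : c + w ∈ Metric.ball c (3/2) := by simpa [dist_eq_norm] using hw
    exact hre _ hw') (by norm_num) hzb (by simpa using hg0)
  simp only [add_sub_cancel] at this
  refine this.trans ?_
  have hx1 : 1 ≤ (1 + |u|) ^ (1/2 : ℝ) := Real.one_le_rpow (by linarith [abs_nonneg u]) (by norm_num)
  have hMle : M ≤ (A0 + 20) * (1 + |u|) ^ (1/2 : ℝ) := by
    have h1 : Real.log (5 + |u|) ≤ (5 * (1 + |u|)) ^ (1/2 : ℝ) / (1/2) :=
      (Real.log_le_log (by positivity) (by linarith [abs_nonneg u])).trans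
        (Real.log_le_rpow_div (by positivity) (by norm_num))
    rw [Real.mul_rpow (by norm_num) (by positivity)] at h1
    have h2 : (5:ℝ) ^ (1/2 : ℝ) ≤ 5 := by
      calc (5:ℝ) ^ (1/2 : ℝ) ≤ 5 ^ (1:ℝ) := Real.rpow_le_rpow_of_exponent_le (by norm_num) (by norm_num)
        _ = 5 := by simp
    nlinarith
  have hpos : 0 < 3/2 - ‖z - c‖ := by linarith
  calc 2 * M * ‖z - c‖ / (3/2 - ‖z - c‖) ≤ 2 * M * (3/2) / δ := by
        gcongr <;> linarith
    _ = 3 * M / δ := by ring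
    _ ≤ 3 * ((A0 + 20) * (1 + |u|) ^ (1/2 : ℝ)) / δ := by gcongr
    _ = _ := by ring

lemma growth (RH : RHyp) {δ : ℝ} (hδ : 0 < δ) : ∃ C : ℝ, 0 < C ∧ ∀ s : ℂ, 1/2 + δ ≤ s.re →
    ‖deriv riemannZeta₁ s / riemannZeta₁ s‖ ≤ C * (1 + |s.im|) ^ (1/2 : ℝ) ∧
    ‖(riemannZeta₁ s)⁻¹‖ ≤ Real.exp (C * (1 + |s.im|)) := by
  obtain ⟨A, hA, hlog⟩ := local_log RH
  obtain ⟨B, hB, hB2⟩ := logderiv_bound_two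
  refine ⟨A / (δ/2) / (δ/2) + A / δ + B + 4, by positivity, fun s hs => ?_⟩
  have hx1 : 1 ≤ (1 + |s.im|) ^ (1/2 : ℝ) := Real.one_le_rpow (by linarith [abs_nonneg s.im]) (by norm_num)
  have hx2 : (1 + |s.im|) ^ (1/2 : ℝ) ≤ 1 + |s.im| := by
    calc _ ≤ (1 + |s.im|) ^ (1 : ℝ) := Real.rpow_le_rpow_of_exponent_le (by linarith [abs_nonneg s.im]) (by norm_num)
      _ = _ := by simp
  have h4 : (4:ℝ) ≤ Real.exp 4 := by linarith [Real.add_one_le_exp (4:ℝ)]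
  set X := (1 + |s.im|) ^ (1/2 : ℝ)
  have p1 : 0 ≤ A / (δ/2) / (δ/2) := by positivity
  have p2 : 0 ≤ A / δ := by positivity
  rcases le_or_gt 2 s.re with h2 | h2
  · constructor
    · refine (hB2 s h2).trans ?_
      have : B * 1 ≤ B * X := by gcongr
      nlinarith
    · have := zeta1_lower h2
      rw [norm_inv]
      calc _ ≤ (1/4 : ℝ)⁻¹ := by gcongr
        _ ≤ Real.exp 4 := by norm_num; exact h4
        _ ≤ _ := by
          apply Real.exp_le_exp.2
          nlinarith
  · obtain ⟨g, hg, hge, hgb⟩ := hlog s.im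
    have e : s - (2 + s.im * I) = ((s.re - 2 : ℝ) : ℂ) := by
      apply Complex.ext <;> simp
    have en : ‖s - (2 + s.im * I)‖ ≤ 3/2 - δ := by
      rw [e, norm_real, Real.norm_eq_abs, abs_of_neg (by linarith)]; linarith
    have hsb : s ∈ Metric.ball (2 + s.im * I) (3/2) := by
      rw [Metric.mem_ball, dist_eq_norm]; linarith
    constructor
    · rw [← (hg s hsb).deriv]
      have hsub : Metric.closedBall s (δ/2) ⊆ Metric.ball (2 + s.im * I) (3/2) := by
        intro w hw
        rw [Metric.mem_closedBall, dist_eq_norm] at hw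
        rw [Metric.mem_ball, dist_eq_norm]
        have := norm_add_le (w - s) (s - (2 + s.im * I))
        rw [sub_add_sub_cancel] at this
        linarith
      have := norm_deriv_le_of_forall_mem_sphere_norm_le (c := s) (R := δ/2) (f := g)
        (C := A * X / (δ/2)) (by positivity) ?_ ?_
      · refine this.trans ?_
        have e2 : A * X / (δ/2) / (δ/2) = A / (δ/2) / (δ/2) * X := by ring
        rw [e2]
        gcongr
        linarith
      · refine DifferentiableOn.diffContOnCl ?_
        rw [closure_ball _ (by positivity)]
        exact fun w hw => (hg w (hsub hw)).differentiableAt.differentiableWithinAt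
      · intro w hw
        rw [mem_sphere_iff_norm] at hw
        refine hgb _ (by positivity) w ?_
        have := norm_add_le (w - s) (s - (2 + s.im * I))
        rw [sub_add_sub_cancel] at this
        linarith
    · rw [hge s hsb, mul_inv, norm_mul, ← Complex.exp_neg, Complex.norm_exp]
      have h3 := zeta1_lower (s := 2 + s.im * I) (by simp)
      have h5 : ‖(riemannZeta₁ (2 + s.im * I))⁻¹‖ ≤ Real.exp 4 := by
        rw [norm_inv]
        calc _ ≤ (1/4 : ℝ)⁻¹ := by gcongr
          _ ≤ _ := by norm_num; exact h4
      have h6 : (-g s).re ≤ A / δ * X := by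
        calc (-g s).re ≤ ‖-g s‖ := re_le_norm _
          _ = ‖g s‖ := norm_neg _
          _ ≤ A * X / δ := hgb δ hδ s en
          _ = _ := by ring
      calc _ ≤ Real.exp 4 * Real.exp (A / δ * X) := by gcongr
        _ = Real.exp (4 + A / δ * X) := by rw [Real.exp_add]
        _ ≤ _ := by
          apply Real.exp_le_exp.2
          nlinarith

end SB


namespace SB

lemma log_sum_lower (y : ℝ) (n : ℕ) :
    Real.log ((n : ℝ) + 1) - Real.log (|y| + 2) - 3/2 + (3/2) / ((n : ℝ) + 1) ≤
      ∑ j ∈ Finset.range n, ((j : ℝ) + 1) / (((j : ℝ) + 2) ^ 2 + y ^ 2) := by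
  have key : ∀ n : ℕ, Real.log (((n : ℝ) + 2)^2 + y^2) / 2 - Real.log (4 + y^2) / 2
      - 3/2 + (3/2) / ((n : ℝ) + 1) ≤
      ∑ j ∈ Finset.range n, ((j : ℝ) + 1) / (((j : ℝ) + 2) ^ 2 + y ^ 2) := by
    intro n
    induction n with
    | zero => norm_num
    | succ n ih =>
      rw [Finset.sum_range_succ]
      refine le_trans ?_ (add_le_add_left ih _)
      push_cast
      set m : ℝ := (n : ℝ) + 2 with hm
      have hm2 : 2 ≤ m := by have : (0:ℝ) ≤ n := Nat.cast_nonneg n; linarith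
      have hp : 0 < m ^ 2 + y ^ 2 := by positivity
      have h1 : Real.log ((m + 1)^2 + y^2) ≤ Real.log (m^2 + y^2) + (2 * m + 1) / (m^2+y^2) := by
        have : (m + 1)^2 + y^2 = (m^2+y^2) * (1 + (2 * m + 1) / (m^2+y^2)) := by field_simp; ring
        rw [this, Real.log_mul hp.ne' (by positivity)]
        have := Real.log_le_sub_one_of_pos (x := 1 + (2 * m + 1) / (m^2+y^2)) (by positivity)
        linarith
      have h2 : (3/2) / (m^2 + y^2) ≤ (3/2) / (m - 1) - (3/2) / m := by
        have : (3/2) / (m - 1) - (3/2) / m = (3/2) / (m * (m-1)) := by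
          have : m - 1 ≠ 0 := by linarith
          field_simp; ring
        rw [this]
        apply div_le_div_of_nonneg_left (by norm_num) (by nlinarith)
        nlinarith [sq_nonneg y]
      have e1 : (n : ℝ) + 1 + 2 = m + 1 := by rw [hm]; ring
      have e2 : (n : ℝ) + 1 + 1 = m := by rw [hm]; ring
      have e3 : (n : ℝ) + 1 = m - 1 := by rw [hm]; ring
      rw [e1, e2, e3]
      have e4 : (2 * m + 1) / (m^2+y^2) = 2 * ((m - 1) / (m^2+y^2)) + 2 * ((3/2) / (m^2+y^2)) := by ring
      linarith
  refine le_trans ?_ (key n)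
  have hn : (0:ℝ) ≤ n := Nat.cast_nonneg n
  have h1 : Real.log ((n : ℝ) + 1) ≤ Real.log (((n : ℝ) + 2)^2 + y^2) / 2 := by
    have : Real.log (((n : ℝ) + 1)^2) ≤ Real.log (((n : ℝ) + 2)^2 + y^2) :=
      Real.log_le_log (by positivity) (by nlinarith [sq_nonneg y])
    rw [Real.log_pow] at this; push_cast at this; linarith
  have h2 : Real.log (4 + y^2) / 2 ≤ Real.log (|y| + 2) := by
    have : Real.log (4 + y^2) ≤ Real.log ((|y| + 2)^2) :=
      Real.log_le_log (by positivity) (by rw [← sq_abs y]; nlinarith [abs_nonneg y])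
    rw [Real.log_pow] at this; push_cast at this; linarith
  linarith

lemma gamma_ratio {w : ℂ} (h1 : 1 ≤ w.re) (h2 : w.re ≤ 3/2) {h : ℝ} (h0 : 0 < h) (hh : h ≤ 1/2) :
    ‖Complex.Gamma (w + h)‖ ≤ ‖Complex.Gamma (w - h)‖ *
      Real.exp (2 * h * (Real.log (|w.im| + 2) + 3/2)) := by
  have t1 := (Complex.GammaSeq_tendsto_Gamma (w + h)).norm
  have t2 := ((Complex.GammaSeq_tendsto_Gamma (w - h)).norm).mul_const
    (Real.exp (2 * h * (Real.log (|w.im| + 2) + 3/2)))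
  refine le_of_tendsto_of_tendsto t1 t2 ?_
  filter_upwards [eventually_ge_atTop 1] with n hn
  have hn0 : (0:ℝ) < n := by exact_mod_cast hn
  set y := w.im
  have hfac : ∀ j : ℕ, ‖w - h + j‖ ≤ ‖w + h + j‖ *
      Real.exp (-(2 * h) * (((j : ℝ) + 1) / (((j : ℝ) + 2) ^ 2 + y ^ 2))) := by
    intro j
    have hj : (0:ℝ) ≤ j := Nat.cast_nonneg j
    set a := w.re + j with ha
    have e1 : ‖w - h + j‖ ^ 2 = (a - h)^2 + y^2 := by
      rw [Complex.sq_norm, Complex.normSq_apply]; simp [ha, y]; ring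
    have e2 : ‖w + h + j‖ ^ 2 = (a + h)^2 + y^2 := by
      rw [Complex.sq_norm, Complex.normSq_apply]; simp [ha, y]; ring
    have hap : 1 ≤ a := by linarith
    have hp : 0 < (a + h)^2 + y^2 := by positivity
    have h3 : ((j : ℝ) + 1) / (((j : ℝ) + 2) ^ 2 + y ^ 2) ≤ a / ((a+h)^2+y^2) := by
      have h31 : ((j : ℝ) + 1) ≤ a := by linarith
      have h32 : a + h ≤ (j : ℝ) + 2 := by linarith
      have h33 : 0 ≤ a + h := by linarith
      exact div_le_div₀ (by linarith) h31 hp (by gcongr)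
    refine abs_le_of_sq_le_sq' ?_ (by positivity) |>.2
    rw [mul_pow, e1, e2, ← Real.exp_nat_mul]
    have h4 : (a - h)^2 + y^2 = ((a+h)^2+y^2) * (1 - 4 * h * (a / ((a+h)^2+y^2))) := by
      field_simp; ring
    rw [h4]
    gcongr
    have := Real.add_one_le_exp (-(4 * h * (((j : ℝ) + 1) / (((j : ℝ) + 2) ^ 2 + y ^ 2))))
    have h5 : 4 * h * (((j : ℝ) + 1) / (((j : ℝ) + 2) ^ 2 + y ^ 2)) ≤ 4 * h * (a / ((a+h)^2+y^2)) := by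
      gcongr
    calc _ ≤ -(4 * h * (((j : ℝ) + 1) / (((j : ℝ) + 2) ^ 2 + y ^ 2))) + 1 := by linarith
      _ ≤ _ := this
      _ = _ := by congr 1; push_cast; ring
  have hprod : ‖∏ j ∈ Finset.range (n+1), (w - h + j)‖ ≤ ‖∏ j ∈ Finset.range (n+1), (w + h + j)‖ *
      Real.exp (-(2 * h) * ∑ j ∈ Finset.range (n+1), (((j : ℝ) + 1) / (((j : ℝ) + 2) ^ 2 + y ^ 2))) := by
    rw [norm_prod, norm_prod, Finset.mul_sum, Real.exp_sum, ← Finset.prod_mul_distrib]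
    exact Finset.prod_le_prod (fun _ _ => norm_nonneg _) (fun j _ => hfac j)
  have hprod2 : ‖∏ j ∈ Finset.range (n+1), (w - h + j)‖ ≤ ‖∏ j ∈ Finset.range (n+1), (w + h + j)‖ *
      Real.exp (-(2 * h) * (Real.log n - Real.log (|y| + 2) - 3/2)) := by
    refine hprod.trans ?_
    gcongr ?_ * Real.exp ?_
    have h6 := log_sum_lower y (n+1)
    have h7 : Real.log n ≤ Real.log (((n+1 : ℕ) : ℝ) + 1) := Real.log_le_log hn0 (by push_cast; linarith)
    have h8 : 0 ≤ (3/2) / (((n+1 : ℕ) : ℝ) + 1) := by positivity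
    have : (Real.log n - Real.log (|y| + 2) - 3/2) ≤
       ∑ j ∈ Finset.range (n+1), (((j : ℝ) + 1) / (((j : ℝ) + 2) ^ 2 + y ^ 2)) := by linarith
    nlinarith
  have hne : ∀ z : ℂ, 0 < z.re → ∏ j ∈ Finset.range (n+1), (z + j) ≠ 0 := by
    intro z hz
    refine Finset.prod_ne_zero_iff.2 fun j _ h => ?_
    have := congrArg Complex.re h
    simp at this
    have hj : (0:ℝ) ≤ j := Nat.cast_nonneg j
    linarith
  have p1 := norm_pos_iff.2 (hne (w - h) (by simp; linarith))
  have p2 := norm_pos_iff.2 (hne (w + h) (by simp; linarith))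
  simp only [Complex.GammaSeq, norm_div, norm_mul]
  have q1 : ‖(n : ℂ) ^ (w + h)‖ = (n : ℝ) ^ (w.re + h) := by
    have := norm_cpow_eq_rpow_re_of_pos hn0 (w + h)
    simpa using this
  have q2 : ‖(n : ℂ) ^ (w - h)‖ = (n : ℝ) ^ (w.re - h) := by
    have := norm_cpow_eq_rpow_re_of_pos hn0 (w - h)
    simpa using this
  rw [q1, q2]
  have q3 : (n : ℝ) ^ (w.re + h) = (n : ℝ) ^ (w.re - h) * Real.exp (2 * h * Real.log n) := by
    rw [Real.rpow_def_of_pos hn0, Real.rpow_def_of_pos hn0, ← Real.exp_add]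
    congr 1; ring
  rw [q3, div_mul_eq_mul_div, div_le_div_iff₀ p2 p1]
  set E := Real.exp (2 * h * Real.log n)
  set E' := Real.exp (2 * h * (Real.log (|y| + 2) + 3/2))
  have q4 : Real.exp (-(2 * h) * (Real.log n - Real.log (|y| + 2) - 3/2)) * E = E' := by
    rw [← Real.exp_add]; congr 1; ring
  calc (n : ℝ) ^ (w.re - h) * E * ‖(n.factorial : ℂ)‖ * ‖∏ j ∈ Finset.range (n+1), (w - h + j)‖
      ≤ (n : ℝ) ^ (w.re - h) * E * ‖(n.factorial : ℂ)‖ * (‖∏ j ∈ Finset.range (n+1), (w + h + j)‖ *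
      Real.exp (-(2 * h) * (Real.log n - Real.log (|y| + 2) - 3/2))) := by gcongr
    _ = _ := by rw [← q4]; ring

lemma gamma_ratio_beta {z : ℂ} (hz : 1 ≤ z.re) {c : ℝ} (hc : 0 < c) :
    ‖Complex.Gamma z / Complex.Gamma (z + c)‖ ≤ 1 / (c * Real.Gamma c) := by
  have h1 := Complex.Gamma_mul_Gamma_eq_betaIntegral (s := z) (t := c) (by linarith) (by simpa using hc)
  have h2 : Complex.Gamma (z + c) ≠ 0 := Complex.Gamma_ne_zero_of_re_pos (by simp; linarith)
  have h3 : Real.Gamma c ≠ 0 := (Real.Gamma_pos_of_pos hc).ne'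
  have h4 : Complex.Gamma z / Complex.Gamma (z + c) = Complex.betaIntegral z c / Real.Gamma c := by
    rw [Complex.Gamma_ofReal] at h1
    have : (Real.Gamma c : ℂ) ≠ 0 := by exact_mod_cast h3
    field_simp
    rw [mul_comm] at h1
    rw [mul_comm, h1]
  rw [h4, norm_div, norm_real, Real.norm_of_nonneg (Real.Gamma_pos_of_pos hc).le]
  have h5 : ‖Complex.betaIntegral z c‖ ≤ 1 / c := by
    have hInt : ∫ x in (0:ℝ)..1, (1 - x) ^ (c - 1) = 1 / c := by
      rw [intervalIntegral.integral_comp_sub_left (fun x : ℝ => x ^ (c - 1)) 1]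
      simp
      rw [integral_rpow (Or.inl (by linarith))]
      simp [hc.ne']
    rw [← hInt, Complex.betaIntegral]
    refine intervalIntegral.norm_integral_le_of_norm_le (by norm_num) ?_ ?_
    · have hae : ∀ᵐ x : ℝ, x ≠ 1 := by simp [ae_iff]
      filter_upwards [hae] with x hx1 hx
      have hx0 : 0 < x := hx.1
      have hx2 : 0 < 1 - x := by
        have := lt_of_le_of_ne hx.2 hx1
        linarith
      have e : (1 - (x : ℂ)) = ((1 - x : ℝ) : ℂ) := by push_cast; ring
      rw [norm_mul, e, norm_cpow_eq_rpow_re_of_pos hx0, norm_cpow_eq_rpow_re_of_pos hx2]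
      have h6 : x ^ (z - 1).re ≤ 1 := Real.rpow_le_one hx0.le hx.2 (by simp; linarith)
      have h7 : 0 ≤ (1 - x) ^ ((c : ℂ) - 1).re := by positivity
      calc _ ≤ 1 * (1 - x) ^ ((c : ℂ) - 1).re := by gcongr
        _ = _ := by simp
    · have := (intervalIntegral.intervalIntegrable_rpow' (a := 1) (b := 0) (r := c - 1) (by linarith)).comp_sub_left 1
      simpa using this
  rw [one_div, mul_inv, ← one_div, ← div_eq_mul_inv]
  gcongr


/-- The completed zeta function times `s(s-1)`, in a form valid for `Re s > 0`. -/
noncomputable def G (s : ℂ) : ℂ := 2 * (π : ℂ) ^ (-s / 2) * Complex.Gamma (s / 2 + 1) * riemannZeta₁ s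

lemma G_eq {a : ℂ} (h0 : 0 < a.re) (h1 : a.re < 1) :
    G a = a * (a - 1) * completedRiemannZeta a := by
  have ha0 : a ≠ 0 := fun h => by simp [h] at h0
  have ha1 : a ≠ 1 := fun h => by simp [h] at h1
  rw [G, zeta1_eq_mul ha1, riemannZeta_def_of_ne_zero ha0, Complex.Gamma_add_one _ (by simpa using ha0)]
  have hG := Gammaℝ_ne_zero_of_re_pos h0
  have e1 : completedRiemannZeta a = completedRiemannZeta a / Gammaℝ a * Gammaℝ a := by field_simp
  have e2 := Gammaℝ_def a
  calc _ = a * (a - 1) * (completedRiemannZeta a / Gammaℝ a * ((π : ℂ) ^ (-a / 2) * Complex.Gamma (a / 2))) := by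
        ring
    _ = _ := by rw [← e2, ← e1]

lemma norm_G_conj {a : ℂ} (h1 : a.re < 1) : ‖G (starRingEnd ℂ a)‖ = ‖G a‖ := by
  have ha1 : a ≠ 1 := fun h => by simp [h] at h1
  have ha2 : starRingEnd ℂ a ≠ 1 := fun h => by
    have := congrArg Complex.re h
    simp at this; linarith
  rw [G, G, zeta1_eq_mul ha1, zeta1_eq_mul ha2, riemannZeta_conj]
  have e1 : starRingEnd ℂ a / 2 + 1 = starRingEnd ℂ (a / 2 + 1) := by
    simp [show (starRingEnd ℂ) 2 = 2 from Complex.conj_ofNat 2]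
  have e2 : starRingEnd ℂ a - 1 = starRingEnd ℂ (a - 1) := by simp
  rw [e1, e2, Complex.Gamma_conj]
  simp only [norm_mul, Complex.norm_conj]
  congr 3
  rw [norm_cpow_eq_rpow_re_of_pos Real.pi_pos, norm_cpow_eq_rpow_re_of_pos Real.pi_pos]
  simp

lemma G_line {c : ℝ} (hc0 : 0 < c) (hc : c < 1/4) {s : ℂ} (hs : s.re = 1/2) :
    ‖G (s - c)‖ = ‖G (s + c)‖ := by
  have e : s - c = 1 - starRingEnd ℂ (s + c) := by
    apply Complex.ext
    · simp [hs]; ring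
    · simp
  have hr1 : 0 < (s - c).re := by simp [hs]; linarith
  have hr2 : (s - c).re < 1 := by simp [hs]; linarith
  have hr3 : 0 < (s + c).re := by simp [hs]; linarith
  have hr4 : (s + c).re < 1 := by simp [hs]; linarith
  rw [← norm_G_conj hr4, G_eq hr1 hr2, G_eq (by simpa using hr3) (by simpa using hr4), e,
    completedRiemannZeta_one_sub]
  simp only [norm_mul]
  rw [norm_sub_rev 1, show (1 - starRingEnd ℂ (s + c) - 1) = - starRingEnd ℂ (s + c) by ring, norm_neg]
  ring

lemma zeta_upper {s : ℂ} (hs : 2 ≤ s.re) : ‖riemannZeta s‖ ≤ 2 := by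
  have h1 : 1 < s.re := by linarith
  rw [zeta_eq_tsum_one_div_nat_add_one_cpow h1]
  have h := hasSum_zeta_two
  have hS : HasSum (fun n : ℕ => (1:ℝ) / ((n : ℝ) + 1) ^ 2) (π ^ 2 / 6) := by
    have := (hasSum_nat_add_iff' 1).2 hasSum_zeta_two
    simpa using this
  refine (tsum_of_norm_bounded hS fun n => ?_).trans ?_
  · have e : ((n : ℂ) + 1) = (((n : ℝ) + 1 : ℝ) : ℂ) := by push_cast; ring
    have hp : (0:ℝ) < n + 1 := by positivity
    rw [norm_div, norm_one, e, norm_cpow_eq_rpow_re_of_pos hp]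
    gcongr
    rw [← Real.rpow_natCast]
    apply Real.rpow_le_rpow_of_exponent_le
    · have : (0:ℝ) ≤ n := Nat.cast_nonneg n
      linarith
    · simpa using hs
  · have := Real.pi_lt_d2
    have := Real.pi_pos
    nlinarith

lemma G_ratio {c : ℝ} {s : ℂ} (hs : 1/2 ≤ s.re) (hc0 : 0 < c) (hc : c < 1/4) :
    ‖G (s - c) / G (s + c)‖ ≤ π ^ c * (1 / (c * Real.Gamma c)) *
      (‖riemannZeta₁ (s - c)‖ * ‖(riemannZeta₁ (s + c))⁻¹‖) := by
  have h2 : ‖(π : ℂ) ^ (-(s - c) / 2) / (π : ℂ) ^ (-(s + c) / 2)‖ = π ^ c := by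
    rw [norm_div, norm_cpow_eq_rpow_re_of_pos Real.pi_pos, norm_cpow_eq_rpow_re_of_pos Real.pi_pos,
      ← Real.rpow_sub Real.pi_pos]
    congr 1
    simp; ring
  have h3 := gamma_ratio_beta (z := (s - c) / 2 + 1) (by simp; linarith) hc0
  have e : (s - c) / 2 + 1 + c = (s + c) / 2 + 1 := by ring
  rw [e] at h3
  have e2 : G (s - c) / G (s + c) = ((π : ℂ) ^ (-(s - c) / 2) / (π : ℂ) ^ (-(s + c) / 2)) *
     (Complex.Gamma ((s - c) / 2 + 1) / Complex.Gamma ((s + c) / 2 + 1)) *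
     (riemannZeta₁ (s - c) * (riemannZeta₁ (s + c))⁻¹) := by
    rw [G, G]
    simp only [div_eq_mul_inv, mul_inv]
    ring
  rw [e2, norm_mul, norm_mul, h2, norm_mul]
  gcongr

lemma G_ne_zero (RH : RHyp) {s : ℂ} (hs : 1/2 < s.re) : G s ≠ 0 := by
  rw [G]
  refine mul_ne_zero (mul_ne_zero (mul_ne_zero two_ne_zero ?_) ?_) (zeta1_ne_zero RH hs)
  · rw [Complex.cpow_ne_zero_iff]; left; exact_mod_cast Real.pi_pos.ne'
  · exact Complex.Gamma_ne_zero_of_re_pos (by simp; linarith)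

lemma G_diff {s : ℂ} (hs : 0 < s.re) : DifferentiableAt ℂ G s := by
  unfold G
  refine DifferentiableAt.mul (DifferentiableAt.mul (DifferentiableAt.const_mul ?_ _) ?_)
    differentiable_riemannZeta₁.differentiableAt
  · exact DifferentiableAt.const_cpow (by fun_prop) (Or.inl (by exact_mod_cast Real.pi_pos.ne'))
  · refine (Complex.differentiableAt_Gamma _ fun m h => ?_).comp s (by fun_prop)
    have := congrArg Complex.re h
    simp at this
    have hj : (0:ℝ) ≤ m := Nat.cast_nonneg m
    linarith

lemma G_mono (RH : RHyp) {c : ℝ} (hc0 : 0 < c) (hc : c < 1/4) {s : ℂ} (hs : 1/2 ≤ s.re) :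
    ‖G (s - c)‖ ≤ ‖G (s + c)‖ := by
  have hpos : ∀ s : ℂ, 1/2 ≤ s.re → G (s + c) ≠ 0 := fun s hs =>
    G_ne_zero RH (by simp; linarith)
  suffices H : ∀ z : ℂ, 0 ≤ z.re → ‖G (z + 1/2 - c) / G (z + 1/2 + c)‖ ≤ 1 by
    have := H (s - 1/2) (by simp; linarith)
    rw [sub_add_cancel, norm_div, div_le_one (norm_pos_iff.2 (hpos s hs))] at this
    exact this
  intro z hz
  have hre : ∀ z : ℂ, (z + 1/2).re = z.re + 1/2 := by intro z; simp
  set K := π ^ c * (1 / (c * Real.Gamma c)) with hK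
  have hKp : 0 < K := by have := Real.Gamma_pos_of_pos hc0; positivity
  refine PhragmenLindelof.right_half_plane_of_bounded_on_real
    (f := fun z : ℂ => G (z + 1/2 - c) / G (z + 1/2 + c)) ?_ ?_ ?_ ?_ hz
  · refine DifferentiableOn.diffContOnCl fun w hw => ?_
    have hw0 : 0 ≤ w.re := by
      have : closure {z : ℂ | 0 < z.re} ⊆ {z : ℂ | 0 ≤ z.re} :=
        closure_minimal (fun z (hz : 0 < z.re) => show 0 ≤ z.re from le_of_lt hz) (isClosed_le continuous_const continuous_re)
      exact this hw
    have hr := hre w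
    have d1 : DifferentiableAt ℂ (fun z : ℂ => G (z + 1/2 - c)) w :=
      DifferentiableAt.comp (g := G) w (G_diff (by rw [sub_re, hr]; simp; linarith)) (by fun_prop)
    have d2 : DifferentiableAt ℂ (fun z : ℂ => G (z + 1/2 + c)) w :=
      DifferentiableAt.comp (g := G) w (G_diff (by rw [add_re, hr]; simp; linarith)) (by fun_prop)
    exact (d1.div d2 (hpos _ (by rw [hr]; linarith))).differentiableWithinAt
  · obtain ⟨C1, hC1, hg1⟩ := zeta1_growth
    obtain ⟨C2, hC2, hg2⟩ := growth RH hc0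
    refine ⟨1, by norm_num, C2 + 2, ?_⟩
    refine Asymptotics.IsBigO.of_bound (K * (C1 * 4 * Real.exp C2)) ?_
    have : {z : ℂ | 0 < z.re} ∈ Bornology.cobounded ℂ ⊓ 𝓟 {z : ℂ | 0 < z.re} :=
      mem_inf_of_right (mem_principal_self _)
    filter_upwards [this] with w hw
    have hw : 0 < w.re := hw
    have hr := hre w
    refine (G_ratio (by rw [hr]; linarith) hc0 hc).trans ?_
    rw [Real.norm_of_nonneg (Real.exp_pos _).le, Real.rpow_one, mul_assoc K]
    refine mul_le_mul_of_nonneg_left ?_ hKp.le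
    have a1 := hg1 (w + 1/2 - c) (by rw [sub_re, hr]; simp; linarith)
    have a2 := (hg2 (w + 1/2 + c) (by rw [add_re, hr]; simp; linarith)).2
    have im : (w + 1/2 + c).im = w.im := by simp
    rw [im] at a2
    have n1 : 1 + ‖w + 1/2 - c‖ ≤ 2 * Real.exp ‖w‖ := by
      have e0 : w + 1/2 - c = w + ((1/2 - c : ℝ) : ℂ) := by push_cast; ring
      rw [e0]
      have := norm_add_le w ((1/2 - c : ℝ) : ℂ)
      rw [norm_real, Real.norm_of_nonneg (by linarith)] at this
      have h3 := Real.add_one_le_exp ‖w‖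
      linarith [norm_nonneg w]
    calc _ ≤ (C1 * (2 * Real.exp ‖w‖)^2) * Real.exp (C2 * (1 + ‖w‖)) := by
          refine mul_le_mul (a1.trans ?_) (a2.trans ?_) (norm_nonneg _) (by positivity)
          · gcongr
          · apply Real.exp_le_exp.2
            have := abs_im_le_norm w
            gcongr
      _ = C1 * 4 * Real.exp C2 * Real.exp ((C2 + 2) * ‖w‖) := by
          have : Real.exp ((C2 + 2) * ‖w‖) = Real.exp ‖w‖ ^ 2 * Real.exp (C2 * ‖w‖) := by
            rw [← Real.exp_nat_mul, ← Real.exp_add]; congr 1; push_cast; ring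
          have h5 : Real.exp (C2 * (1 + ‖w‖)) = Real.exp C2 * Real.exp (C2 * ‖w‖) := by
            rw [← Real.exp_add]; congr 1; ring
          rw [this, h5]; ring
  · refine isBoundedUnder_of_eventually_le (a := K * 8) ?_
    filter_upwards [eventually_ge_atTop 3] with x hx
    have hr := hre x
    rw [ofReal_re] at hr
    refine (G_ratio (by rw [hr]; linarith) hc0 hc).trans ?_
    refine mul_le_mul_of_nonneg_left ?_ hKp.le
    have r1 : ((x : ℂ) + 1/2 - c).re = x + 1/2 - c := by simp
    have r2 : ((x : ℂ) + 1/2 + c).re = x + 1/2 + c := by simp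
    have ne1 : ((x : ℂ) + 1/2 - c) ≠ 1 := fun h => by rw [h] at r1; simp at r1; linarith
    have ne2 : ((x : ℂ) + 1/2 + c) ≠ 1 := fun h => by rw [h] at r2; simp at r2; linarith
    rw [zeta1_eq_mul ne1, zeta1_eq_mul ne2]
    have u1 := zeta_upper (s := (x : ℂ) + 1/2 - c) (by rw [r1]; linarith)
    have u2 := zeta_lower (s := (x : ℂ) + 1/2 + c) (by rw [r2]; linarith)
    have v1 : ‖(x : ℂ) + 1/2 - c - 1‖ = x - c - 1/2 := by
      have : (x : ℂ) + 1/2 - c - 1 = ((x - c - 1/2 : ℝ) : ℂ) := by push_cast; ring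
      rw [this, norm_real, Real.norm_of_nonneg (by linarith)]
    have v2 : ‖(x : ℂ) + 1/2 + c - 1‖ = x + c - 1/2 := by
      have : (x : ℂ) + 1/2 + c - 1 = ((x + c - 1/2 : ℝ) : ℂ) := by push_cast; ring
      rw [this, norm_real, Real.norm_of_nonneg (by linarith)]
    rw [norm_inv, norm_mul, norm_mul, v1, v2, ← div_eq_mul_inv,
      div_le_iff₀ (mul_pos (by linarith) (by linarith))]
    have : 0 < x - c - 1/2 := by linarith
    calc (x - c - 1/2) * ‖riemannZeta ((x : ℂ) + 1/2 - c)‖ ≤ (x + c - 1/2) * 2 := by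
          refine mul_le_mul (by linarith) u1 (norm_nonneg _) (by linarith)
      _ ≤ _ := by nlinarith
  · intro x
    have hx : ((x : ℂ) * I + 1/2).re = 1/2 := by simp
    rw [norm_div, G_line hc0 hc hx]
    exact div_self_le_one _

lemma zeta1_mono (RH : RHyp) {c : ℝ} (hc0 : 0 < c) (hc : c < 1/4) {s : ℂ} (hs : 1/2 ≤ s.re)
    (hs1 : s.re ≤ 1) :
    ‖riemannZeta₁ (s - c)‖ ≤ ‖riemannZeta₁ (s + c)‖ * Real.exp (c * (Real.log (|s.im| + 2) + 3/2)) := by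
  have h1 := G_mono RH hc0 hc hs
  rw [G, G] at h1
  simp only [norm_mul] at h1
  rw [norm_cpow_eq_rpow_re_of_pos Real.pi_pos, norm_cpow_eq_rpow_re_of_pos Real.pi_pos] at h1
  have h2 := gamma_ratio (w := s / 2 + 1) (h := c / 2) (by simp; linarith) (by simp; linarith) (by linarith)
    (by linarith)
  have e1 : s / 2 + 1 + (c / 2 : ℝ) = (s + c) / 2 + 1 := by push_cast; ring
  have e2 : s / 2 + 1 - (c / 2 : ℝ) = (s - c) / 2 + 1 := by push_cast; ring
  rw [e1, e2] at h2
  have hg : 0 < ‖Complex.Gamma ((s - c) / 2 + 1)‖ := norm_pos_iff.2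
    (Complex.Gamma_ne_zero_of_re_pos (by simp; linarith))
  have hp : π ^ (-(s + c) / 2).re ≤ π ^ (-(s - c) / 2).re := by
    apply Real.rpow_le_rpow_of_exponent_le (by linarith [Real.pi_gt_three])
    simp; linarith
  have hpp : 0 < π ^ (-(s - c) / 2).re := Real.rpow_pos_of_pos Real.pi_pos _
  set P := π ^ (-(s - c) / 2).re
  set g := ‖Complex.Gamma ((s - c) / 2 + 1)‖
  set E := Real.exp (c * (Real.log (|s.im| + 2) + 3/2)) with hE
  have h3 : Real.exp (2 * (c / 2) * (Real.log (|(s / 2 + 1).im| + 2) + 3/2)) ≤ E := by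
    apply Real.exp_le_exp.2
    rw [show 2 * (c/2) = c by ring]
    have : (s / 2 + 1).im = s.im / 2 := by simp
    rw [this, abs_div, abs_two]
    have h31 : Real.log (|s.im| / 2 + 2) ≤ Real.log (|s.im| + 2) :=
      Real.log_le_log (by positivity) (by linarith [abs_nonneg s.im])
    exact mul_le_mul_of_nonneg_left (by linarith) hc0.le
  have h4 : ‖(2:ℂ)‖ * P * g * ‖riemannZeta₁ (s - c)‖ ≤ ‖(2:ℂ)‖ * P * (g * E) * ‖riemannZeta₁ (s + c)‖ := by
    refine h1.trans ?_
    gcongr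
    exact h2.trans (by gcongr)
  have h5 : 0 < ‖(2:ℂ)‖ * P * g := mul_pos (mul_pos (by simp) hpp) hg
  refine le_of_mul_le_mul_left (h4.trans (le_of_eq ?_)) h5
  ring

/-- key positivity: lower bound of the real part of the logarithmic derivative. -/
lemma re_logderiv_lower (RH : RHyp) {s : ℂ} (hs : 1/2 < s.re) (hs1 : s.re ≤ 1) :
    -(1/2) * Real.log (|s.im| + 2) - 3/4 ≤ (deriv riemannZeta₁ s / riemannZeta₁ s).re := by
  set r := s.re - 1/2 with hr
  have hr0 : 0 < r := by linarith
  have hball : ∀ z ∈ Metric.ball s r, 1/2 < z.re := by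
    intro z hz
    rw [Metric.mem_ball, dist_eq_norm] at hz
    have := (abs_re_le_norm (z - s)).trans_lt hz
    rw [sub_re] at this
    linarith [(abs_lt.1 this).1]
  obtain ⟨g, hg0, hg, hge⟩ := exists_log (F := riemannZeta₁) (c := s) (r := r) hr0
    differentiable_riemannZeta₁.differentiableOn (fun z hz => zeta1_ne_zero RH (hball z hz))
  set M := Real.log (|s.im| + 2) + 3/2 with hM
  set D := deriv riemannZeta₁ s / riemannZeta₁ s with hD
  have hgs := hg s (Metric.mem_ball_self hr0)
  have hdp : HasDerivAt (fun c : ℝ => g (s + c)) D 0 := by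
    have : HasDerivAt (fun z : ℂ => g (s + z)) D ((0:ℝ) : ℂ) := by
      have h := HasDerivAt.comp_const_add (f := g) (f' := D) s ((0:ℝ) : ℂ) (by simpa using hgs)
      exact h
    exact this.comp_ofReal
  have hdm : HasDerivAt (fun c : ℝ => g (s - c)) (-D) 0 := by
    have : HasDerivAt (fun z : ℂ => g (s - z)) (-D) ((0:ℝ) : ℂ) := by
      have h := HasDerivAt.comp_const_sub (f := g) (f' := D) s ((0:ℝ) : ℂ) (by simpa using hgs)
      exact h
    exact this.comp_ofReal
  have hd : HasDerivAt (fun c : ℝ => (g (s + c) - g (s - c)).re + c * M) ((D - -D).re + 1 * M) 0 := by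
    exact (HasDerivAt.fun_add (reCLM.hasFDerivAt.comp_hasDerivAt 0 (hdp.sub hdm)) ((hasDerivAt_id 0).mul_const M))
  have hnn : ∀ᶠ c : ℝ in nhdsWithin 0 (Set.Ioi 0), 0 ≤ (g (s + c) - g (s - c)).re + c * M := by
    have : Set.Ioo (0:ℝ) (min r (1/4)) ∈ nhdsWithin (0:ℝ) (Set.Ioi 0) :=
      Ioo_mem_nhdsGT (by positivity)
    filter_upwards [this] with c hc
    have hc0 := hc.1
    have hc1 := hc.2.trans_le (min_le_left _ _)
    have hc2 := hc.2.trans_le (min_le_right _ _)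
    have h1 := zeta1_mono RH hc0 hc2 hs.le hs1
    have b1 : s + c ∈ Metric.ball s r := by
      simp [Metric.mem_ball, abs_of_pos hc0, hc1]
    have b2 : s - c ∈ Metric.ball s r := by
      simp [Metric.mem_ball, dist_eq_norm, abs_of_pos hc0, hc1]
    rw [hge _ b1, hge _ b2, norm_mul, norm_mul, Complex.norm_exp, Complex.norm_exp, mul_assoc,
      ← Real.exp_add] at h1
    have h2 := Real.exp_le_exp.1 (le_of_mul_le_mul_left h1 (norm_pos_iff.2 (zeta1_ne_zero RH hs)))
    rw [← hM] at h2
    rw [sub_re]; linarith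
  have hlim := hd.hasDerivWithinAt (s := Set.Ioi 0)
  rw [hasDerivWithinAt_iff_tendsto_slope' (by simp)] at hlim
  have : 0 ≤ (D - -D).re + 1 * M := by
    refine ge_of_tendsto hlim ?_
    filter_upwards [hnn, self_mem_nhdsWithin] with c hc hc0
    rw [slope_def_field]
    simp only [ofReal_zero, add_zero, sub_zero, sub_self, zero_re, zero_mul]
    exact div_nonneg hc (le_of_lt hc0)
  rw [sub_re, neg_re] at this
  linarith

end SB

namespace SB

/-- the function `sin (π z) / π`. -/
noncomputable def sinpi (z : ℂ) : ℂ := Complex.sin (π * z) / π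

/-- the entire function `sin (π z) / (π z)`. -/
noncomputable def sc (z : ℂ) : ℂ := dslope sinpi 0 z

lemma sinpi_hasDeriv (z : ℂ) : HasDerivAt sinpi (Complex.cos (π * z)) z := by
  have hpi : (π : ℂ) ≠ 0 := by exact_mod_cast Real.pi_ne_zero
  have h1 : HasDerivAt (fun z : ℂ => (π : ℂ) * z) π z := by
    simpa using (hasDerivAt_id z).const_mul (π : ℂ)
  have h := (h1.csin).div_const (π : ℂ)
  rw [mul_div_cancel_right₀ _ hpi] at h
  exact h

lemma sinpi_diff : Differentiable ℂ sinpi := fun z => (sinpi_hasDeriv z).differentiableAt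

lemma sinpi_zero : sinpi 0 = 0 := by simp [sinpi]

lemma sc_diff : Differentiable ℂ sc := by
  have := (Complex.differentiableOn_dslope (E := ℂ) (f := sinpi) (s := Set.univ) (c := 0)
    Filter.univ_mem).2 sinpi_diff.differentiableOn
  exact differentiableOn_univ.1 this

lemma sc_mul (z : ℂ) : z * sc z = sinpi z := by
  have := sub_smul_dslope sinpi 0 z
  simpa [sinpi_zero, sc] using this

lemma sc_zero : sc 0 = 1 := by
  simp [sc, dslope_same, (sinpi_hasDeriv 0).deriv]

lemma sc_of_ne {z : ℂ} (hz : z ≠ 0) : sc z = sinpi z / z := by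
  rw [← sc_mul]; field_simp

lemma sc_neg (z : ℂ) : sc (-z) = sc z := by
  by_cases hz : z = 0
  · simp [hz]
  · rw [sc_of_ne hz, sc_of_ne (neg_ne_zero.2 hz)]
    simp only [sinpi, mul_neg, Complex.sin_neg, neg_div, neg_neg, div_neg]

lemma norm_sin_le (w : ℂ) : ‖Complex.sin w‖ ≤ Real.exp |w.im| := by
  rw [Complex.sin]
  have h1 : ‖Complex.exp (-w * I)‖ ≤ Real.exp |w.im| := by
    rw [Complex.norm_exp]
    exact Real.exp_le_exp.2 (by simpa using le_abs_self _)
  have h2 : ‖Complex.exp (w * I)‖ ≤ Real.exp |w.im| := by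
    rw [Complex.norm_exp]
    exact Real.exp_le_exp.2 (by simpa using neg_le_abs _)
  have h3 := norm_sub_le (Complex.exp (-w * I)) (Complex.exp (w * I))
  simp only [norm_div, norm_mul, Complex.norm_I, mul_one, RCLike.norm_ofNat]
  linarith

lemma norm_cos_le (w : ℂ) : ‖Complex.cos w‖ ≤ Real.exp |w.im| := by
  rw [Complex.cos]
  have h1 : ‖Complex.exp (-w * I)‖ ≤ Real.exp |w.im| := by
    rw [Complex.norm_exp]
    exact Real.exp_le_exp.2 (by simpa using le_abs_self _)
  have h2 : ‖Complex.exp (w * I)‖ ≤ Real.exp |w.im| := by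
    rw [Complex.norm_exp]
    exact Real.exp_le_exp.2 (by simpa using neg_le_abs _)
  have h3 := norm_add_le (Complex.exp (w * I)) (Complex.exp (-w * I))
  simp only [norm_div, RCLike.norm_ofNat]
  linarith

lemma norm_sinpi_le (z : ℂ) : ‖sinpi z‖ ≤ Real.exp (π * |z.im|) * ‖z‖ := by
  have hconv : Convex ℝ {w : ℂ | |w.im| ≤ |z.im|} := by
    have : {w : ℂ | |w.im| ≤ |z.im|} = Complex.imLm ⁻¹' (Set.Icc (-|z.im|) |z.im|) := by
      ext w; simp [abs_le]
    rw [this]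
    exact (convex_Icc _ _).linear_preimage _
  have := hconv.norm_image_sub_le_of_norm_deriv_le (f := sinpi) (C := Real.exp (π * |z.im|))
    (x := 0) (y := z) (fun w _ => sinpi_diff w) (fun w hw => by
      rw [(sinpi_hasDeriv w).deriv]
      refine (norm_cos_le _).trans (Real.exp_le_exp.2 ?_)
      simp only [Complex.mul_im, Complex.ofReal_re, Complex.ofReal_im, zero_mul, add_zero, abs_mul,
        abs_of_pos Real.pi_pos]
      exact mul_le_mul_of_nonneg_left hw Real.pi_pos.le) (by simp) (by simp)
  simpa [sinpi_zero] using this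

lemma sc_sq_bound (z : ℂ) : ‖sc z‖ ^ 2 * (1 + ‖z‖ ^ 2) ≤ 2 * Real.exp (2 * π * |z.im|) := by
  by_cases hz : z = 0
  · simp [hz, sc_zero]
  have hn : 0 < ‖z‖ := norm_pos_iff.2 hz
  have hm : ‖z‖ * ‖sc z‖ = ‖sinpi z‖ := by rw [← norm_mul, sc_mul]
  have h1 : ‖sc z‖ ≤ Real.exp (π * |z.im|) := by
    have := norm_sinpi_le z
    rw [← hm, mul_comm] at this
    exact le_of_mul_le_mul_right this hn
  have h2 : ‖z‖ * ‖sc z‖ ≤ Real.exp (π * |z.im|) := by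
    rw [hm, sinpi, norm_div]
    have := norm_sin_le (π * z)
    simp only [Complex.mul_im, Complex.ofReal_re, Complex.ofReal_im, zero_mul, add_zero, abs_mul,
        abs_of_pos Real.pi_pos] at this
    refine (div_le_self (norm_nonneg _) ?_).trans this
    simp only [Complex.norm_real, Real.norm_eq_abs, abs_of_pos Real.pi_pos]
    linarith [Real.pi_gt_three]
  have h3 : Real.exp (2 * π * |z.im|) = Real.exp (π * |z.im|) ^ 2 := by
    rw [← Real.exp_nat_mul]; congr 1; push_cast; ring
  rw [h3]
  have a := pow_le_pow_left₀ (norm_nonneg _) h1 2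
  have b := pow_le_pow_left₀ (by positivity) h2 2
  nlinarith

/-- the series `∑ 1/(z+n+1)^2`. -/
noncomputable def TT (z : ℂ) : ℂ := ∑' n : ℕ, 1 / (z + n + 1) ^ 2

noncomputable def hh (z : ℂ) : ℂ := z - z ^ 2 * TT z

lemma summ_half : Summable (fun n : ℕ => 1 / ((n : ℝ) + 1 / 2) ^ 2) := by
  have := Real.summable_one_div_nat_add_rpow (1/2) 2
  refine (this.2 (by norm_num)).congr fun n => ?_
  rw [abs_of_pos (by positivity)]
  norm_cast

lemma tt_term_bound {z : ℂ} (hz : -1/2 < z.re) (n : ℕ) :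
    ‖1 / (z + n + 1) ^ 2‖ ≤ 1 / ((n : ℝ) + 1 / 2) ^ 2 := by
  rw [norm_div, norm_one, norm_pow]
  have h : (n : ℝ) + 1 / 2 ≤ ‖z + n + 1‖ := by
    refine le_trans ?_ (Complex.re_le_norm _)
    simp; linarith
  gcongr

lemma tt_summable {z : ℂ} (hz : -1/2 < z.re) : Summable (fun n : ℕ => 1 / (z + n + 1) ^ 2) :=
  Summable.of_norm_bounded summ_half (tt_term_bound hz)

lemma tt_diff : DifferentiableOn ℂ TT {z | -1/2 < z.re} := by
  refine Complex.differentiableOn_tsum_of_summable_norm summ_half ?_ ?_ ?_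
  · intro n z hz
    have : z + n + 1 ≠ 0 := by
      intro h
      have := congrArg Complex.re h
      simp at this
      simp at hz
      have hn : (0:ℝ) ≤ n := by positivity
      linarith
    exact DifferentiableAt.differentiableWithinAt (by fun_prop (disch := simpa using this))
  · exact isOpen_lt continuous_const Complex.continuous_re
  · intro n z hz
    exact tt_term_bound hz n

lemma hh_diff : DifferentiableOn ℂ hh {z | -1/2 < z.re} := by
  unfold hh
  exact differentiableOn_id.sub ((differentiableOn_id.pow 2).mul tt_diff)

lemma hasSum_tele {a : ℕ → ℂ} (ha : Tendsto a atTop (nhds 0))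
    (hs : Summable fun n => a n - a (n + 1)) : HasSum (fun n => a n - a (n + 1)) (a 0) := by
  have h1 := hs.hasSum.tendsto_sum_nat
  have h2 : Tendsto (fun n => ∑ i ∈ Finset.range n, (a i - a (i + 1))) atTop (nhds (a 0 - 0)) := by
    simp_rw [Finset.sum_range_sub']
    exact tendsto_const_nhds.sub ha
  rw [sub_zero] at h2
  rw [← tendsto_nhds_unique h1 h2]
  exact hs.hasSum

lemma hasSum_tele_real {a : ℕ → ℝ} (ha : Tendsto a atTop (nhds 0)) (hm : ∀ n, a (n+1) ≤ a n) :
    HasSum (fun n => a n - a (n + 1)) (a 0) := by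
  rw [hasSum_iff_tendsto_nat_of_nonneg (fun n => by linarith [hm n])]
  simp_rw [Finset.sum_range_sub']
  simpa using tendsto_const_nhds.sub ha

lemma tele_real {x : ℝ} (hx : 0 < x) :
    HasSum (fun n : ℕ => 1 / (x + n) - 1 / (x + (n + 1 : ℕ))) (1 / x) := by
  have := hasSum_tele_real (a := fun n : ℕ => 1 / (x + n)) ?_ ?_
  · simpa using this
  · simp only [one_div]
    exact (tendsto_atTop_add_const_left _ _ tendsto_natCast_atTop_atTop).inv_tendsto_atTop
  · intro n
    have : (0:ℝ) ≤ n := by positivity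
    exact one_div_le_one_div_of_le (by positivity) (by push_cast; linarith)

lemma norm_add_nat {z : ℂ} (hz : 0 ≤ z.re) (m : ℕ) : (‖z‖ + m) ^ 2 ≤ 2 * ‖z + m‖ ^ 2 := by
  have h1 : ‖z + m‖ ^ 2 = ‖z‖ ^ 2 + m ^ 2 + 2 * m * z.re := by
    rw [Complex.sq_norm, Complex.sq_norm, Complex.normSq_apply, Complex.normSq_apply]
    simp; ring
  rw [h1]
  have : 0 ≤ (m : ℝ) * z.re := by positivity
  nlinarith [sq_nonneg (‖z‖ - m)]

lemma norm_le_add_nat {z : ℂ} (hz : 0 ≤ z.re) (m : ℕ) : ‖z‖ ≤ ‖z + m‖ := by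
  have h1 : ‖z + m‖ ^ 2 = ‖z‖ ^ 2 + m ^ 2 + 2 * m * z.re := by
    rw [Complex.sq_norm, Complex.sq_norm, Complex.normSq_apply, Complex.normSq_apply]
    simp; ring
  have : 0 ≤ (m : ℝ) * z.re := by positivity
  exact (sq_le_sq₀ (norm_nonneg _) (norm_nonneg _)).1 (by rw [h1]; nlinarith [sq_nonneg (m:ℝ)])

lemma hh_bound {z : ℂ} (hz : 0 ≤ z.re) : ‖hh z‖ ≤ 2 := by
  by_cases h0 : z = 0
  · simp [h0, hh]
  have hn : 0 < ‖z‖ := norm_pos_iff.2 h0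
  have hne : ∀ m : ℕ, z + m ≠ 0 := fun m h => by
    have := norm_le_add_nat hz m
    rw [h, norm_zero] at this; linarith
  have hR : HasSum (fun n : ℕ => 2 * ‖z‖ * (1 / (‖z‖ + n) - 1 / (‖z‖ + (n + 1 : ℕ)))) 2 := by
    have := (tele_real hn).mul_left (2 * ‖z‖)
    rwa [mul_one_div, mul_div_cancel_right₀ _ hn.ne'] at this
  have key : ∀ n : ℕ, ‖z ^ 2 * ((1 / (z + n) - 1 / (z + (n + 1 : ℕ))) - 1 / (z + n + 1) ^ 2)‖ ≤
      2 * ‖z‖ * (1 / (‖z‖ + n) - 1 / (‖z‖ + (n + 1 : ℕ))) := by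
    intro n
    have e : z ^ 2 * ((1 / (z + n) - 1 / (z + (n + 1 : ℕ))) - 1 / (z + n + 1) ^ 2) =
        z ^ 2 / ((z + n) * (z + (n + 1 : ℕ)) ^ 2) := by
      have a := hne n
      have b := hne (n + 1)
      push_cast at b ⊢
      have c : z + n + 1 ≠ 0 := by rwa [add_assoc]
      rw [← add_assoc]
      field_simp
      ring
    rw [e, norm_div, norm_mul, norm_pow, norm_pow]
    have a := norm_le_add_nat hz n
    have b := norm_add_nat hz (n + 1)
    have e2 : 1 / (‖z‖ + n) - 1 / (‖z‖ + (n + 1 : ℕ)) = 1 / ((‖z‖ + n) * (‖z‖ + (n + 1 : ℕ))) := by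
      push_cast
      field_simp
      ring
    rw [e2, mul_one_div]
    have c : 0 < ‖z‖ + n := by positivity
    have d : 0 < ‖z‖ + (n + 1 : ℕ) := by positivity
    have e3 : 0 < ‖z + n‖ := lt_of_lt_of_le hn a
    have e4 : 0 < ‖z + (n + 1 : ℕ)‖ := lt_of_lt_of_le hn (norm_le_add_nat hz _)
    rw [div_le_div_iff₀ (by positivity) (by positivity)]
    have f1 : (‖z‖ + n) * (‖z‖ + (n + 1 : ℕ)) ≤ 2 * ‖z + (n + 1 : ℕ)‖ ^ 2 := by
      refine le_trans ?_ b
      push_cast at d ⊢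
      nlinarith
    calc ‖z‖ ^ 2 * ((‖z‖ + n) * (‖z‖ + (n + 1 : ℕ))) ≤ (‖z‖ * ‖z + n‖) * (2 * ‖z + (n + 1 : ℕ)‖ ^ 2) := by
          apply mul_le_mul _ f1 (by positivity) (by positivity)
          rw [pow_two]; gcongr
      _ = _ := by ring
  have hT := tt_summable (z := z) (by linarith)
  have hs : Summable (fun n : ℕ => z ^ 2 * ((1 / (z + n) - 1 / (z + (n + 1 : ℕ))) - 1 / (z + n + 1) ^ 2)) :=
    Summable.of_norm_bounded hR.summable key
  have hz2 : z ^ 2 ≠ 0 := pow_ne_zero _ h0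
  have hs2 : Summable (fun n : ℕ => (1 / (z + n) - 1 / (z + (n + 1 : ℕ)))) := by
    have := ((summable_mul_left_iff hz2).1 hs).add hT
    refine this.congr fun n => by ring
  have hlim : Tendsto (fun n : ℕ => 1 / (z + n)) atTop (nhds 0) := by
    rw [tendsto_zero_iff_norm_tendsto_zero]
    refine squeeze_zero' (Eventually.of_forall fun _ => norm_nonneg _) (g := fun n : ℕ => 1 / (n : ℝ)) ?_
      tendsto_one_div_atTop_nhds_zero_nat
    filter_upwards [eventually_gt_atTop 0] with n h
    rw [norm_div, norm_one]
    have : (n : ℝ) ≤ ‖z + n‖ := by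
      refine le_trans ?_ (Complex.re_le_norm _)
      simpa using hz
    have hp : (0:ℝ) < n := by exact_mod_cast h
    gcongr
  have h3 := hasSum_tele hlim hs2
  have h4 := (h3.sub hT.hasSum).mul_left (z ^ 2)
  have e : z ^ 2 * (1 / (z + (0 : ℕ)) - TT z) = hh z := by
    rw [hh]; simp; field_simp
  rw [← e]
  exact h4.norm_le_of_bounded hR key

lemma hh_real {x : ℝ} (hx : 0 ≤ x) : ∃ v : ℝ, 0 ≤ v ∧ v ≤ 1 ∧ hh x = v := by
  have hs : Summable (fun n : ℕ => 1 / (x + n + 1) ^ 2) := by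
    refine Summable.of_nonneg_of_le (fun n => by positivity) (fun n => ?_) summ_half
    gcongr <;> linarith
  have hT : TT x = ((∑' n : ℕ, 1 / (x + n + 1) ^ 2 : ℝ) : ℂ) := by
    rw [TT, Complex.ofReal_tsum]
    push_cast
    rfl
  set τ := ∑' n : ℕ, 1 / (x + n + 1) ^ 2 with hτ
  have hlow : 1 / (x + 1) ≤ τ := by
    have h1 := tele_real (x := x + 1) (by linarith)
    rw [← h1.tsum_eq]
    refine h1.summable.tsum_le_tsum (fun n => ?_) hs
    have hn : (0:ℝ) ≤ n := by positivity
    push_cast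
    rw [div_sub_div _ _ (by positivity) (by positivity), div_le_div_iff₀ (by positivity) (by positivity)]
    ring_nf
    nlinarith [mul_nonneg hx hn, sq_nonneg (x + n)]
  refine ⟨x - x ^ 2 * τ, ?_, ?_, ?_⟩
  · rcases eq_or_lt_of_le hx with h | h
    · simp [← h]
    have h1 := tele_real h
    have : τ ≤ 1 / x := by
      rw [← h1.tsum_eq]
      refine hs.tsum_le_tsum (fun n => ?_) h1.summable
      have hn : (0:ℝ) ≤ n := by positivity
      push_cast
      rw [div_sub_div _ _ (by positivity) (by positivity), div_le_div_iff₀ (by positivity) (by positivity)]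
      ring_nf
      nlinarith [mul_nonneg hx hn, sq_nonneg (x + n)]
    have h2 : x ^ 2 * τ ≤ x ^ 2 * (1 / x) := by gcongr
    have h3 : x ^ 2 * (1 / x) = x := by field_simp
    linarith
  · have h2 : x ^ 2 * (1 / (x + 1)) ≤ x ^ 2 * τ := by gcongr
    have h3 : x - x ^ 2 * (1 / (x + 1)) ≤ 1 := by
      rw [mul_one_div, sub_le_iff_le_add, ← sub_le_iff_le_add', le_div_iff₀ (by linarith)]
      nlinarith
    linarith
  · rw [hh, hT]; push_cast; ring

/-- the two pieces of the kernel -/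
noncomputable def KH (z : ℂ) : ℂ := sc z ^ 2 * hh z
noncomputable def KL (z : ℂ) : ℂ := sc z ^ 2 * (1 - hh z)

lemma KH_diff : DifferentiableOn ℂ KH {z | -1/2 < z.re} :=
  (sc_diff.differentiableOn.pow 2).mul hh_diff

lemma KL_diff : DifferentiableOn ℂ KL {z | -1/2 < z.re} :=
  (sc_diff.differentiableOn.pow 2).mul ((differentiableOn_const 1).sub hh_diff)

lemma KH_bound {z : ℂ} (hz : 0 ≤ z.re) : ‖KH z‖ ≤ 6 * Real.exp (2 * π * |z.im|) / (1 + ‖z‖ ^ 2) := by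
  rw [le_div_iff₀ (by positivity), KH, norm_mul, norm_pow]
  have h1 := sc_sq_bound z
  have h2 := hh_bound hz
  calc ‖sc z‖ ^ 2 * ‖hh z‖ * (1 + ‖z‖ ^ 2) = (‖sc z‖ ^ 2 * (1 + ‖z‖ ^ 2)) * ‖hh z‖ := by ring
    _ ≤ (2 * Real.exp (2 * π * |z.im|)) * 2 := by gcongr
    _ ≤ _ := by linarith [Real.exp_pos (2 * π * |z.im|)]

lemma KL_bound {z : ℂ} (hz : 0 ≤ z.re) : ‖KL z‖ ≤ 6 * Real.exp (2 * π * |z.im|) / (1 + ‖z‖ ^ 2) := by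
  rw [le_div_iff₀ (by positivity), KL, norm_mul, norm_pow]
  have h1 := sc_sq_bound z
  have h2 : ‖1 - hh z‖ ≤ 3 := by
    refine (norm_sub_le _ _).trans ?_
    rw [norm_one]; linarith [hh_bound hz]
  calc ‖sc z‖ ^ 2 * ‖1 - hh z‖ * (1 + ‖z‖ ^ 2) = (‖sc z‖ ^ 2 * (1 + ‖z‖ ^ 2)) * ‖1 - hh z‖ := by ring
    _ ≤ (2 * Real.exp (2 * π * |z.im|)) * 3 := by gcongr
    _ ≤ _ := by linarith [Real.exp_pos (2 * π * |z.im|)]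

/-- real sinc -/
noncomputable def scr (x : ℝ) : ℝ := (sc x).re

lemma sc_real (x : ℝ) : sc x = scr x := by
  have : (sc x).im = 0 := by
    by_cases hx : x = 0
    · simp [hx, sc_zero]
    · rw [sc_of_ne (by exact_mod_cast hx), sinpi]
      have : (Complex.sin (π * x) / π / x : ℂ) = ((Real.sin (π * x) / π / x : ℝ) : ℂ) := by push_cast; rfl
      rw [this, Complex.ofReal_im]
  apply Complex.ext
  · simp [scr]
  · simp [this]

lemma kernel_real {x : ℝ} (hx : 0 ≤ x) : ∃ a b : ℝ, 0 ≤ a ∧ 0 ≤ b ∧ KH x = a ∧ KL x = b ∧ a + b = scr x ^ 2 := by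
  obtain ⟨v, h0, h1, h2⟩ := hh_real hx
  refine ⟨scr x ^ 2 * v, scr x ^ 2 * (1 - v), by positivity, mul_nonneg (by positivity) (by linarith), ?_, ?_, by ring⟩
  · rw [KH, h2, sc_real]; push_cast; rfl
  · rw [KL, h2, sc_real]; push_cast; rfl

lemma cot_deriv {z : ℂ} (hz : 0 < z.im) :
    HasDerivAt (fun x => (π : ℂ) * Complex.cot (π * x)) (-(π ^ 2 / Complex.sin (π * z) ^ 2)) z := by
  have hs : Complex.sin (π * z) ≠ 0 := by
    intro h
    rw [Complex.sin_eq_zero_iff] at h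
    obtain ⟨k, hk⟩ := h
    have := congrArg Complex.im hk
    simp [Real.pi_ne_zero] at this
    linarith
  have h1 : HasDerivAt (fun z : ℂ => (π : ℂ) * z) π z := by
    simpa using (hasDerivAt_id z).const_mul (π : ℂ)
  have h2 := ((h1.ccos).div (h1.csin) hs).const_mul (π : ℂ)
  have e : (π : ℂ) * ((-Complex.sin (π * z) * π * Complex.sin (π * z) - Complex.cos (π * z) * (Complex.cos (π * z) * π)) / Complex.sin (π * z) ^ 2) = -(π ^ 2 / Complex.sin (π * z) ^ 2) := by
    field_simp
    linear_combination (-1 : ℂ) * Complex.sin_sq_add_cos_sq (π * z)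
  rw [e] at h2
  exact h2

lemma sum_inv_sq {z : ℂ} (hz : 0 < z.im) :
    ∑' n : ℤ, 1 / (z + n) ^ 2 = π ^ 2 / Complex.sin (π * z) ^ 2 := by
  have h := iteratedDerivWithin_cot_pi_mul_eq_mul_tsum_div_pow (k := 1) le_rfl (z := z) hz
  have hopen : IsOpen UpperHalfPlane.upperHalfPlaneSet := UpperHalfPlane.isOpen_upperHalfPlaneSet
  rw [iteratedDerivWithin_one, derivWithin_of_isOpen hopen hz, (cot_deriv hz).deriv] at h
  simp at h
  simp only [one_div]
  rw [← h]

lemma kernel_jump {η : ℝ} (hη : 0 ≤ η) : KL (η * I) - KH (-(η * I)) = 1 := by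
  rcases eq_or_lt_of_le hη with h | h
  · simp [← h, KL, KH, sc_zero, hh]
  set z : ℂ := η * I with hz
  have him : 0 < z.im := by simpa [hz] using h
  have hre : z.re = 0 := by simp [hz]
  have hz0 : z ≠ 0 := fun h => by rw [h] at him; simp at him
  have h1 := tt_summable (z := z) (by rw [hre]; norm_num)
  have h2 := tt_summable (z := -z) (by rw [Complex.neg_re, hre]; norm_num)
  have hsum : ∑' n : ℤ, 1 / (z + n) ^ 2 = 1 / z ^ 2 + TT z + TT (-z) := by
    have a : HasSum (fun n : ℕ => 1 / (z + (n : ℤ)) ^ 2) (TT z + 1 / z ^ 2) := by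
      have := (hasSum_nat_add_iff (f := fun n : ℕ => 1 / (z + (n : ℤ)) ^ 2) 1 (g := TT z)).1 ?_
      · simpa using this
      · have e : (fun n : ℕ => 1 / (z + ((n + 1 : ℕ) : ℤ)) ^ 2) = fun n : ℕ => 1 / (z + n + 1) ^ 2 := by
          funext n; push_cast; rw [add_assoc]
        rw [e]
        exact h1.hasSum
    have b : HasSum (fun n : ℕ => 1 / (z + (-(n + 1 : ℤ) : ℤ)) ^ 2) (TT (-z)) := by
      have e : (fun n : ℕ => 1 / (z + (-(n + 1 : ℤ) : ℤ)) ^ 2) = fun n : ℕ => 1 / (-z + n + 1) ^ 2 := by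
        funext n; push_cast; congr 1; ring
      rw [e]
      exact h2.hasSum
    have := (HasSum.of_nat_of_neg_add_one (f := fun n : ℤ => 1 / (z + n) ^ 2) a b).tsum_eq
    rw [this]; ring
  rw [sum_inv_sq him] at hsum
  have hs : Complex.sin (π * z) ≠ 0 := by
    intro h
    rw [Complex.sin_eq_zero_iff] at h
    obtain ⟨k, hk⟩ := h
    have := congrArg Complex.im hk
    simp [Real.pi_ne_zero] at this
    linarith
  have hpi : (π : ℂ) ≠ 0 := by exact_mod_cast Real.pi_ne_zero
  rw [KL, KH, sc_neg, ← mul_sub]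
  have e : (1 - hh z - hh (-z)) = z ^ 2 * (1 / z ^ 2 + TT z + TT (-z)) := by
    rw [hh, hh]; field_simp; ring
  rw [e, ← hsum, sc_of_ne hz0, sinpi]
  field_simp

end SB

namespace SB

lemma lint_of_deriv {g g' : ℝ → ℝ} {l : ℝ} (hd : ∀ x ∈ Set.Ici (0:ℝ), HasDerivAt g (g' x) x)
    (hp : ∀ x ∈ Set.Ioi (0:ℝ), 0 ≤ g' x) (hl : Tendsto g atTop (nhds l)) :
    ∫⁻ x in Set.Ioi (0:ℝ), ENNReal.ofReal (g' x) = ENNReal.ofReal (l - g 0) := by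
  rw [← integral_Ioi_of_hasDerivAt_of_nonneg' hd hp hl]
  rw [ofReal_integral_eq_lintegral_ofReal (integrableOn_Ioi_deriv_of_nonneg' hd hp hl)]
  exact (ae_restrict_iff' measurableSet_Ioi).2 (Eventually.of_forall hp)

lemma exp_neg_tendsto {x : ℝ} (hx : 0 < x) : Tendsto (fun w : ℝ => Real.exp (-(x * w))) atTop (nhds 0) :=
  Real.tendsto_exp_neg_atTop_nhds_zero.comp (tendsto_id.const_mul_atTop hx)

lemma lap1 {x : ℝ} (hx : 0 < x) :
    ∫⁻ w in Set.Ioi (0:ℝ), ENNReal.ofReal (w * Real.exp (-(x * w))) = ENNReal.ofReal (1 / x ^ 2) := by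
  have hl : Tendsto (fun w : ℝ => -(w / x + 1 / x ^ 2) * Real.exp (-(x * w))) atTop (nhds 0) := by
    have h1 : Tendsto (fun w : ℝ => (x * w) * Real.exp (-(x * w))) atTop (nhds 0) := by
      have := (Real.tendsto_pow_mul_exp_neg_atTop_nhds_zero 1).comp (tendsto_id.const_mul_atTop hx)
      simpa [Function.comp_def] using this
    have h2 := (h1.const_mul (-(1 / x ^ 2))).add ((exp_neg_tendsto hx).const_mul (-(1 / x ^ 2)))
    simp only [mul_zero, add_zero] at h2
    refine h2.congr fun w => ?_
    field_simp
    ring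
  rw [lint_of_deriv (g := fun w : ℝ => -(w / x + 1 / x ^ 2) * Real.exp (-(x * w))) ?_ ?_ hl]
  · simp
  · intro w _
    have h1 : HasDerivAt (fun w : ℝ => Real.exp (-(x * w))) (Real.exp (-(x * w)) * (-x)) w := by
      have : HasDerivAt (fun w : ℝ => -(x * w)) (-x) w := by
        exact (((hasDerivAt_id w).const_mul x).neg).congr_deriv (by simp)
      exact this.exp
    have h2 : HasDerivAt (fun w : ℝ => -(w / x + 1 / x ^ 2)) (-(1 / x)) w := by
      exact (((hasDerivAt_id w).div_const x).add_const (1 / x ^ 2)).neg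
    refine (h2.mul h1).congr_deriv ?_
    field_simp
    ring
  · intro w hw
    have : (0:ℝ) < w := hw
    positivity

lemma lap2 {w : ℝ} (hw : 0 < w) :
    ∫⁻ x in Set.Ioi (0:ℝ), ENNReal.ofReal (Real.sin (π * x) ^ 2 * Real.exp (-(x * w))) =
      ENNReal.ofReal (2 * π ^ 2 / (w * (w ^ 2 + 4 * π ^ 2))) := by
  have hpi := Real.pi_pos
  set g : ℝ → ℝ := fun x => Real.exp (-(w * x)) * (-(1 / (2 * w)) +
    (w * Real.cos (2 * π * x) - 2 * π * Real.sin (2 * π * x)) / (2 * (w ^ 2 + 4 * π ^ 2))) with hg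
  have hl : Tendsto g atTop (nhds 0) := by
    refine squeeze_zero_norm (a := fun x => Real.exp (-(w * x)) * (1 / (2 * w) + (w + 2 * π) / (2 * (w ^ 2 + 4 * π ^ 2)))) (fun x => ?_) ?_
    · rw [hg]
      simp only [norm_mul, Real.norm_eq_abs, Real.abs_exp]
      gcongr
      refine (abs_add_le _ _).trans ?_
      rw [abs_neg, abs_of_pos (show 0 < 1 / (2 * w) by positivity), abs_div,
        abs_of_pos (show 0 < 2 * (w ^ 2 + 4 * π ^ 2) by positivity)]
      gcongr
      refine (abs_sub _ _).trans ?_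
      rw [abs_mul, abs_mul, abs_of_pos hw, abs_of_pos (show 0 < 2 * π by positivity)]
      nlinarith [Real.abs_cos_le_one (2 * π * x), Real.abs_sin_le_one (2 * π * x)]
    · simpa using (exp_neg_tendsto hw).mul_const _
  rw [lint_of_deriv (g := g) ?_ ?_ hl]
  · congr 1
    simp [hg]
    field_simp
    ring
  · intro x _
    have h1 : HasDerivAt (fun x : ℝ => Real.exp (-(w * x))) (Real.exp (-(w * x)) * (-w)) x := by
      have : HasDerivAt (fun x : ℝ => -(w * x)) (-w) x := by
        exact (((hasDerivAt_id x).const_mul w).neg).congr_deriv (by simp)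
      exact this.exp
    have h0 : HasDerivAt (fun x : ℝ => 2 * π * x) (2 * π) x := by
      simpa using (hasDerivAt_id x).const_mul (2 * π)
    have h2 := ((((h0.cos).const_mul w).sub ((h0.sin).const_mul (2 * π))).div_const (2 * (w ^ 2 + 4 * π ^ 2))).const_add (-(1 / (2 * w)))
    refine (h1.mul h2).congr_deriv ?_
    simp only [Pi.sub_apply]
    have hc : Real.cos (2 * π * x) = 1 - 2 * Real.sin (π * x) ^ 2 := by
      rw [mul_assoc, Real.cos_two_mul, Real.cos_sq']; ring
    rw [hc, mul_comm x w]
    field_simp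
    ring
  · intro x _
    positivity

lemma lap3 : ∫⁻ w in Set.Ioi (0:ℝ), ENNReal.ofReal (2 / (w ^ 2 + 4 * π ^ 2)) = ENNReal.ofReal (1 / 2) := by
  have hpi := Real.pi_pos
  have hl : Tendsto (fun w : ℝ => (1 / π) * Real.arctan (w / (2 * π))) atTop (nhds (1 / π * (π / 2))) := by
    refine Tendsto.const_mul _ ((Real.tendsto_arctan_atTop.mono_right nhdsWithin_le_nhds).comp ?_)
    exact tendsto_id.atTop_div_const (by positivity)
  rw [lint_of_deriv (g := fun w : ℝ => (1 / π) * Real.arctan (w / (2 * π))) ?_ ?_ hl]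
  · congr 1
    simp
    field_simp
  · intro w _
    have := ((((hasDerivAt_id w).div_const (2 * π))).arctan).const_mul (1 / π)
    refine this.congr_deriv ?_
    simp only [id]
    field_simp
    ring
  · intro w _
    positivity

lemma scr_sq {x : ℝ} (hx : 0 < x) : scr x ^ 2 = Real.sin (π * x) ^ 2 / π ^ 2 * (1 / x ^ 2) := by
  have h : scr x = Real.sin (π * x) / π / x := by
    have h1 := sc_real x
    rw [sc_of_ne (by exact_mod_cast hx.ne'), sinpi] at h1
    have : (Complex.sin (π * x) / π / x : ℂ) = ((Real.sin (π * x) / π / x : ℝ) : ℂ) := by push_cast; rfl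
    rw [this] at h1
    exact_mod_cast h1.symm
  rw [h]; field_simp

lemma lint_scr : ∫⁻ x in Set.Ioi (0:ℝ), ENNReal.ofReal (scr x ^ 2) = ENNReal.ofReal (1 / 2) := by
  have hpi := Real.pi_pos
  have h1 : ∫⁻ x in Set.Ioi (0:ℝ), ENNReal.ofReal (scr x ^ 2) =
      ∫⁻ x in Set.Ioi (0:ℝ), ∫⁻ w in Set.Ioi (0:ℝ),
        ENNReal.ofReal (Real.sin (π * x) ^ 2 / π ^ 2 * (w * Real.exp (-(x * w)))) := by
    refine setLIntegral_congr_fun measurableSet_Ioi fun x hx => ?_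
    rw [scr_sq hx, ENNReal.ofReal_mul (by positivity), ← lap1 hx, ← lintegral_const_mul _ (by fun_prop)]
    refine lintegral_congr fun w => ?_
    rw [← ENNReal.ofReal_mul (by positivity)]
  rw [h1, lintegral_lintegral_swap (by
    apply Measurable.aemeasurable
    unfold Function.uncurry
    fun_prop), ← lap3]
  refine setLIntegral_congr_fun measurableSet_Ioi fun w hw => ?_
  have hw' : (0:ℝ) < w := hw
  have h2 : ∀ x, ENNReal.ofReal (Real.sin (π * x) ^ 2 / π ^ 2 * (w * Real.exp (-(x * w)))) =
      ENNReal.ofReal (w / π ^ 2) * ENNReal.ofReal (Real.sin (π * x) ^ 2 * Real.exp (-(x * w))) := by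
    intro x
    rw [← ENNReal.ofReal_mul (by positivity)]
    congr 1
    ring
  simp_rw [h2]
  rw [lintegral_const_mul _ (by fun_prop), lap2 hw', ← ENNReal.ofReal_mul (by positivity)]
  congr 1
  field_simp

lemma scr_cont : Continuous scr :=
  Complex.continuous_re.comp (sc_diff.continuous.comp Complex.continuous_ofReal)

lemma scr_integrable : IntegrableOn (fun x => scr x ^ 2) (Set.Ioi 0) := by
  refine ⟨(scr_cont.pow 2).aestronglyMeasurable, ?_⟩
  rw [hasFiniteIntegral_iff_ofReal (Eventually.of_forall fun x => sq_nonneg _), lint_scr]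
  exact ENNReal.ofReal_lt_top

lemma scr_integral : ∫ x in Set.Ioi (0:ℝ), scr x ^ 2 = 1 / 2 := by
  rw [integral_eq_lintegral_of_nonneg_ae (Eventually.of_forall fun x => sq_nonneg _)
    (scr_cont.pow 2).aestronglyMeasurable, lint_scr, ENNReal.toReal_ofReal (by norm_num)]

end SB

namespace SB

/-- decay function -/
noncomputable def dec (x : ℝ) : ℝ := (x + 1) ^ (-(3/2) : ℝ)

lemma dec_integrable : IntegrableOn dec (Set.Ioi 0) :=
  integrableOn_add_rpow_Ioi_of_lt (by norm_num) (by norm_num)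

lemma dec_nonneg {x : ℝ} (hx : 0 ≤ x) : 0 ≤ dec x := Real.rpow_nonneg (by linarith) _

lemma dec_tendsto : Tendsto dec atTop (nhds 0) :=
  (tendsto_rpow_neg_atTop (by norm_num : (0:ℝ) < 3/2)).comp (tendsto_atTop_add_const_right _ _ tendsto_id)

lemma integrable_of_dec {g : ℝ → ℂ} {C : ℝ} (hc : ContinuousOn g (Set.Ici 0))
    (hb : ∀ x, 0 ≤ x → ‖g x‖ ≤ C * dec x) : IntegrableOn g (Set.Ioi 0) := by
  refine Integrable.mono' (dec_integrable.const_mul C)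
    ((hc.mono Set.Ioi_subset_Ici_self).aestronglyMeasurable measurableSet_Ioi) ?_
  exact (ae_restrict_iff' measurableSet_Ioi).2 (Eventually.of_forall fun x hx => hb x (le_of_lt hx))

lemma half_strip {f : ℂ → ℂ} {a b C : ℝ} (hab : a ≤ b)
    (hd : ∀ p : ℂ, a ≤ p.re → p.re ≤ b → 0 ≤ p.im → DifferentiableAt ℂ f p)
    (hb : ∀ p : ℂ, a ≤ p.re → p.re ≤ b → 0 ≤ p.im → ‖f p‖ ≤ C * dec p.im) :
    ∫ x in Set.Ioi (0:ℝ), f (a + x * I) =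
      (∫ x in Set.Ioi (0:ℝ), f (b + x * I)) - I * ∫ y in a..b, f y := by
  have hline : ∀ c : ℝ, a ≤ c → c ≤ b → IntegrableOn (fun x : ℝ => f (c + x * I)) (Set.Ioi 0) := by
    intro c h1 h2
    refine integrable_of_dec (C := C) (fun x hx => ?_) (fun x hx => ?_)
    · have := hd (c + x * I) (by simpa using h1) (by simpa using h2) (by simpa using hx)
      have h3 : ContinuousAt (fun x : ℝ => (c + x * I : ℂ)) x := by fun_prop
      exact (ContinuousAt.comp (f := fun x : ℝ => (c + x * I : ℂ)) this.continuousAt h3).continuousWithinAt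
    · simpa using hb (c + x * I) (by simpa using h1) (by simpa using h2) (by simpa using hx)
  have hrect : ∀ X : ℝ, 0 ≤ X → (∫ x in a..b, f x) - (∫ x in a..b, f (x + X * I)) +
      I * (∫ y in (0:ℝ)..X, f (b + y * I)) - I * (∫ y in (0:ℝ)..X, f (a + y * I)) = 0 := by
    intro X hX
    have := Complex.integral_boundary_rect_eq_zero_of_differentiableOn f (a : ℂ) (b + X * I) (by
      intro p hp
      rw [Complex.mem_reProdIm] at hp
      simp [hab, hX] at hp
      exact (hd p hp.1.1 hp.1.2 hp.2.1).differentiableWithinAt)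
    simpa using this
  have hA := intervalIntegral_tendsto_integral_Ioi 0 (hline a le_rfl hab) tendsto_id
  have hB := intervalIntegral_tendsto_integral_Ioi 0 (hline b hab le_rfl) tendsto_id
  have hT : Tendsto (fun X : ℝ => ∫ x in a..b, f (x + X * I)) atTop (nhds 0) := by
    refine squeeze_zero_norm' (a := fun X => (C * dec X) * |b - a|) ?_ ?_
    · filter_upwards [eventually_ge_atTop 0] with X hX
      refine intervalIntegral.norm_integral_le_of_norm_le_const fun x hx => ?_
      rw [Set.uIoc_of_le hab] at hx
      simpa using hb (x + X * I) (by simpa using hx.1.le) (by simpa using hx.2) (by simpa using hX)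
    · simpa using (dec_tendsto.const_mul C).mul_const |b - a|
  have hlim := (((tendsto_const_nhds (x := ∫ x in a..b, f x)).sub hT).add (hB.const_mul I)).sub (hA.const_mul I)
  have h0 : Tendsto (fun X : ℝ => (∫ x in a..b, f x) - (∫ x in a..b, f (x + X * I)) +
      I * (∫ y in (0:ℝ)..X, f (b + y * I)) - I * (∫ y in (0:ℝ)..X, f (a + y * I))) atTop (nhds 0) := by
    refine tendsto_const_nhds.congr' ?_
    filter_upwards [eventually_ge_atTop 0] with X hX
    exact (hrect X hX).symm
  have h := tendsto_nhds_unique hlim h0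
  linear_combination (I : ℂ) * h + (- (∫ x in Set.Ioi (0:ℝ), f (b + x * I)) + ∫ x in Set.Ioi (0:ℝ), f (a + x * I)) * Complex.I_mul_I

lemma half_strip_low {f : ℂ → ℂ} {a b C : ℝ} (hab : a ≤ b)
    (hd : ∀ p : ℂ, a ≤ p.re → p.re ≤ b → p.im ≤ 0 → DifferentiableAt ℂ f p)
    (hb : ∀ p : ℂ, a ≤ p.re → p.re ≤ b → p.im ≤ 0 → ‖f p‖ ≤ C * dec (-p.im)) :
    ∫ x in Set.Ioi (0:ℝ), f (a - x * I) =
      (∫ x in Set.Ioi (0:ℝ), f (b - x * I)) + I * ∫ y in a..b, f y := by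
  have h := half_strip (f := fun p => f (a + b - p)) (C := C) hab ?_ ?_
  · have e1 : ∀ x : ℝ, (a : ℂ) + b - (a + x * I) = b - x * I := fun x => by ring
    have e2 : ∀ x : ℝ, (a : ℂ) + b - (b + x * I) = a - x * I := fun x => by ring
    simp only [e1, e2] at h
    have e3 : ∫ y in a..b, f (a + b - y) = ∫ y in a..b, f y := by
      have := intervalIntegral.integral_comp_sub_left (a := a) (b := b) (fun x : ℝ => f x) (a + b)
      simpa using this
    rw [e3] at h
    rw [h]; ring
  · intro p h1 h2 h3
    have := hd (a + b - p) (by simp; linarith) (by simp; linarith) (by simp; linarith)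
    have h4 : DifferentiableAt ℂ (fun p : ℂ => (a : ℂ) + b - p) p := by fun_prop
    exact DifferentiableAt.comp (f := fun p : ℂ => (a : ℂ) + b - p) p this h4
  · intro p h1 h2 h3
    have := hb (a + b - p) (by simp; linarith) (by simp; linarith) (by simp; linarith)
    simpa using this

/-- admissible right half-plane functions -/
structure Adm (r : ℂ → ℂ) (σ C : ℝ) : Prop where
  diff : ∀ s : ℂ, σ ≤ s.re → DifferentiableAt ℂ r s
  bound : ∀ s : ℂ, σ ≤ s.re → ‖r s‖ ≤ C * (1 + |s.im|) ^ (1/2 : ℝ)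

noncomputable def JH (α : ℝ) (r : ℂ → ℂ) (s : ℂ) (y : ℝ) : ℂ :=
  ∫ x in Set.Ioi (0:ℝ), KH (α * (x - y * I)) * r (s + y + x * I)
noncomputable def JL (α : ℝ) (r : ℂ → ℂ) (s : ℂ) (y : ℝ) : ℂ :=
  ∫ x in Set.Ioi (0:ℝ), KL (α * (x + y * I)) * r (s + y - x * I)

lemma ker_scaled {α x y : ℝ} (hα : 1 ≤ α) :
    6 * Real.exp (2 * π * |α * y|) / (1 + ((α * x) ^ 2 + (α * y) ^ 2)) ≤ 6 * Real.exp (2 * π * α * |y|) / (1 + x ^ 2) := by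
  rw [abs_mul, abs_of_pos (by linarith : 0 < α), ← mul_assoc]
  have : x ^ 2 ≤ (α * x) ^ 2 + (α * y) ^ 2 := by
    nlinarith [sq_nonneg x, sq_nonneg (α * y), sq_nonneg ((α - 1)), mul_nonneg (sub_nonneg.2 hα) (sq_nonneg x), mul_nonneg (mul_nonneg (sub_nonneg.2 hα) (by linarith : 0 ≤ α)) (sq_nonneg x)]
  gcongr

lemma nsq (z : ℂ) : ‖z‖ ^ 2 = z.re ^ 2 + z.im ^ 2 := by
  rw [Complex.sq_norm, Complex.normSq_apply]; ring

lemma KH_scaled {α : ℝ} (hα : 1 ≤ α) {x : ℝ} (hx : 0 ≤ x) (y : ℝ) :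
    ‖KH (α * (x - y * I))‖ ≤ 6 * Real.exp (2 * π * α * |y|) / (1 + x ^ 2) := by
  have h := KH_bound (z := α * (x - y * I)) (by simp; positivity)
  refine h.trans ?_
  rw [nsq]
  simpa using ker_scaled (x := x) (y := y) hα

lemma KL_scaled {α : ℝ} (hα : 1 ≤ α) {x : ℝ} (hx : 0 ≤ x) (y : ℝ) :
    ‖KL (α * (x + y * I))‖ ≤ 6 * Real.exp (2 * π * α * |y|) / (1 + x ^ 2) := by
  have h := KL_bound (z := α * (x + y * I)) (by simp; positivity)
  refine h.trans ?_
  rw [nsq]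
  simpa using ker_scaled (x := x) (y := y) hα

lemma dec_ker {x u : ℝ} (hx : 0 ≤ x) (t : ℝ) (hu : |u| ≤ |t| + x) :
    1 / (1 + x ^ 2) * (1 + |u|) ^ (1/2 : ℝ) ≤ 2 * (1 + |t|) ^ (1/2 : ℝ) * dec x := by
  have h1 : (1 + |u|) ^ (1/2 : ℝ) ≤ (1 + |t|) ^ (1/2 : ℝ) * (x + 1) ^ (1/2:ℝ) := by
    rw [← Real.mul_rpow (by positivity) (by positivity)]
    gcongr
    nlinarith [abs_nonneg t, mul_nonneg (abs_nonneg t) hx]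
  have h2 : dec x = (x + 1) ^ (1/2:ℝ) / (x + 1) ^ 2 := by
    rw [dec, ← Real.rpow_natCast, ← Real.rpow_sub (by linarith)]; norm_num
  have h3 : 1 / (1 + x ^ 2) ≤ 2 / (x + 1) ^ 2 := by
    rw [div_le_div_iff₀ (by positivity) (by positivity)]
    nlinarith [sq_nonneg (x - 1)]
  rw [h2]
  calc _ ≤ 2 / (x + 1) ^ 2 * ((1 + |t|) ^ (1/2 : ℝ) * (x + 1) ^ (1/2:ℝ)) := by gcongr
    _ = _ := by ring

lemma fH_bound {r : ℂ → ℂ} {σ C α y x B : ℝ} {s : ℂ} (hr : Adm r σ C) (hα : 1 ≤ α) (hx : 0 ≤ x)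
    (hy : σ ≤ s.re + y) (hB : |y| ≤ B) :
    ‖KH (α * (x - y * I)) * r (s + y + x * I)‖ ≤
      12 * Real.exp (2 * π * α * B) * C * (1 + |s.im|) ^ (1/2 : ℝ) * dec x := by
  have h1 := KH_scaled hα hx y
  have h2 := hr.bound (s + y + x * I) (by simpa using hy)
  have h3 := dec_ker hx s.im (u := (s + y + x * I).im) (by
    simp only [Complex.add_im, Complex.ofReal_im, Complex.mul_im, Complex.I_im, Complex.I_re]
    simp
    exact (abs_add_le _ _).trans (by rw [abs_of_nonneg hx]))
  have hC : 0 ≤ C := by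
    by_contra h
    have := (norm_nonneg _).trans h2
    have h5 : 0 < (1 + |(s + y + x * I).im|) ^ (1/2 : ℝ) := by positivity
    nlinarith
  have h4 : Real.exp (2 * π * α * |y|) ≤ Real.exp (2 * π * α * B) := by
    have := Real.pi_pos
    gcongr
  rw [norm_mul]
  calc _ ≤ (6 * Real.exp (2 * π * α * |y|) / (1 + x ^ 2)) * (C * (1 + |(s + y + x * I).im|) ^ (1/2 : ℝ)) := by gcongr
    _ = 6 * Real.exp (2 * π * α * |y|) * C * (1 / (1 + x ^ 2) * (1 + |(s + y + x * I).im|) ^ (1/2 : ℝ)) := by ring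
    _ ≤ 6 * Real.exp (2 * π * α * B) * C * (2 * (1 + |s.im|) ^ (1/2 : ℝ) * dec x) := by gcongr
    _ = _ := by ring

lemma fL_bound {r : ℂ → ℂ} {σ C α y x B : ℝ} {s : ℂ} (hr : Adm r σ C) (hα : 1 ≤ α) (hx : 0 ≤ x)
    (hy : σ ≤ s.re + y) (hB : |y| ≤ B) :
    ‖KL (α * (x + y * I)) * r (s + y - x * I)‖ ≤
      12 * Real.exp (2 * π * α * B) * C * (1 + |s.im|) ^ (1/2 : ℝ) * dec x := by
  have h1 := KL_scaled hα hx y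
  have h2 := hr.bound (s + y - x * I) (by simpa using hy)
  have h3 := dec_ker hx s.im (u := (s + y - x * I).im) (by
    simp
    exact (abs_sub _ _).trans (by rw [abs_of_nonneg hx]))
  have hC : 0 ≤ C := by
    by_contra h
    have := (norm_nonneg _).trans h2
    have h5 : 0 < (1 + |(s + y - x * I).im|) ^ (1/2 : ℝ) := by positivity
    nlinarith
  have h4 : Real.exp (2 * π * α * |y|) ≤ Real.exp (2 * π * α * B) := by
    have := Real.pi_pos
    gcongr
  rw [norm_mul]
  calc _ ≤ (6 * Real.exp (2 * π * α * |y|) / (1 + x ^ 2)) * (C * (1 + |(s + y - x * I).im|) ^ (1/2 : ℝ)) := by gcongr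
    _ = 6 * Real.exp (2 * π * α * |y|) * C * (1 / (1 + x ^ 2) * (1 + |(s + y - x * I).im|) ^ (1/2 : ℝ)) := by ring
    _ ≤ 6 * Real.exp (2 * π * α * B) * C * (2 * (1 + |s.im|) ^ (1/2 : ℝ) * dec x) := by gcongr
    _ = _ := by ring

lemma diff_of_open {K : ℂ → ℂ} (hK : DifferentiableOn ℂ K {z | -1/2 < z.re}) {z : ℂ} (hz : 0 ≤ z.re) :
    DifferentiableAt ℂ K z :=
  hK.differentiableAt ((isOpen_lt continuous_const Complex.continuous_re).mem_nhds
    (by simp only [Set.mem_ofPred_eq]; linarith))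

lemma fH_diff {r : ℂ → ℂ} {σ C α : ℝ} {s p : ℂ} (hr : Adm r σ C) (hα : 1 ≤ α)
    (hy : σ ≤ s.re + p.re) (hp : 0 ≤ p.im) : DifferentiableAt ℂ (fun p => KH (-(I * α * p)) * r (s + p)) p := by
  have h1 := diff_of_open KH_diff (z := -(I * α * p)) (by simp; positivity)
  have h2 := hr.diff (s + p) (by simpa using hy)
  have h3 : DifferentiableAt ℂ (fun p : ℂ => -(I * α * p)) p := by fun_prop
  have h4 : DifferentiableAt ℂ (fun p : ℂ => s + p) p := by fun_prop
  exact (DifferentiableAt.comp (f := fun p : ℂ => -(I * α * p)) p h1 h3).mul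
    (DifferentiableAt.comp (f := fun p : ℂ => s + p) p h2 h4)

lemma fL_diff {r : ℂ → ℂ} {σ C α : ℝ} {s p : ℂ} (hr : Adm r σ C) (hα : 1 ≤ α)
    (hy : σ ≤ s.re + p.re) (hp : p.im ≤ 0) : DifferentiableAt ℂ (fun p => KL (I * α * p) * r (s + p)) p := by
  have h1 := diff_of_open KL_diff (z := I * α * p) (by simp; exact mul_nonpos_of_nonneg_of_nonpos (by linarith) hp)
  have h2 := hr.diff (s + p) (by simpa using hy)
  have h3 : DifferentiableAt ℂ (fun p : ℂ => I * α * p) p := by fun_prop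
  have h4 : DifferentiableAt ℂ (fun p : ℂ => s + p) p := by fun_prop
  exact (DifferentiableAt.comp (f := fun p : ℂ => I * α * p) p h1 h3).mul
    (DifferentiableAt.comp (f := fun p : ℂ => s + p) p h2 h4)

lemma eH (α x y : ℝ) : -(I * (α : ℂ) * (y + x * I)) = α * (x - y * I) := by
  linear_combination (-(α : ℂ) * x) * Complex.I_mul_I

lemma eL (α x y : ℝ) : I * (α : ℂ) * (y - x * I) = α * (x + y * I) := by
  linear_combination (-(α : ℂ) * x) * Complex.I_mul_I

lemma intH {r : ℂ → ℂ} {σ C α y : ℝ} {s : ℂ} (hr : Adm r σ C) (hα : 1 ≤ α) (hy : σ ≤ s.re + y) :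
    IntegrableOn (fun x : ℝ => KH (α * (x - y * I)) * r (s + y + x * I)) (Set.Ioi 0) := by
  refine integrable_of_dec (C := 12 * Real.exp (2 * π * α * |y|) * C * (1 + |s.im|) ^ (1/2 : ℝ)) (fun x hx => ?_)
    (fun x hx => fH_bound hr hα hx hy le_rfl)
  have h1 := (fH_diff (s := s) (p := y + x * I) hr hα (by simpa using hy) (by simpa using hx)).continuousAt
  have h3 : ContinuousAt (fun x : ℝ => (y + x * I : ℂ)) x := by fun_prop
  have h4 := ContinuousAt.comp (f := fun x : ℝ => (y + x * I : ℂ)) h1 h3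
  refine ContinuousAt.continuousWithinAt ?_
  refine h4.congr (Eventually.of_forall fun x => ?_)
  simp only [Function.comp_apply, eH, add_assoc]

lemma intL {r : ℂ → ℂ} {σ C α y : ℝ} {s : ℂ} (hr : Adm r σ C) (hα : 1 ≤ α) (hy : σ ≤ s.re + y) :
    IntegrableOn (fun x : ℝ => KL (α * (x + y * I)) * r (s + y - x * I)) (Set.Ioi 0) := by
  refine integrable_of_dec (C := 12 * Real.exp (2 * π * α * |y|) * C * (1 + |s.im|) ^ (1/2 : ℝ)) (fun x hx => ?_)
    (fun x hx => fL_bound hr hα hx hy le_rfl)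
  have h1 := (fL_diff (s := s) (p := y - x * I) hr hα (by simpa using hy) (by simpa using hx)).continuousAt
  have h3 : ContinuousAt (fun x : ℝ => (y - x * I : ℂ)) x := by fun_prop
  have h4 := ContinuousAt.comp (f := fun x : ℝ => (y - x * I : ℂ)) h1 h3
  refine ContinuousAt.continuousWithinAt ?_
  refine h4.congr (Eventually.of_forall fun x => ?_)
  simp only [Function.comp_apply, eL, add_sub_assoc]

/-- the shift identity -/
lemma J_shift {r : ℂ → ℂ} {σ C α a b : ℝ} {s : ℂ} (hr : Adm r σ C) (hα : 1 ≤ α) (ha : 0 ≤ a) (hab : a ≤ b)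
    (hs : σ ≤ s.re + a) :
    JH α r s a + JL α r s a = JH α r s b + JL α r s b + I * ∫ y in a..b, r (s + y) := by
  have hH := half_strip (f := fun p => KH (-(I * α * p)) * r (s + p))
    (C := 12 * Real.exp (2 * π * α * b) * C * (1 + |s.im|) ^ (1/2 : ℝ)) hab
    (fun p h1 h2 h3 => fH_diff hr hα (by linarith) h3) (fun p h1 h2 h3 => by
      have := fH_bound (s := s) (x := p.im) (y := p.re) (B := b) hr hα h3 (by linarith) (by rw [abs_of_nonneg (by linarith)]; exact h2)
      rw [← eH, add_assoc, Complex.re_add_im] at this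
      exact this)
  have hL := half_strip_low (f := fun p => KL (I * α * p) * r (s + p))
    (C := 12 * Real.exp (2 * π * α * b) * C * (1 + |s.im|) ^ (1/2 : ℝ)) hab
    (fun p h1 h2 h3 => fL_diff hr hα (by linarith) h3) (fun p h1 h2 h3 => by
      have := fL_bound (s := s) (x := -p.im) (y := p.re) (B := b) hr hα (by linarith) (by linarith) (by rw [abs_of_nonneg (by linarith)]; exact h2)
      rw [← eL, add_sub_assoc] at this
      have e : (p.re : ℂ) - ((-p.im : ℝ) : ℂ) * I = p := by
        push_cast; rw [neg_mul, sub_neg_eq_add, Complex.re_add_im]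
      rw [e] at this
      exact this)
  simp only [eH, eL, ← add_assoc, ← add_sub_assoc] at hH hL
  have hmem : ∀ y ∈ Set.uIcc a b, 0 ≤ y := fun y hy => by
    rw [Set.uIcc_of_le hab] at hy; exact ha.trans hy.1
  have hcont : ContinuousOn (fun y : ℝ => KH (-(I * α * y)) * r (s + y)) (Set.uIcc a b) := by
    intro y hy
    have h0 := hmem y hy
    rw [Set.uIcc_of_le hab] at hy
    have h1 := (fH_diff (s := s) (p := y) hr hα (by simp; linarith [hy.1]) (by simp)).continuousAt
    exact (ContinuousAt.comp (f := fun x : ℝ => (x : ℂ)) h1 Complex.continuous_ofReal.continuousAt).continuousWithinAt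
  have hcont2 : ContinuousOn (fun y : ℝ => KL (I * α * y) * r (s + y)) (Set.uIcc a b) := by
    intro y hy
    have h0 := hmem y hy
    rw [Set.uIcc_of_le hab] at hy
    have h1 := (fL_diff (s := s) (p := y) hr hα (by simp; linarith [hy.1]) (by simp)).continuousAt
    exact (ContinuousAt.comp (f := fun x : ℝ => (x : ℂ)) h1 Complex.continuous_ofReal.continuousAt).continuousWithinAt
  have hj : ∫ y in a..b, r (s + y) = (∫ y in a..b, KL (I * α * y) * r (s + y)) - ∫ y in a..b, KH (-(I * α * y)) * r (s + y) := by
    rw [← intervalIntegral.integral_sub hcont2.intervalIntegrable hcont.intervalIntegrable]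
    refine intervalIntegral.integral_congr fun y hy => ?_
    have h0 := hmem y hy
    have := kernel_jump (η := α * y) (by positivity)
    have e : I * (α : ℂ) * y = (α * y : ℝ) * I := by push_cast; ring
    rw [← sub_mul, e, this, one_mul]
  rw [hj, JH, JL, JH, JL, hH, hL]
  ring

end SB

namespace SB

noncomputable def LamC (n : ℕ) : ℂ := ((ArithmeticFunction.vonMangoldt n : ℝ) : ℂ)

noncomputable def PP (M : ℕ) (s : ℂ) : ℂ := ∑ n ∈ Finset.range (M + 1), LSeries.term LamC s n

lemma PP_one (s : ℂ) : PP 1 s = 0 := by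
  simp [PP, Finset.sum_range_succ, LSeries.term, LamC]

noncomputable def B0 : ℝ := ∑' n : ℕ, ‖LSeries.term LamC 2 n‖

lemma summ_two : Summable (fun n : ℕ => ‖LSeries.term LamC 2 n‖) :=
  (ArithmeticFunction.LSeriesSummable_vonMangoldt (s := 2) (by norm_num)).norm

lemma B0_nonneg : 0 ≤ B0 := tsum_nonneg fun _ => norm_nonneg _

lemma tail_bound {s : ℂ} (hs : 2 ≤ s.re) (M : ℕ) :
    ‖deriv riemannZeta s / riemannZeta s + PP M s‖ ≤ B0 * ((M : ℝ) + 1) ^ (-(s.re - 2)) := by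
  have h1 := ArithmeticFunction.LSeriesSummable_vonMangoldt (s := s) (by linarith)
  have h2 := ArithmeticFunction.LSeries_vonMangoldt_eq_deriv_riemannZeta_div (s := s) (by linarith)
  have h3 : LSeries LamC s = - deriv riemannZeta s / riemannZeta s := h2
  have h4 : Summable (LSeries.term LamC s) := h1
  have h5 := h4.sum_add_tsum_nat_add (M + 1)
  have h6 : deriv riemannZeta s / riemannZeta s + PP M s = - ∑' n, LSeries.term LamC s (n + (M + 1)) := by
    have h7 : PP M s + ∑' n, LSeries.term LamC s (n + (M + 1)) = - deriv riemannZeta s / riemannZeta s := by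
      rw [← h3]; exact h5
    rw [neg_div] at h7
    linear_combination h7
  rw [h6, norm_neg]
  have hs2 := (summable_nat_add_iff (M + 1)).2 summ_two
  have key : ∀ n : ℕ, ‖LSeries.term LamC s (n + (M + 1))‖ ≤
      ((M : ℝ) + 1) ^ (-(s.re - 2)) * ‖LSeries.term LamC 2 (n + (M + 1))‖ := by
    intro n
    rw [LSeries.norm_term_eq, LSeries.norm_term_eq, if_neg (by omega), if_neg (by omega)]
    have hn : (0:ℝ) < ((n + (M + 1) : ℕ) : ℝ) := by positivity
    have e : (((n + (M + 1) : ℕ) : ℝ)) ^ s.re = ((n + (M + 1) : ℕ) : ℝ) ^ (2:ℂ).re * ((n + (M + 1) : ℕ) : ℝ) ^ (s.re - 2) := by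
      rw [← Real.rpow_add hn]; congr 1; simp
    rw [e, ← div_div, div_eq_mul_inv (_ / _), mul_comm, ← Real.rpow_neg hn.le]
    gcongr ?_ * _
    refine Real.rpow_le_rpow_of_nonpos (by positivity) ?_ (by linarith)
    push_cast
    linarith [(by positivity : (0:ℝ) ≤ n)]
  refine (tsum_of_norm_bounded (hs2.mul_left _).hasSum key).trans ?_
  rw [tsum_mul_left, mul_comm]
  gcongr
  rw [B0, ← summ_two.sum_add_tsum_nat_add (M + 1)]
  have : 0 ≤ ∑ i ∈ Finset.range (M + 1), ‖LSeries.term LamC 2 i‖ := Finset.sum_nonneg fun _ _ => norm_nonneg _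
  linarith

lemma sum_inv_sqrt (M : ℕ) : ∑ n ∈ Finset.range M, 1 / Real.sqrt ((n : ℝ) + 1) ≤ 2 * Real.sqrt M := by
  induction M with
  | zero => simp
  | succ k ih =>
    rw [Finset.sum_range_succ]
    push_cast
    have hp : 0 < Real.sqrt ((k : ℝ) + 1) := Real.sqrt_pos.2 (by positivity)
    have h1 : Real.sqrt ((k : ℝ) + 1) ^ 2 = k + 1 := Real.sq_sqrt (by positivity)
    have h2 : Real.sqrt (k : ℝ) ^ 2 = k := Real.sq_sqrt (by positivity)
    have h3 : 1 / Real.sqrt ((k : ℝ) + 1) ≤ 2 * Real.sqrt ((k : ℝ) + 1) - 2 * Real.sqrt k := by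
      rw [div_le_iff₀ hp]
      nlinarith [sq_nonneg (Real.sqrt ((k : ℝ) + 1) - Real.sqrt k)]
    linarith

lemma PP_bound {s : ℂ} (hs : 1/2 ≤ s.re) {M : ℕ} {l : ℝ} (hl : 0 ≤ l) (hM : (M : ℝ) ≤ Real.exp l) :
    ‖PP M s‖ ≤ 2 * l * Real.exp (l / 2) := by
  have h1 : ‖PP M s‖ ≤ ∑ n ∈ Finset.range M, l * (1 / Real.sqrt ((n : ℝ) + 1)) := by
    rw [PP, Finset.sum_range_succ']
    simp only [LSeries.term_zero, add_zero]
    refine norm_sum_le_of_le _ fun n hn => ?_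
    rw [LSeries.norm_term_eq, if_neg (by omega)]
    have hn' : ((n + 1 : ℕ) : ℝ) ≤ M := by exact_mod_cast Finset.mem_range.1 hn
    have h2 : ‖LamC (n + 1)‖ ≤ l := by
      rw [LamC, Complex.norm_real, Real.norm_eq_abs, abs_of_nonneg ArithmeticFunction.vonMangoldt_nonneg]
      refine ArithmeticFunction.vonMangoldt_le_log.trans ?_
      rw [Real.log_le_iff_le_exp (by positivity)]
      exact hn'.trans hM
    rw [mul_one_div]
    have h3 : Real.sqrt ((n : ℝ) + 1) ≤ ((n + 1 : ℕ) : ℝ) ^ s.re := by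
      rw [Real.sqrt_eq_rpow]
      push_cast
      exact Real.rpow_le_rpow_of_exponent_le (by linarith [(by positivity : (0:ℝ) ≤ n)]) hs
    gcongr
  rw [← Finset.mul_sum] at h1
  refine h1.trans ?_
  have h4 : Real.sqrt M ≤ Real.exp (l / 2) := by
    rw [Real.sqrt_le_left (by positivity), ← Real.exp_nat_mul]
    refine hM.trans_eq ?_
    congr 1; push_cast; ring
  have h5 := sum_inv_sqrt M
  calc _ ≤ l * (2 * Real.exp (l / 2)) := by gcongr; linarith
    _ = _ := by ring

lemma PP_diff (M : ℕ) : Differentiable ℂ (PP M) := by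
  unfold PP
  refine Differentiable.fun_sum fun n _ => ?_
  have e : (fun s => LSeries.term LamC s n) = fun s => if n = 0 then 0 else LamC n / (n : ℂ) ^ s := by
    funext s; rfl
  rw [e]
  by_cases hn : n = 0
  · simp [hn]
  · simp only [hn, if_false]
    have hn' : (n : ℂ) ≠ 0 := by exact_mod_cast hn
    intro s
    have h1 : DifferentiableAt ℂ (fun s : ℂ => (n : ℂ) ^ s) s :=
      differentiableAt_id.const_cpow (Or.inl hn')
    exact (differentiableAt_const _).div h1 (by simp [Complex.cpow_eq_zero_iff, hn'])

noncomputable def rr (M : ℕ) (s : ℂ) : ℂ := deriv riemannZeta₁ s / riemannZeta₁ s - 1 / (s + 1) + PP M s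
noncomputable def EE (s : ℂ) : ℂ := 1 / (s - 1) - 1 / (s + 1)
noncomputable def qq (M : ℕ) (s : ℂ) : ℂ := rr M s - EE s

lemma inv_add_one_bound {s : ℂ} (hs : 0 ≤ s.re) : ‖1 / (s + 1)‖ ≤ 1 := by
  rw [norm_div, norm_one]
  have : 1 ≤ ‖s + 1‖ := by
    refine le_trans ?_ (Complex.re_le_norm _)
    simpa using hs
  exact div_le_one_of_le₀ this (norm_nonneg _)

lemma rr_eq (RH : RHyp) {s : ℂ} (hs : 1/2 < s.re) (h1 : s ≠ 1) (M : ℕ) :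
    rr M s = deriv riemannZeta s / riemannZeta s + EE s + PP M s := by
  rw [rr, logderiv_zeta1 h1 (zeta_ne_zero RH hs), EE]; ring

lemma ne_one_of_re {s : ℂ} (hs : 2 ≤ s.re) : s ≠ 1 := by
  rintro rfl; norm_num at hs

lemma qq_bound (RH : RHyp) {s : ℂ} (hs : 2 ≤ s.re) (M : ℕ) :
    ‖qq M s‖ ≤ B0 * ((M : ℝ) + 1) ^ (-(s.re - 2)) := by
  have h := tail_bound hs M
  rw [qq, rr_eq RH (by linarith) (ne_one_of_re hs)]
  convert h using 2
  ring

lemma one_le_rp (u : ℝ) : 1 ≤ (1 + |u|) ^ (1/2 : ℝ) := Real.one_le_rpow (by linarith [abs_nonneg u]) (by norm_num)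

lemma rr_diff (RH : RHyp) {s : ℂ} (hs : 1/2 < s.re) (M : ℕ) : DifferentiableAt ℂ (rr M) s := by
  have h1 : DifferentiableAt ℂ (deriv riemannZeta₁) s := (differentiable_riemannZeta₁.deriv) s
  have h2 := differentiable_riemannZeta₁ s
  have h3 := zeta1_ne_zero RH hs
  have h4 : s + 1 ≠ 0 := by
    intro h
    have := congrArg Complex.re h
    simp at this; linarith
  have h5 : DifferentiableAt ℂ (fun s : ℂ => 1 / (s + 1)) s := by fun_prop (disch := exact h4)
  exact ((h1.div h2 h3).sub h5).add (PP_diff M s)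

lemma rr_adm (RH : RHyp) {σ : ℝ} (hσ : 1/2 < σ) (M : ℕ) : ∃ C, Adm (rr M) σ C := by
  obtain ⟨C, hC, h⟩ := growth RH (δ := σ - 1/2) (by linarith)
  set D := 2 * Real.log (M + 1) * Real.exp (Real.log (M + 1) / 2) with hD
  have hD0 : 0 ≤ D := by
    have : 0 ≤ Real.log ((M : ℝ) + 1) := Real.log_nonneg (by linarith [(by positivity : (0:ℝ) ≤ M)])
    positivity
  refine ⟨C + 1 + D, fun s hs => rr_diff RH (by linarith) M, fun s hs => ?_⟩
  have h1 := (h s (by linarith)).1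
  have h2 := inv_add_one_bound (s := s) (by linarith)
  have h3 := PP_bound (s := s) (by linarith) (M := M) (l := Real.log (M + 1)) (Real.log_nonneg (by linarith [(by positivity : (0:ℝ) ≤ M)])) (by
    rw [Real.exp_log (by positivity)]; linarith)
  have h4 := one_le_rp s.im
  rw [rr]
  calc _ ≤ ‖deriv riemannZeta₁ s / riemannZeta₁ s‖ + ‖1 / (s + 1)‖ + ‖PP M s‖ :=
        (norm_add_le _ _).trans (by gcongr; exact norm_sub_le _ _)
    _ ≤ C * (1 + |s.im|) ^ (1/2 : ℝ) + 1 + D := by gcongr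
    _ ≤ _ := by nlinarith

lemma EE_diff {s : ℂ} (hs : 2 ≤ s.re) : DifferentiableAt ℂ EE s := by
  have h1 : s - 1 ≠ 0 := sub_ne_zero.2 (ne_one_of_re hs)
  have h4 : s + 1 ≠ 0 := by
    intro h
    have := congrArg Complex.re h
    simp at this; linarith
  unfold EE
  fun_prop (disch := assumption)

lemma EE_bound {s : ℂ} (hs : 2 ≤ s.re) : ‖EE s‖ ≤ 2 / (1 + s.im ^ 2) := by
  have h1 : s - 1 ≠ 0 := sub_ne_zero.2 (ne_one_of_re hs)
  have h4 : s + 1 ≠ 0 := by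
    intro h
    have := congrArg Complex.re h
    simp at this; linarith
  have e : EE s = 2 / ((s - 1) * (s + 1)) := by
    rw [EE]; field_simp; ring
  have a : 1 + s.im ^ 2 ≤ ‖s - 1‖ ^ 2 := by rw [nsq]; simp only [Complex.sub_re, Complex.sub_im, Complex.add_re, Complex.add_im, Complex.one_re, Complex.one_im, sub_zero, add_zero]; nlinarith
  have b : 1 + s.im ^ 2 ≤ ‖s + 1‖ ^ 2 := by rw [nsq]; simp only [Complex.sub_re, Complex.sub_im, Complex.add_re, Complex.add_im, Complex.one_re, Complex.one_im, sub_zero, add_zero]; nlinarith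
  have c : 1 + s.im ^ 2 ≤ ‖s - 1‖ * ‖s + 1‖ := by
    refine (sq_le_sq₀ (by positivity) (by positivity)).1 ?_
    rw [mul_pow, pow_two (1 + s.im ^ 2)]
    exact mul_le_mul a b (by positivity) (by positivity)
  rw [e, norm_div, norm_mul]
  simp only [RCLike.norm_ofNat]
  gcongr

lemma EE_adm : Adm EE 2 2 := by
  refine ⟨fun s hs => EE_diff hs, fun s hs => (EE_bound hs).trans ?_⟩
  have h4 := one_le_rp s.im
  have : 2 / (1 + s.im ^ 2) ≤ 2 := div_le_self (by norm_num) (by nlinarith [sq_nonneg s.im])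
  linarith

lemma qq_adm (RH : RHyp) (M : ℕ) : Adm (qq M) 2 B0 := by
  refine ⟨fun s hs => (rr_diff RH (by linarith) M).sub (EE_diff hs), fun s hs => (qq_bound RH hs M).trans ?_⟩
  have h4 := one_le_rp s.im
  have : ((M : ℝ) + 1) ^ (-(s.re - 2)) ≤ 1 :=
    Real.rpow_le_one_of_one_le_of_nonpos (by linarith [(by positivity : (0:ℝ) ≤ M)]) (by linarith)
  have hB := B0_nonneg
  gcongr
  exact this.trans h4

end SB

namespace SB

lemma two_frac (x u : ℝ) : 1 / (1 + x ^ 2) * (1 / (1 + u ^ 2)) ≤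
    2 / (1 + (u - x) ^ 2) * (1 / (1 + x ^ 2) + 1 / (1 + u ^ 2)) := by
  have e : 1 / (1 + x ^ 2) + 1 / (1 + u ^ 2) = (1 / (1 + x ^ 2) * (1 / (1 + u ^ 2))) * (2 + x ^ 2 + u ^ 2) := by
    field_simp; ring
  rw [e]
  have h : 1 ≤ 2 / (1 + (u - x) ^ 2) * (2 + x ^ 2 + u ^ 2) := by
    rw [div_mul_eq_mul_div, le_div_iff₀ (by positivity)]
    nlinarith [sq_nonneg (u + x)]
  calc _ = (1 / (1 + x ^ 2) * (1 / (1 + u ^ 2))) * 1 := by ring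
    _ ≤ (1 / (1 + x ^ 2) * (1 / (1 + u ^ 2))) * (2 / (1 + (u - x) ^ 2) * (2 + x ^ 2 + u ^ 2)) := by gcongr
    _ = _ := by ring

lemma int_frac : Integrable (fun x : ℝ => 1 / (1 + x ^ 2)) := by
  simpa [one_div] using integrable_inv_one_add_sq

lemma int_frac_val : ∫ x : ℝ, 1 / (1 + x ^ 2) = π := by
  simpa [one_div] using integral_univ_inv_one_add_sq

lemma int_frac_set {g : ℝ → ℝ} (hg : Integrable g) (h0 : ∀ x, 0 ≤ g x) :
    ∫ x in Set.Ioi (0:ℝ), g x ≤ ∫ x, g x :=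
  setIntegral_le_integral hg (Eventually.of_forall h0)

/-- a common estimate for the two pieces of `J_E`. -/
lemma E_piece {g : ℝ → ℂ} {A t : ℝ} (hA : 0 ≤ A) {u : ℝ → ℝ} (hu : (∀ x, u x = t + x) ∨ (∀ x, u x = t - x))
    (hg : ∀ x, 0 ≤ x → ‖g x‖ ≤ A * (1 / (1 + x ^ 2) * (1 / (1 + u x ^ 2)))) :
    ‖∫ x in Set.Ioi (0:ℝ), g x‖ ≤ A * (2 / (1 + t ^ 2) * (2 * π)) := by
  have hI : Integrable (fun x => 1 / (1 + u x ^ 2)) ∧ ∫ x, 1 / (1 + u x ^ 2) = π := by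
    rcases hu with hu | hu
    · simp only [hu]
      exact ⟨int_frac.comp_add_left t, by
        rw [integral_add_left_eq_self (fun x : ℝ => 1 / (1 + x ^ 2)) t]; exact int_frac_val⟩
    · simp only [hu]
      exact ⟨int_frac.comp_sub_left t, by
        rw [integral_sub_left_eq_self (fun x : ℝ => 1 / (1 + x ^ 2)) _ t]; exact int_frac_val⟩
  have h2 : ∀ x, 0 ≤ x → ‖g x‖ ≤ A * (2 / (1 + t ^ 2) * (1 / (1 + x ^ 2) + 1 / (1 + u x ^ 2))) := by
    intro x hx
    refine (hg x hx).trans ?_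
    refine mul_le_mul_of_nonneg_left ?_ hA
    rcases hu with hu | hu
    · have := two_frac x (u x)
      rwa [hu, add_sub_cancel_right, ← hu] at this
    · have := two_frac (-x) (u x)
      rwa [hu, sub_neg_eq_add, sub_add_cancel, neg_sq, ← hu] at this
  have hInt : Integrable (fun x => A * (2 / (1 + t ^ 2) * (1 / (1 + x ^ 2) + 1 / (1 + u x ^ 2)))) :=
    ((int_frac.add hI.1).const_mul _).const_mul _
  refine (norm_integral_le_of_norm_le hInt.integrableOn
    ((ae_restrict_iff' measurableSet_Ioi).2 (Eventually.of_forall fun x hx => h2 x (le_of_lt hx)))).trans ?_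
  refine (int_frac_set hInt fun x => by positivity).trans_eq ?_
  rw [integral_const_mul, integral_const_mul, integral_add int_frac hI.1, hI.2, int_frac_val]
  ring

lemma JE_bound {α y : ℝ} {s : ℂ} (hα : 1 ≤ α) (hy0 : 0 ≤ y) (hy : y ≤ 3/2) (hs : s.re + y = 2)
    (hexp : Real.exp (3 * π * α) ≤ 1 + s.im ^ 2) : ‖JH α EE s y + JL α EE s y‖ ≤ 96 * π := by
  have hpi := Real.pi_pos
  have he : Real.exp (2 * π * α * |y|) ≤ Real.exp (3 * π * α) := by
    apply Real.exp_le_exp.2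
    rw [abs_of_nonneg hy0]
    have : 0 < π * α := by positivity
    nlinarith
  have hH : ‖JH α EE s y‖ ≤ (12 * Real.exp (3 * π * α)) * (2 / (1 + s.im ^ 2) * (2 * π)) := by
    refine E_piece (by positivity) (u := fun x => s.im + x) (Or.inl fun x => rfl) fun x hx => ?_
    rw [norm_mul]
    have h1 := (KH_scaled hα hx y)
    have h2 := EE_bound (s := s + y + x * I) (by simp [hs])
    have e : (s + y + x * I).im = s.im + x := by simp
    rw [e] at h2
    calc _ ≤ (6 * Real.exp (2 * π * α * |y|) / (1 + x ^ 2)) * (2 / (1 + (s.im + x) ^ 2)) := by gcongr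
      _ ≤ (6 * Real.exp (3 * π * α) / (1 + x ^ 2)) * (2 / (1 + (s.im + x) ^ 2)) := by gcongr
      _ = _ := by ring
  have hL : ‖JL α EE s y‖ ≤ (12 * Real.exp (3 * π * α)) * (2 / (1 + s.im ^ 2) * (2 * π)) := by
    refine E_piece (by positivity) (u := fun x => s.im - x) (Or.inr fun x => rfl) fun x hx => ?_
    rw [norm_mul]
    have h1 := (KL_scaled hα hx y)
    have h2 := EE_bound (s := s + y - x * I) (by simp [hs])
    have e : (s + y - x * I).im = s.im - x := by simp
    rw [e] at h2
    calc _ ≤ (6 * Real.exp (2 * π * α * |y|) / (1 + x ^ 2)) * (2 / (1 + (s.im - x) ^ 2)) := by gcongr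
      _ ≤ (6 * Real.exp (3 * π * α) / (1 + x ^ 2)) * (2 / (1 + (s.im - x) ^ 2)) := by gcongr
      _ = _ := by ring
  have h3 : (12 * Real.exp (3 * π * α)) * (2 / (1 + s.im ^ 2) * (2 * π)) ≤ 48 * π := by
    have : (12 * Real.exp (3 * π * α)) * (2 / (1 + s.im ^ 2) * (2 * π)) = 48 * π * (Real.exp (3 * π * α) / (1 + s.im ^ 2)) := by ring
    rw [this]
    have h4 : Real.exp (3 * π * α) / (1 + s.im ^ 2) ≤ 1 := div_le_one_of_le₀ hexp (by positivity)
    nlinarith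
  refine (norm_add_le _ _).trans ?_
  linarith

/-- `J_q(Y)` estimate -/
lemma Jq_bound (RH : RHyp) {α Y : ℝ} {s : ℂ} (hα : 1 ≤ α) (hY : 0 ≤ Y) (hs : 2 ≤ s.re + Y) (M : ℕ) :
    ‖JH α (qq M) s Y + JL α (qq M) s Y‖ ≤
      12 * π * B0 * (Real.exp (2 * π * α * Y) * ((M : ℝ) + 1) ^ (-(s.re + Y - 2))) := by
  have hpi := Real.pi_pos
  have hB := B0_nonneg
  set A := 6 * Real.exp (2 * π * α * Y) * (B0 * ((M : ℝ) + 1) ^ (-(s.re + Y - 2))) with hA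
  have hA0 : 0 ≤ A := by positivity
  have gen : ∀ g : ℝ → ℂ, (∀ x, 0 ≤ x → ‖g x‖ ≤ A * (1 / (1 + x ^ 2))) → ‖∫ x in Set.Ioi (0:ℝ), g x‖ ≤ A * π := by
    intro g hg
    have hInt : Integrable (fun x : ℝ => A * (1 / (1 + x ^ 2))) := int_frac.const_mul _
    refine (norm_integral_le_of_norm_le hInt.integrableOn
      ((ae_restrict_iff' measurableSet_Ioi).2 (Eventually.of_forall fun x hx => hg x (le_of_lt hx)))).trans ?_
    refine (int_frac_set hInt fun x => by positivity).trans_eq ?_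
    rw [integral_const_mul, int_frac_val]
  have hH : ‖JH α (qq M) s Y‖ ≤ A * π := by
    refine gen _ fun x hx => ?_
    rw [norm_mul]
    have h1 := (KH_scaled hα hx Y)
    have h2 := qq_bound RH (s := s + Y + x * I) (by simpa using hs) M
    have e : (s + Y + x * I).re = s.re + Y := by simp
    rw [e] at h2
    rw [abs_of_nonneg hY] at h1
    calc _ ≤ (6 * Real.exp (2 * π * α * Y) / (1 + x ^ 2)) * (B0 * ((M : ℝ) + 1) ^ (-(s.re + Y - 2))) := by gcongr
      _ = _ := by rw [hA]; ring
  have hL : ‖JL α (qq M) s Y‖ ≤ A * π := by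
    refine gen _ fun x hx => ?_
    rw [norm_mul]
    have h1 := (KL_scaled hα hx Y)
    have h2 := qq_bound RH (s := s + Y - x * I) (by simpa using hs) M
    have e : (s + Y - x * I).re = s.re + Y := by simp
    rw [e] at h2
    rw [abs_of_nonneg hY] at h1
    calc _ ≤ (6 * Real.exp (2 * π * α * Y) / (1 + x ^ 2)) * (B0 * ((M : ℝ) + 1) ^ (-(s.re + Y - 2))) := by gcongr
      _ = _ := by rw [hA]; ring
  refine (norm_add_le _ _).trans ((add_le_add hH hL).trans_eq ?_)
  rw [hA]; ring

lemma exp_tail_int (a b : ℝ) : ∫ y in a..b, Real.exp (-(Real.log 2) * (y - a)) ≤ 1 / Real.log 2 := by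
  have hl : 0 < Real.log 2 := Real.log_pos (by norm_num)
  have : ∀ y ∈ Set.uIcc a b, HasDerivAt (fun y => -(1 / Real.log 2) * Real.exp (-(Real.log 2) * (y - a))) (Real.exp (-(Real.log 2) * (y - a))) y := by
    intro y _
    have h1 : HasDerivAt (fun y => -(Real.log 2) * (y - a)) (-(Real.log 2) * 1) y :=
      ((hasDerivAt_id y).sub_const a).const_mul _
    refine (h1.exp.const_mul (-(1 / Real.log 2))).congr_deriv ?_
    field_simp
  rw [intervalIntegral.integral_eq_sub_of_hasDerivAt this (by
    apply Continuous.intervalIntegrable; fun_prop)]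
  have h2 : 0 < 1 / Real.log 2 * Real.exp (-(Real.log 2) * (b - a)) := by positivity
  simp only [sub_self, mul_zero, Real.exp_zero, mul_one]
  linarith

lemma rpow_le_two {M : ℕ} (hM : 1 ≤ M) {e : ℝ} (he : 0 ≤ e) :
    ((M : ℝ) + 1) ^ (-e) ≤ Real.exp (-(Real.log 2) * e) := by
  have h1 : (1:ℝ) ≤ M := by exact_mod_cast hM
  have : Real.exp (-(Real.log 2) * e) = (2:ℝ) ^ (-e) := by
    rw [Real.rpow_def_of_pos (by norm_num)]; congr 1; ring
  rw [this]
  exact Real.rpow_le_rpow_of_nonpos (by norm_num) (by linarith) (by linarith)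

lemma Jq_const (RH : RHyp) {α Y : ℝ} {s : ℂ} (hα : 1 ≤ α) (hY : 0 ≤ Y) (hs : s.re + Y = 2) {M : ℕ}
    (hM1 : 1 ≤ M) (hM : Real.exp (2 * π * α) < M + 1) :
    ‖JH α (qq M) s Y + JL α (qq M) s Y‖ ≤ B0 / Real.log 2 := by
  have hpi := Real.pi_pos
  have hB := B0_nonneg
  set ρ := Real.exp (2 * π * α) * ((M : ℝ) + 1)⁻¹ with hρ
  have hM0 : (0:ℝ) < (M : ℝ) + 1 := by positivity
  have hρ0 : 0 < ρ := by positivity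
  have hρ1 : ρ < 1 := by rw [hρ, ← div_eq_mul_inv, div_lt_one hM0]; exact hM
  have hstep : ∀ Z, Y ≤ Z → ‖JH α (qq M) s Y + JL α (qq M) s Y‖ ≤
      12 * π * B0 * ((M : ℝ) + 1) ^ Y * ρ ^ Z + B0 / Real.log 2 := by
    intro Z hZ
    rw [J_shift (qq_adm RH M) hα hY hZ hs.ge]
    refine (norm_add_le _ _).trans (add_le_add ?_ ?_)
    · refine (Jq_bound RH hα (hY.trans hZ) (by linarith) M).trans_eq ?_
      have e1 : s.re + Z - 2 = Z - Y := by linarith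
      rw [e1, hρ, Real.mul_rpow (by positivity) (by positivity), ← Real.exp_mul, Real.inv_rpow hM0.le,
        ← Real.rpow_neg hM0.le, neg_sub, sub_eq_add_neg, Real.rpow_add hM0]
      ring
    · rw [norm_mul, Complex.norm_I, one_mul]
      have hb : ∀ y ∈ Set.Ioc Y Z, ‖qq M (s + y)‖ ≤ B0 * Real.exp (-(Real.log 2) * (y - Y)) := by
        intro y hy
        have h1 := qq_bound RH (s := s + y) (by simp; linarith [hy.1]) M
        have h2 := rpow_le_two hM1 (e := (s + (y:ℂ)).re - 2) (by simp; linarith [hy.1])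
        refine h1.trans ?_
        have e : (s + (y:ℂ)).re - 2 = y - Y := by simp; linarith
        rw [e] at h2 ⊢
        gcongr
      refine (intervalIntegral.norm_integral_le_of_norm_le hZ (Eventually.of_forall hb) ?_).trans ?_
      · apply Continuous.intervalIntegrable; fun_prop
      · rw [intervalIntegral.integral_const_mul, div_eq_mul_one_div B0]
        gcongr
        exact exp_tail_int _ _
  have hlim : Tendsto (fun Z : ℝ => 12 * π * B0 * ((M : ℝ) + 1) ^ Y * ρ ^ Z + B0 / Real.log 2) atTop
      (nhds (12 * π * B0 * ((M : ℝ) + 1) ^ Y * 0 + B0 / Real.log 2)) :=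
    ((tendsto_rpow_atTop_of_base_lt_one ρ (by linarith) hρ1).const_mul _).add_const _
  rw [mul_zero, zero_add] at hlim
  refine ge_of_tendsto hlim ?_
  filter_upwards [eventually_ge_atTop Y] with Z hZ using hstep Z hZ

end SB

namespace SB

lemma scr_scaled_int {α : ℝ} (hα : 1 ≤ α) : IntegrableOn (fun x => scr (α * x) ^ 2) (Set.Ioi 0) := by
  have := (integrableOn_Ioi_comp_mul_left_iff (fun x => scr x ^ 2) 0 (a := α) (by linarith)).2
    (by simpa using scr_integrable)
  exact this

lemma scr_scaled_val {α : ℝ} (hα : 1 ≤ α) : ∫ x in Set.Ioi (0:ℝ), scr (α * x) ^ 2 = 1 / (2 * α) := by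
  have := integral_comp_mul_left_Ioi (fun x => scr x ^ 2) 0 (b := α) (by linarith)
  rw [this, mul_zero, scr_integral, smul_eq_mul]
  field_simp

lemma scr_sq_bound {α x : ℝ} (hα : 1 ≤ α) : scr (α * x) ^ 2 ≤ 2 / (1 + x ^ 2) := by
  have h := sc_sq_bound ((α * x : ℝ) : ℂ)
  rw [sc_real, Complex.norm_real, Complex.norm_real, Real.norm_eq_abs, Real.norm_eq_abs, sq_abs, sq_abs] at h
  simp only [Complex.ofReal_im, abs_zero, mul_zero, Real.exp_zero, mul_one] at h
  rw [le_div_iff₀ (by positivity)]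
  refine le_trans ?_ h
  have : x ^ 2 ≤ (α * x) ^ 2 := by
    rw [mul_pow]
    nlinarith [sq_nonneg x, mul_nonneg (sub_nonneg.2 hα) (sq_nonneg x), mul_nonneg (mul_nonneg (sub_nonneg.2 hα) (by linarith : 0 ≤ α)) (sq_nonneg x)]
  gcongr

lemma scr_log {α x : ℝ} (hα : 1 ≤ α) (hx : 0 ≤ x) :
    scr (α * x) ^ 2 * (1/2 * Real.log (1 + x)) ≤ 4 * dec x := by
  have h1 := scr_sq_bound (x := x) hα
  have h2 := Real.log_le_rpow_div (x := 1 + x) (by linarith) (ε := 1/2) (by norm_num)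
  have h3 := dec_ker hx 0 (u := x) (by simp [abs_of_nonneg hx])
  rw [abs_of_nonneg hx] at h3
  simp only [abs_zero, add_zero, Real.one_rpow, mul_one] at h3
  have h0 : 0 ≤ Real.log (1 + x) := Real.log_nonneg (by linarith)
  calc _ ≤ 2 / (1 + x ^ 2) * (1/2 * ((1 + x) ^ (1/2:ℝ) / (1/2))) := by gcongr
    _ = 2 * (1 / (1 + x ^ 2) * (1 + x) ^ (1/2:ℝ)) := by ring
    _ ≤ 2 * (2 * dec x) := by gcongr
    _ = _ := by ring

lemma re_rr_lower (RH : RHyp) {s : ℂ} (hs : 1/2 < s.re) (hs1 : s.re ≤ 1) {M : ℕ} {D : ℝ}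
    (hD : ‖PP M s‖ ≤ D) {t x : ℝ} (hx : 0 ≤ x) (hu : |s.im| ≤ |t| + x) :
    -((1/2) * Real.log (|t| + 2) + 7/4 + D) - 1/2 * Real.log (1 + x) ≤ (rr M s).re := by
  have h1 := re_logderiv_lower RH hs hs1
  have h2 := (Complex.abs_re_le_norm _).trans (inv_add_one_bound (s := s) (by linarith))
  have h3 := (Complex.abs_re_le_norm _).trans hD
  have h4 : Real.log (|s.im| + 2) ≤ Real.log (|t| + 2) + Real.log (1 + x) := by
    rw [← Real.log_mul (by positivity) (by positivity)]
    apply Real.log_le_log (by positivity)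
    nlinarith [abs_nonneg t, mul_nonneg (abs_nonneg t) hx]
  rw [rr, Complex.add_re, Complex.sub_re]
  linarith [abs_le.1 h2, abs_le.1 h3]

lemma Jr_lower (RH : RHyp) {α : ℝ} (hα : 1 ≤ α) {s : ℂ} (hs : 1/2 < s.re) (hs1 : s.re ≤ 1) {M : ℕ} {D : ℝ}
    (hD : ∀ s : ℂ, 1/2 ≤ s.re → ‖PP M s‖ ≤ D) :
    -(((1/2) * Real.log (|s.im| + 2) + 7/4 + D) * (1 / (2 * α)) + 4 * ∫ x in Set.Ioi (0:ℝ), dec x) ≤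
      (JH α (rr M) s 0 + JL α (rr M) s 0).re := by
  obtain ⟨C, hC⟩ := rr_adm RH hs M
  have iH := intH (y := 0) (s := s) hC hα (by simp)
  have iL := intL (y := 0) (s := s) hC hα (by simp)
  set G := (1/2) * Real.log (|s.im| + 2) + 7/4 + D with hG
  have hlow : IntegrableOn (fun x => -(G * scr (α * x) ^ 2 + 4 * dec x)) (Set.Ioi 0) :=
    (((scr_scaled_int hα).const_mul G).add (dec_integrable.const_mul 4)).neg
  have iHL : IntegrableOn (fun x : ℝ => KH (α*(x-((0:ℝ):ℂ)*I)) * rr M (s+((0:ℝ):ℂ)+x*I) + KL (α*(x+((0:ℝ):ℂ)*I)) * rr M (s+((0:ℝ):ℂ)-x*I)) (Set.Ioi 0) := iH.add iL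
  rw [JH, JL, ← integral_add iH iL, ← Complex.reCLM_apply, ← Complex.reCLM.integral_comp_comm iHL]
  have hval : ∫ x in Set.Ioi (0:ℝ), -(G * scr (α * x) ^ 2 + 4 * dec x) =
      -(G * (1 / (2 * α)) + 4 * ∫ x in Set.Ioi (0:ℝ), dec x) := by
    rw [integral_neg, integral_add ((scr_scaled_int hα).const_mul G) (dec_integrable.const_mul 4),
      integral_const_mul, integral_const_mul, scr_scaled_val hα]
  rw [← hval]
  refine setIntegral_mono_on hlow (Complex.reCLM.integrable_comp iHL) measurableSet_Ioi fun x hx => ?_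
  have hx0 : (0:ℝ) ≤ x := le_of_lt hx
  obtain ⟨a, b, ha, hb, h1, h2, h3⟩ := kernel_real (x := α * x) (by positivity)
  have e1 : (α : ℂ) * (x - ((0:ℝ):ℂ) * I) = ((α * x : ℝ) : ℂ) := by push_cast; ring
  have e2 : (α : ℂ) * (x + ((0:ℝ):ℂ) * I) = ((α * x : ℝ) : ℂ) := by push_cast; ring
  rw [e1, e2, h1, h2]
  simp only [Complex.reCLM_apply, Complex.add_re, Complex.re_ofReal_mul]
  have hp := re_rr_lower RH (s := s + ((0:ℝ):ℂ) + x * I) (M := M) (D := D) (t := s.im) (x := x) (by simpa using hs) (by simpa using hs1)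
    (hD _ (by simpa using hs.le)) hx0 (by simpa using (abs_add_le s.im x).trans (by rw [abs_of_nonneg hx0]))
  have hm := re_rr_lower RH (s := s + ((0:ℝ):ℂ) - x * I) (M := M) (D := D) (t := s.im) (x := x) (by simpa using hs) (by simpa using hs1)
    (hD _ (by simpa using hs.le)) hx0 (by simpa using (abs_sub s.im x).trans (by rw [abs_of_nonneg hx0]))
  rw [← hG] at hp hm
  have h4 := scr_log hα hx0
  have h5 := mul_le_mul_of_nonneg_left hp ha
  have h6 := mul_le_mul_of_nonneg_left hm hb
  have h7 : G * scr (α * x) ^ 2 = G * a + G * b := by rw [← h3]; ring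
  have h8 : scr (α * x) ^ 2 * (1/2 * Real.log (1 + x)) = a * (1/2 * Real.log (1 + x)) + b * (1/2 * Real.log (1 + x)) := by rw [← h3]; ring
  linarith

noncomputable def ZZ (s : ℂ) : ℂ := deriv riemannZeta s / riemannZeta s

lemma ZZ_cont (RH : RHyp) {s : ℂ} (hs : 1/2 < s.re) (h1 : s ≠ 1) : ContinuousAt ZZ s := by
  have hopen : IsOpen ({1}ᶜ : Set ℂ) := isOpen_compl_singleton
  have hd : DifferentiableOn ℂ riemannZeta {1}ᶜ := fun z hz => (differentiableAt_riemannZeta hz).differentiableWithinAt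
  have h2 : DifferentiableAt ℂ (deriv riemannZeta) s := (hd.deriv hopen).differentiableAt (hopen.mem_nhds h1)
  exact (h2.div (differentiableAt_riemannZeta h1) (zeta_ne_zero RH hs)).continuousAt

lemma ZZ_bound {s : ℂ} (hs : 2 ≤ s.re) : ‖ZZ s‖ ≤ B0 * Real.exp (-(Real.log 2) * (s.re - 2)) := by
  have h := tail_bound hs 1
  rw [PP_one, add_zero] at h
  refine h.trans ?_
  have := rpow_le_two le_rfl (e := s.re - 2) (by linarith)
  have hB := B0_nonneg
  gcongr

lemma ne_one_im {s : ℂ} (hs : s.im ≠ 0) : s ≠ 1 := by rintro rfl; simp at hs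

lemma ZZ_line_cont (RH : RHyp) {t : ℝ} (ht : t ≠ 0) {σ : ℝ} (hσ : 1/2 < σ) :
    ContinuousAt (fun σ : ℝ => ZZ (σ + t * I)) σ := by
  have h1 := ZZ_cont RH (s := σ + t * I) (by simpa using hσ) (ne_one_im (by simpa using ht))
  have h3 : ContinuousAt (fun x : ℝ => (x + t * I : ℂ)) σ := by fun_prop
  exact ContinuousAt.comp (f := fun x : ℝ => (x + t * I : ℂ)) h1 h3

lemma exp_tail_integrable : IntegrableOn (fun σ : ℝ => B0 * Real.exp (-(Real.log 2) * (σ - 2))) (Set.Ioi 2) := by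
  refine Integrable.const_mul ?_ _
  have := (integrableOn_exp_mul_Ioi (a := -Real.log 2) (by simpa using Real.log_pos (by norm_num : (1:ℝ) < 2)) 2).mul_const (Real.exp (Real.log 2 * 2))
  refine this.congr (Eventually.of_forall fun σ => ?_)
  simp only [← Real.exp_add]
  congr 1; ring

lemma ZZ_integrable (RH : RHyp) {t : ℝ} (ht : t ≠ 0) : IntegrableOn (fun σ : ℝ => ZZ (σ + t * I)) (Set.Ioi 2) := by
  refine Integrable.mono' exp_tail_integrable ?_ ?_
  · refine ContinuousOn.aestronglyMeasurable (fun σ hσ => ?_) measurableSet_Ioi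
    have : (2:ℝ) < σ := hσ
    exact (ZZ_line_cont RH ht (by linarith)).continuousWithinAt
  · refine (ae_restrict_iff' measurableSet_Ioi).2 (Eventually.of_forall fun σ hσ => ?_)
    have : (2:ℝ) < σ := hσ
    simpa using ZZ_bound (s := σ + t * I) (by simpa using this.le)

noncomputable def Btail : ℝ := ∫ σ in Set.Ioi (2:ℝ), B0 * Real.exp (-(Real.log 2) * (σ - 2))

lemma ZZ_tail {t : ℝ} : ‖∫ σ in Set.Ioi (2:ℝ), ZZ (σ + t * I)‖ ≤ Btail := by
  refine norm_integral_le_of_norm_le exp_tail_integrable ?_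
  refine (ae_restrict_iff' measurableSet_Ioi).2 (Eventually.of_forall fun σ hσ => ?_)
  have : (2:ℝ) < σ := hσ
  simpa using ZZ_bound (s := σ + t * I) (by simpa using this.le)

end SB

namespace SB

lemma J_rr_split (RH : RHyp) {α Y : ℝ} {s : ℂ} (hα : 1 ≤ α) (hs : s.re + Y = 2) (M : ℕ) :
    JH α (rr M) s Y + JL α (rr M) s Y =
      (JH α (qq M) s Y + JL α (qq M) s Y) + (JH α EE s Y + JL α EE s Y) := by
  have q1 := intH (y := Y) (s := s) (qq_adm RH M) hα hs.ge
  have q2 := intL (y := Y) (s := s) (qq_adm RH M) hα hs.ge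
  have e1 := intH (y := Y) (s := s) EE_adm hα hs.ge
  have e2 := intL (y := Y) (s := s) EE_adm hα hs.ge
  have h1 : JH α (rr M) s Y = JH α (qq M) s Y + JH α EE s Y := by
    rw [JH, JH, JH, ← integral_add q1 e1]
    congr 1; funext x; rw [qq]; ring
  have h2 : JL α (rr M) s Y = JL α (qq M) s Y + JL α EE s Y := by
    rw [JL, JL, JL, ← integral_add q2 e2]
    congr 1; funext x; rw [qq]; ring
  rw [h1, h2]; ring

lemma EE_bound' {s : ℂ} (hs : 0 ≤ s.re) (ht : 1 ≤ |s.im|) : ‖EE s‖ ≤ 2 := by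
  have h1 := inv_add_one_bound hs
  have h2 : ‖1 / (s - 1)‖ ≤ 1 := by
    rw [norm_div, norm_one]
    have := Complex.abs_im_le_norm (s - 1)
    simp only [Complex.sub_im, Complex.one_im, sub_zero] at this
    exact div_le_one_of_le₀ (by linarith) (norm_nonneg _)
  rw [EE]
  linarith [norm_sub_le (1 / (s - 1)) (1 / (s + 1))]

noncomputable def Cst : ℝ := 7/8 + 2*π + 4 * (∫ x in Set.Ioi (0:ℝ), dec x) + B0 / Real.log 2 + 96*π + 3 + 6*π + Btail

lemma dec_int_nonneg : 0 ≤ ∫ x in Set.Ioi (0:ℝ), dec x :=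
  setIntegral_nonneg measurableSet_Ioi fun x hx => dec_nonneg (le_of_lt hx)

lemma Btail_nonneg : 0 ≤ Btail := (norm_nonneg _).trans (ZZ_tail (t := 1))

lemma Cst_pos : 0 < Cst := by
  have h1 := dec_int_nonneg
  have h2 := Btail_nonneg
  have h3 : 0 ≤ B0 / Real.log 2 := div_nonneg B0_nonneg (Real.log_nonneg (by norm_num))
  have := Real.pi_pos
  rw [Cst]; positivity

lemma main_lower (RH : RHyp) {σ0 t α : ℝ} (hσ : 1/2 < σ0) (hσ1 : σ0 ≤ 1) (ht : 1 ≤ |t|) (hα : 1 ≤ α)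
    (hexp : Real.exp (3 * π * α) ≤ 1 + t ^ 2) :
    IntegrableOn (fun σ : ℝ => ZZ (σ + t * I)) (Set.Ioi σ0) ∧
    -(Real.log (|t| + 2) / (4 * α) + Cst * (α * Real.exp (π * α))) ≤
      -(∫ σ in Set.Ioi σ0, ZZ (σ + t * I)).im := by
  have hpi := Real.pi_pos
  have ht0 : t ≠ 0 := by rintro rfl; norm_num at ht
  set s : ℂ := σ0 + t * I with hs
  have hsre : s.re = σ0 := by simp [hs]
  have hsim : s.im = t := by simp [hs]
  set M : ℕ := ⌊Real.exp (2 * π * α)⌋₊ with hM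
  have hMle : (M : ℝ) ≤ Real.exp (2 * π * α) := Nat.floor_le (by positivity)
  have hMlt : Real.exp (2 * π * α) < M + 1 := Nat.lt_floor_add_one _
  have hM1 : 1 ≤ M := Nat.le_floor (by push_cast; exact Real.one_le_exp (by positivity))
  set D : ℝ := 2 * (2 * π * α) * Real.exp (2 * π * α / 2) with hD
  have hDb : ∀ s : ℂ, 1/2 ≤ s.re → ‖PP M s‖ ≤ D := fun s hs => PP_bound hs (by positivity) hMle
  set Y : ℝ := 2 - σ0 with hY
  have hY0 : 0 ≤ Y := by linarith
  have hsY : s.re + Y = 2 := by rw [hsre]; linarith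
  obtain ⟨C, hC⟩ := rr_adm RH hσ M
  have hsh := J_shift (s := s) hC hα le_rfl hY0 (by rw [hsre]; linarith)
  rw [J_rr_split RH hα hsY] at hsh
  have hq := Jq_const RH hα hY0 hsY hM1 hMlt
  have hE := JE_bound hα hY0 (by linarith) hsY (by rw [hsim]; exact hexp)
  have hlow := Jr_lower RH hα (s := s) (by rw [hsre]; exact hσ) (by rw [hsre]; exact hσ1) hDb
  rw [hsh] at hlow
  rw [hsim] at hlow
  simp only [Complex.add_re, Complex.mul_re, Complex.I_re, Complex.I_im, zero_mul, one_mul, zero_sub] at hlow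
  have hq' := abs_le.1 ((Complex.abs_re_le_norm _).trans hq)
  have hE' := abs_le.1 ((Complex.abs_re_le_norm _).trans hE)
  simp only [Complex.add_re] at hq' hE'
  have iZ : IntervalIntegrable (fun σ : ℝ => ZZ (σ + t * I)) volume σ0 2 := by
    refine ContinuousOn.intervalIntegrable fun x hx => ?_
    rw [Set.uIcc_of_le (by linarith)] at hx
    exact (ZZ_line_cont RH ht0 (by linarith [hx.1])).continuousWithinAt
  have iR : IntervalIntegrable (fun σ : ℝ => rr M (σ + t * I)) volume σ0 2 := by
    refine ContinuousOn.intervalIntegrable fun x hx => ?_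
    rw [Set.uIcc_of_le (by linarith)] at hx
    have h1 := (rr_diff RH (s := x + t * I) (by simp; linarith [hx.1]) M).continuousAt
    have h3 : ContinuousAt (fun x : ℝ => (x + t * I : ℂ)) x := by fun_prop
    exact (ContinuousAt.comp (f := fun x : ℝ => (x + t * I : ℂ)) h1 h3).continuousWithinAt
  have hsub : ∫ y in (0:ℝ)..Y, rr M (s + y) = ∫ σ in σ0..2, rr M (σ + t * I) := by
    have := intervalIntegral.integral_comp_add_left (fun σ : ℝ => rr M (σ + t * I)) (a := 0) (b := Y) σ0
    rw [add_zero, show σ0 + Y = 2 by rw [hY]; ring] at this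
    rw [← this]
    congr 1; funext y; congr 1; rw [hs]; push_cast; ring
  rw [hsub] at hlow
  have hdiff : ‖(∫ σ in σ0..2, rr M (σ + t * I)) - ∫ σ in σ0..2, ZZ (σ + t * I)‖ ≤ (2 + D) * |2 - σ0| := by
    rw [← intervalIntegral.integral_sub iR iZ]
    refine intervalIntegral.norm_integral_le_of_norm_le_const fun x hx => ?_
    rw [Set.uIoc_of_le (by linarith)] at hx
    have hre : 1/2 < ((x:ℂ) + t * I).re := by simp; linarith [hx.1]
    have him : ((x:ℂ) + t * I).im = t := by simp
    rw [rr_eq RH hre (ne_one_im (by rw [him]; exact ht0)), ZZ]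
    have h1 := EE_bound' (s := x + t * I) (by linarith) (by rw [him]; exact ht)
    have h2 := hDb (x + t * I) hre.le
    refine le_trans (le_of_eq ?_) ((norm_add_le (EE (x + t * I)) (PP M (x + t * I))).trans (add_le_add h1 h2))
    congr 1; ring
  have iT := ZZ_integrable RH ht0
  have iI : IntegrableOn (fun σ : ℝ => ZZ (σ + t * I)) (Set.Ioi σ0) := by
    rw [← Set.Ioc_union_Ioi_eq_Ioi (by linarith : σ0 ≤ 2)]
    exact ((intervalIntegrable_iff_integrableOn_Ioc_of_le (by linarith)).1 iZ).union iT
  refine ⟨iI, ?_⟩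
  have hspl := intervalIntegral.integral_interval_add_Ioi iI iT
  have htail := abs_le.1 ((Complex.abs_im_le_norm _).trans (ZZ_tail (t := t)))
  have hdiff' := abs_le.1 ((Complex.abs_im_le_norm _).trans hdiff)
  rw [← hspl, Complex.add_im]
  rw [Complex.sub_im] at hdiff'
  have hX : Real.exp (2 * π * α / 2) = Real.exp (π * α) := by congr 1; ring
  set X := Real.exp (π * α) with hXd
  have hX1 : 1 ≤ X := Real.one_le_exp (by positivity)
  have hαX : 1 ≤ α * X := by nlinarith
  rw [hX] at hD
  have hY2 : |2 - σ0| ≤ 3/2 := by rw [abs_of_nonneg hY0]; linarith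
  have hD0 : 0 ≤ D := by rw [hD]; positivity
  have hdY : (2 + D) * |2 - σ0| ≤ (2 + D) * (3/2) := by gcongr
  have e1 : ((1/2) * Real.log (|t| + 2) + 7/4 + D) * (1 / (2 * α)) =
      Real.log (|t| + 2) / (4 * α) + (7/8) * (1/α) + 2 * π * X := by
    rw [hD]; field_simp; ring
  have e2 : 1 / α ≤ 1 := by rw [div_le_one (by linarith)]; exact hα
  have e3 : X ≤ α * X := by nlinarith
  rw [e1] at hlow
  have d0 := dec_int_nonneg
  have b0 := Btail_nonneg
  have q0 : 0 ≤ B0 / Real.log 2 := div_nonneg B0_nonneg (Real.log_nonneg (by norm_num))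
  have f1 : 2 * π * X ≤ 2 * π * (α * X) := by gcongr
  have f2 : Cst * (α * X) = 7/8 * (α * X) + 2*π* (α * X) + 4 * (∫ x in Set.Ioi (0:ℝ), dec x) * (α * X) + B0 / Real.log 2 * (α * X) + 96*π * (α * X) + 3 * (α * X) + 6*π * (α * X) + Btail * (α * X) := by
    rw [Cst]; ring
  have f3 := le_mul_of_one_le_right (by positivity : 0 ≤ 4 * (∫ x in Set.Ioi (0:ℝ), dec x)) hαX
  have f4 := le_mul_of_one_le_right q0 hαX
  have f5 := le_mul_of_one_le_right b0 hαX
  have f6 := le_mul_of_one_le_right (by positivity : 0 ≤ 96 * π) hαX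
  have f7 : (2 + D) * (3/2) = 3 + 6 * π * (α * X) := by rw [hD]; ring
  rw [f2]
  linarith [hq'.1, hq'.2, hE'.1, hE'.2, htail.1, htail.2, hdiff'.1, hdiff'.2]

end SB

namespace SB

open scoped ComplexConjugate in
lemma ZZ_conj (s : ℂ) : ZZ (conj s) = conj (ZZ s) := by
  have h1 : (conj ∘ riemannZeta ∘ conj : ℂ → ℂ) = riemannZeta := by
    funext z; simp [riemannZeta_conj]
  have h2 : deriv riemannZeta (conj s) = conj (deriv riemannZeta s) := by
    have := congrFun (deriv_conj_conj (f := riemannZeta)) (conj s)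
    rw [h1] at this
    simpa using this
  rw [ZZ, ZZ, h2, riemannZeta_conj, map_div₀]

lemma ZZ_neg (σ t : ℝ) : (ZZ (σ + ((-t : ℝ) : ℂ) * I)).im = -(ZZ (σ + t * I)).im := by
  have h := ZZ_conj (σ + t * I)
  have e : (starRingEnd ℂ) ((σ : ℂ) + t * I) = σ + ((-t : ℝ) : ℂ) * I := by
    apply Complex.ext <;> simp
  rw [e] at h
  rw [h, Complex.conj_im]

lemma two_sided (RH : RHyp) {σ0 t α : ℝ} (hσ : 1/2 < σ0) (hσ1 : σ0 ≤ 1) (ht : 1 ≤ |t|) (hα : 1 ≤ α)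
    (hexp : Real.exp (3 * π * α) ≤ 1 + t ^ 2) :
    |∫ σ in Set.Ioi σ0, (ZZ (σ + t * I)).im| ≤
      Real.log (|t| + 2) / (4 * α) + Cst * (α * Real.exp (π * α)) := by
  obtain ⟨i1, h1⟩ := main_lower RH hσ hσ1 ht hα hexp
  obtain ⟨i2, h2⟩ := main_lower RH (t := -t) hσ hσ1 (by rwa [abs_neg]) hα (by rwa [neg_sq])
  have e1 : (∫ σ in Set.Ioi σ0, ZZ (σ + t * I)).im = ∫ σ in Set.Ioi σ0, (ZZ (σ + t * I)).im := by
    rw [← Complex.imCLM_apply, ← Complex.imCLM.integral_comp_comm i1]; rfl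
  have e2 : (∫ σ in Set.Ioi σ0, ZZ (σ + ((-t : ℝ) : ℂ) * I)).im = -∫ σ in Set.Ioi σ0, (ZZ (σ + t * I)).im := by
    rw [← Complex.imCLM_apply, ← Complex.imCLM.integral_comp_comm i2, ← integral_neg]
    congr 1; funext σ; exact ZZ_neg σ t
  rw [e1] at h1
  rw [e2, abs_neg] at h2
  exact abs_le.2 ⟨by linarith, by linarith⟩

lemma half_bound (RH : RHyp) {t α : ℝ} (ht : 1 ≤ |t|) (hα : 1 ≤ α)
    (hexp : Real.exp (3 * π * α) ≤ 1 + t ^ 2) :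
    |∫ σ in Set.Ioi (1/2 : ℝ), (ZZ (σ + t * I)).im| ≤
      Real.log (|t| + 2) / (4 * α) + Cst * (α * Real.exp (π * α)) := by
  by_cases hi : IntegrableOn (fun σ : ℝ => (ZZ (σ + t * I)).im) (Set.Ioi (1/2 : ℝ))
  · have hU : (⋃ n : ℕ, Set.Ioi (1/2 + 1 / ((n : ℝ) + 2))) = Set.Ioi (1/2 : ℝ) := by
      ext x
      simp only [Set.mem_iUnion, Set.mem_Ioi]
      constructor
      · rintro ⟨n, hn⟩
        have : 0 < 1 / ((n : ℝ) + 2) := by positivity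
        linarith
      · intro hx
        obtain ⟨n, hn⟩ := exists_nat_one_div_lt (sub_pos.2 hx)
        refine ⟨n, ?_⟩
        have : 1 / ((n : ℝ) + 2) ≤ 1 / ((n : ℝ) + 1) := by gcongr; norm_num
        linarith
    have hm : Monotone (fun n : ℕ => Set.Ioi (1/2 + 1 / ((n : ℝ) + 2))) := by
      intro a b hab
      apply Set.Ioi_subset_Ioi
      have : (a : ℝ) ≤ b := by exact_mod_cast hab
      gcongr
    have hT := tendsto_setIntegral_of_monotone (μ := volume) (f := fun σ : ℝ => (ZZ (σ + t * I)).im)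
      (fun n : ℕ => (measurableSet_Ioi : MeasurableSet (Set.Ioi (1/2 + 1 / ((n : ℝ) + 2))))) hm (by rw [hU]; exact hi)
    rw [hU] at hT
    refine le_of_tendsto hT.abs (Eventually.of_forall fun n => ?_)
    have h1 : 0 < 1 / ((n : ℝ) + 2) := by positivity
    have h2 : 1 / ((n : ℝ) + 2) ≤ 1/2 := by
      gcongr; linarith [(by positivity : (0:ℝ) ≤ n)]
    exact two_sided RH (by linarith) (by linarith) ht hα hexp
  · rw [integral_undef hi, abs_zero]
    have := Cst_pos
    have : 0 ≤ Real.log (|t| + 2) := Real.log_nonneg (by linarith)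
    have : 0 < α := by linarith
    positivity

noncomputable def Bd (t : ℝ) : ℝ := (1 / 4) * Real.log t / Real.log (Real.log t)
        + (4 + Cst) * (Real.log t * Real.log (Real.log (Real.log t)))
            / (Real.log (Real.log t)) ^ 2

lemma ll_lower {t : ℝ} (ht : Real.exp (Real.exp (Real.exp 10)) ≤ t) :
    0 < t ∧ 0 < Real.log t ∧ 0 < Real.log (Real.log t) ∧ 10 ≤ Real.log (Real.log (Real.log t)) := by
  have h0 : 0 < t := (Real.exp_pos _).trans_le ht
  have h1 : Real.exp (Real.exp 10) ≤ Real.log t := (Real.le_log_iff_exp_le h0).2 ht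
  have h1' := (Real.exp_pos _).trans_le h1
  have h2 : Real.exp 10 ≤ Real.log (Real.log t) := (Real.le_log_iff_exp_le h1').2 h1
  have h2' := (Real.exp_pos _).trans_le h2
  exact ⟨h0, h1', h2', (Real.le_log_iff_exp_le h2').2 h2⟩

set_option maxHeartbeats 2000000 in
lemma choose_alpha {t : ℝ} (ht : Real.exp (Real.exp (Real.exp 10)) ≤ t) :
    ∃ α : ℝ, 1 ≤ α ∧ 1 ≤ |t| ∧ Real.exp (3 * π * α) ≤ 1 + t ^ 2 ∧
      (1/π) * (Real.log (|t| + 2) / (4 * α) + Cst * (α * Real.exp (π * α))) ≤ Bd t := by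
  obtain ⟨h0, h1, h2, h3⟩ := ll_lower ht
  rw [Bd]
  have hpi := Real.pi_pos
  have hpi3 := Real.pi_gt_three
  have hpi4 := Real.pi_le_four
  have hC := Cst_pos
  set L := Real.log t with hL
  set L2 := Real.log L with hL2
  set L3 := Real.log L2 with hL3
  have eL : Real.exp L = t := Real.exp_log h0
  have eL2 : Real.exp L2 = L := Real.exp_log h1
  have eL3 : Real.exp L3 = L2 := Real.exp_log h2
  have q3 := Real.quadratic_le_exp_of_nonneg (x := L3) (by linarith)
  rw [eL3] at q3
  have g1 : 6 * L3 ≤ L2 := by nlinarith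
  have q2 := Real.quadratic_le_exp_of_nonneg h2.le
  rw [eL2] at q2
  have g2 : 2 * L2 ≤ L := by nlinarith
  have q1 := Real.add_one_le_exp L
  rw [eL] at q1
  have ht1 : 100 ≤ t := by linarith
  have habs : |t| = t := abs_of_pos h0
  set w := L2 - 3 * L3 with hw
  have hw2 : L2 / 2 ≤ w := by linarith
  have hw0 : 0 < w := by linarith
  have ew : π * (w / π) = w := by field_simp
  have eexp : Real.exp w = L / L2 ^ 3 := by
    rw [hw, Real.exp_sub, eL2, mul_comm (3:ℝ), Real.exp_mul, eL3]
    norm_cast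
  have hLL : 0 < L * L3 / L2 ^ 2 := by positivity
  refine ⟨w / π, ?_, by rw [habs]; linarith, ?_, ?_⟩
  · rw [le_div_iff₀ hpi]; linarith
  · rw [mul_assoc, ew]
    have : Real.exp (3 * w) ≤ Real.exp (L + L) := Real.exp_le_exp.2 (by linarith)
    rw [Real.exp_add, eL] at this
    nlinarith
  · rw [ew, eexp, habs]
    have hlog : Real.log (t + 2) ≤ L + 1 := by
      rw [← Real.log_exp (L + 1)]
      apply Real.log_le_log (by linarith)
      rw [Real.exp_add, eL]
      have := Real.add_one_le_exp (1:ℝ)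
      nlinarith
    have e1 : (1/π) * (Real.log (t + 2) / (4 * (w / π))) = Real.log (t + 2) * (1 / w) / 4 := by
      field_simp
    have hinv : 1 / w ≤ 1 / L2 + 6 * L3 / L2 ^ 2 := by
      rw [div_le_iff₀ hw0]
      have : (1 / L2 + 6 * L3 / L2 ^ 2) * w = 1 + 3 * L3 * (L2 - 6 * L3) / L2 ^ 2 := by
        rw [hw]; field_simp; ring
      rw [this]
      have : 0 ≤ 3 * L3 * (L2 - 6 * L3) / L2 ^ 2 :=
        div_nonneg (mul_nonneg (by linarith) (by linarith)) (by positivity)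
      linarith
    have hA : Real.log (t + 2) * (1 / w) / 4 ≤ (L + 1) * (1 / L2 + 6 * L3 / L2 ^ 2) / 4 := by
      gcongr
    have k1 : 1 / L2 ≤ L * L3 / L2 ^ 2 := by
      rw [div_le_div_iff₀ h2 (by positivity)]
      have : L2 ≤ L * L3 := by nlinarith
      nlinarith
    have k2 : 6 * L3 / L2 ^ 2 ≤ 6 * (L * L3 / L2 ^ 2) := by
      rw [← mul_div_assoc]
      gcongr 6 * ?_ / _
      nlinarith
    have e2 : (L + 1) * (1 / L2 + 6 * L3 / L2 ^ 2) / 4 = 1/4 * L / L2 + 6/4 * (L * L3 / L2 ^ 2) + (1 / L2) / 4 + (6 * L3 / L2 ^ 2) / 4 := by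
      field_simp
      ring
    have hB : (1/π) * (Cst * (w / π * (L / L2 ^ 3))) ≤ Cst * (L * L3 / L2 ^ 2) := by
      have a1 : 1 / π ≤ 1 := by rw [div_le_one hpi]; linarith
      have a2 : w / π ≤ L2 := by
        rw [div_le_iff₀ hpi]; nlinarith
      calc (1/π) * (Cst * (w / π * (L / L2 ^ 3))) ≤ 1 * (Cst * (L2 * (L / L2 ^ 3))) := by gcongr
        _ = Cst * (L * 1 / L2 ^ 2) := by field_simp
        _ ≤ Cst * (L * L3 / L2 ^ 2) := by gcongr; linarith
    have e3 : (4 + Cst) * (L * L3) / L2 ^ 2 = 4 * (L * L3 / L2 ^ 2) + Cst * (L * L3 / L2 ^ 2) := by ring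
    rw [mul_add, e1, e3]
    linarith

lemma Bd_cont {t : ℝ} (ht : Real.exp (Real.exp (Real.exp 10)) ≤ t) : ContinuousAt Bd t := by
  obtain ⟨h0, h1, h2, h3⟩ := ll_lower ht
  have c1 : ContinuousAt (fun t => Real.log t) t := Real.continuousAt_log h0.ne'
  have c2 : ContinuousAt (fun t => Real.log (Real.log t)) t := c1.log h1.ne'
  have c3 : ContinuousAt (fun t => Real.log (Real.log (Real.log t))) t := c2.log h2.ne'
  exact ((continuousAt_const.mul c1).div c2 h2.ne').add
    ((continuousAt_const.mul (c1.mul c3)).div (c2.pow 2) (by positivity))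

lemma ord_discrete (t : ℝ) : ∀ᶠ u in nhdsWithin t {t}ᶜ,
    ∀ ρ : ℂ, riemannZeta ρ = 0 → 0 ≤ ρ.re → ρ.re ≤ 1 → ρ.im ≠ u := by
  have hK : IsCompact (Set.Icc (0:ℝ) 1 ×ℂ Set.Icc (t - 1) (t + 1)) := isCompact_Icc.reProdIm isCompact_Icc
  have hF := (hK.inter_riemannZetaZeros_finite).image Complex.im
  have h1 := (hF.subset (Set.diff_subset (t := {t}))).isClosed.isOpen_compl.mem_nhds (x := t) (by simp)
  have h2 : Set.Icc (t - 1) (t + 1) ∈ nhds t := Icc_mem_nhds (by linarith) (by linarith)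
  filter_upwards [nhdsWithin_le_nhds h1, nhdsWithin_le_nhds h2, self_mem_nhdsWithin] with u a b c ρ z1 z2 z3 z4
  exact a ⟨⟨ρ, ⟨Complex.mem_reProdIm.2 ⟨⟨z2, z3⟩, z4 ▸ b⟩, z1⟩, z4⟩, c⟩

end SB

theorem S_bound_quarter
    (RH : ∀ ρ : ℂ, riemannZeta ρ = 0 → 0 ≤ ρ.re → ρ.re ≤ 1 → ρ.re = 1 / 2)
    (S : ℝ → ℝ)
    (hS₁ : ∀ t : ℝ, 0 < t →
      (∀ ρ : ℂ, riemannZeta ρ = 0 → 0 ≤ ρ.re → ρ.re ≤ 1 → ρ.im ≠ t) →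
      S t = -(1 / π) * ∫ σ in Set.Ioi (1 / 2 : ℝ),
        (deriv riemannZeta (σ + t * Complex.I) / riemannZeta (σ + t * Complex.I)).im)
    (hS₂ : ∀ t : ℝ, 0 < t →
      (∃ ρ : ℂ, riemannZeta ρ = 0 ∧ 0 ≤ ρ.re ∧ ρ.re ≤ 1 ∧ ρ.im = t) →
      Tendsto (fun ε : ℝ => (S (t + ε) + S (t - ε)) / 2)
        (nhdsWithin 0 {(0 : ℝ)}ᶜ) (nhds (S t))) :
    ∃ C T₀ : ℝ, 0 < C ∧ ∀ t : ℝ, T₀ ≤ t →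
      |S t| ≤ (1 / 4) * Real.log t / Real.log (Real.log t)
        + C * (Real.log t * Real.log (Real.log (Real.log t)))
            / (Real.log (Real.log t)) ^ 2 := by
  have key : ∀ t : ℝ, Real.exp (Real.exp (Real.exp 10)) ≤ t →
      (∀ ρ : ℂ, riemannZeta ρ = 0 → 0 ≤ ρ.re → ρ.re ≤ 1 → ρ.im ≠ t) → |S t| ≤ SB.Bd t := by
    intro t ht hz
    have h0 := (SB.ll_lower ht).1
    obtain ⟨α, hα, h1, h2, h3⟩ := SB.choose_alpha ht
    have h4 := SB.half_bound RH h1 hα h2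
    rw [hS₁ t h0 hz, abs_mul, abs_neg, abs_of_pos (by positivity)]
    refine le_trans ?_ h3
    exact mul_le_mul_of_nonneg_left h4 (by positivity)
  refine ⟨4 + SB.Cst, Real.exp (Real.exp (Real.exp 10)) + 1, by linarith [SB.Cst_pos], fun t ht => ?_⟩
  change |S t| ≤ SB.Bd t
  have ht' : Real.exp (Real.exp (Real.exp 10)) < t := by linarith
  have h0 := (SB.ll_lower ht'.le).1
  by_cases hz : ∃ ρ : ℂ, riemannZeta ρ = 0 ∧ 0 ≤ ρ.re ∧ ρ.re ≤ 1 ∧ ρ.im = t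
  · have hp : Tendsto (fun ε : ℝ => t + ε) (nhdsWithin 0 {(0:ℝ)}ᶜ) (nhdsWithin t {t}ᶜ) := by
      refine tendsto_nhdsWithin_of_tendsto_nhds_of_eventually_within _ ?_ ?_
      · have : Continuous (fun ε : ℝ => t + ε) := by fun_prop
        simpa using (this.tendsto 0).mono_left nhdsWithin_le_nhds
      · filter_upwards [self_mem_nhdsWithin] with ε hε
        simpa using hε
    have hm : Tendsto (fun ε : ℝ => t - ε) (nhdsWithin 0 {(0:ℝ)}ᶜ) (nhdsWithin t {t}ᶜ) := by
      refine tendsto_nhdsWithin_of_tendsto_nhds_of_eventually_within _ ?_ ?_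
      · have : Continuous (fun ε : ℝ => t - ε) := by fun_prop
        simpa using (this.tendsto 0).mono_left nhdsWithin_le_nhds
      · filter_upwards [self_mem_nhdsWithin] with ε hε
        simpa using hε
    have hb : ∀ᶠ u in nhdsWithin t {t}ᶜ, |S u| ≤ SB.Bd u := by
      filter_upwards [SB.ord_discrete t, nhdsWithin_le_nhds (Ioi_mem_nhds ht')] with u h1 h2
      exact key u (le_of_lt h2) h1
    have hc : Tendsto SB.Bd (nhdsWithin t {t}ᶜ) (nhds (SB.Bd t)) :=
      (SB.Bd_cont ht'.le).tendsto.mono_left nhdsWithin_le_nhds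
    have hlim : Tendsto (fun ε : ℝ => (SB.Bd (t + ε) + SB.Bd (t - ε)) / 2)
        (nhdsWithin 0 {(0 : ℝ)}ᶜ) (nhds (SB.Bd t)) := by
      have := ((hc.comp hp).add (hc.comp hm)).div_const 2
      simpa using this
    refine le_of_tendsto_of_tendsto (hS₂ t h0 hz).abs hlim ?_
    filter_upwards [hp.eventually hb, hm.eventually hb] with ε h1 h2
    rw [abs_div, abs_of_pos (by norm_num : (0:ℝ) < 2)]
    have := abs_add_le (S (t + ε)) (S (t - ε))
    linarith
  · push Not at hz
    exact key t ht'.le hz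
end

section
/- Beurling's functions H±(z) = (sin πz / π)^2 · { Σ_{m=-∞}^{∞} sgn(m)/(z-m)^2 + 2/z } ± (sin πz / (πz))^2 satisfy ∫_{-∞}^{∞} |H±(x) - sgn(x)| dx = 1. -/
open Complex Real Filter MeasureTheory

namespace Beurling

/-- the Fejér kernel -/
noncomputable def K (x : ℝ) : ℝ := (Real.sin (π * x) / (π * x)) ^ 2

/-- the odd part minus sign -/
noncomputable def D (x : ℝ) : ℝ :=
  (Real.sin (π * x) / π) ^ 2 * ((∑' m : ℤ, (Int.sign m : ℝ) / (x - m) ^ 2) + 2 / x) - Real.sign x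

lemma sin_sq_sub_int (x : ℝ) (m : ℤ) : Real.sin (π * (x - m)) ^ 2 = Real.sin (π * x) ^ 2 := by
  have : π * (x - m) = π * x - m * π := by ring
  rw [this, Real.sin_sub_int_mul_pi, mul_pow]
  rcases Int.even_or_odd m with h | h
  · rw [h.neg_one_zpow]; simp
  · rw [h.neg_one_zpow]; simp

lemma hasSum_K (x : ℝ) (hx : ∀ m : ℤ, x ≠ m) : HasSum (fun m : ℤ => K (x - m)) 1 := by
  have hL2 : MemLp (fun t : ℝ => Complex.exp (2 * π * I * x * t)) 2
      (volume.restrict (Set.Ioc (0:ℝ) 1)) := by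
    refine MemLp.of_bound (by fun_prop) 1 (ae_of_all _ fun t => ?_)
    have : 2 * π * I * x * t = ((2 * π * x * t : ℝ) : ℂ) * I := by push_cast; ring
    rw [this, Complex.norm_exp_ofReal_mul_I]
  have h := hasSum_sq_fourierCoeffOn (zero_lt_one) hL2
  convert h using 1
  · funext m
    rw [fourierCoeffOn_eq_integral]
    have hne : (2 * π * I * (x - m) : ℂ) ≠ 0 := by
      have h1 : (x - m : ℂ) ≠ 0 := by
        have := sub_ne_zero.mpr (hx m)
        exact_mod_cast this
      have := Complex.ofReal_ne_zero.mpr Real.pi_ne_zero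
      simp [*]
    have : ∀ t : ℝ, fourier (-m) (t : AddCircle (1 - 0 : ℝ)) • Complex.exp (2 * π * I * x * t)
        = Complex.exp ((2 * π * I * (x - m)) * t) := by
      intro t
      rw [fourier_coe_apply, smul_eq_mul, ← Complex.exp_add]
      congr 1
      push_cast
      ring
    simp_rw [this]
    rw [integral_exp_mul_complex hne]
    have e : (2 * π * I * (x - m) : ℂ) * (1:ℝ) = I * ((2 * (π * (x - m)) : ℝ) : ℂ) := by
      push_cast; ring
    rw [e]
    simp only [Complex.ofReal_zero, mul_zero, Complex.exp_zero, sub_zero, div_one, one_smul]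
    rw [norm_div, Complex.norm_exp_I_mul_ofReal_sub_one]
    have e2 : ‖(2 * π * I * (x - m) : ℂ)‖ = ‖2 * (π * (x - m))‖ := by
      have : (2 * π * I * (x - m) : ℂ) = I * ((2 * (π * (x - m)) : ℝ) : ℂ) := by
        push_cast; ring
      rw [this, norm_mul, Complex.norm_I, one_mul, Complex.norm_real]
    rw [e2, ← norm_div, Real.norm_eq_abs, sq_abs, K]
    congr 1
    rw [mul_div_cancel_left₀ _ (two_ne_zero), mul_div_mul_left _ _ two_ne_zero]
  · have : ∀ t : ℝ, ‖Complex.exp (2 * π * I * x * t)‖ = 1 := by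
      intro t
      have : 2 * π * I * x * t = ((2 * π * x * t : ℝ) : ℂ) * I := by push_cast; ring
      rw [this, Complex.norm_exp_ofReal_mul_I]
    simp [this]

lemma hasSum_tele (x : ℝ) (hx : 0 < x) :
    HasSum (fun n : ℕ => 1 / (x + n) - 1 / (x + (n + 1))) (1 / x) := by
  rw [hasSum_iff_tendsto_nat_of_nonneg]
  · have : ∀ n : ℕ, ∑ i ∈ Finset.range n, (1 / (x + i) - 1 / (x + (i + 1))) = 1 / x - 1 / (x + n) := by
      intro n
      have := Finset.sum_range_sub' (fun i : ℕ => 1 / (x + i)) n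
      push_cast at this
      simpa using this
    simp_rw [this]
    have h2 : Tendsto (fun n : ℕ => 1 / (x + n)) atTop (nhds 0) :=
      (tendsto_const_nhds.div_atTop (tendsto_atTop_add_const_left _ _ tendsto_natCast_atTop_atTop))
    simpa using tendsto_const_nhds.sub h2
  · intro n
    have : (0:ℝ) < x + n := by positivity
    rw [sub_nonneg]
    apply one_div_le_one_div_of_le this; linarith

lemma summable_sq (x : ℝ) (hx : 0 < x) : Summable (fun n : ℕ => 1 / (x + (n + 1)) ^ 2) := by
  refine Summable.of_nonneg_of_le (fun n => by positivity) (fun n => ?_) (hasSum_tele x hx).summable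
  have : (0:ℝ) < x + n := by positivity
  rw [div_sub_div _ _ (by positivity) (by positivity), div_le_div_iff₀ (by positivity) (by positivity)]
  nlinarith

lemma U_le (x : ℝ) (hx : 0 < x) : ∑' n : ℕ, 1 / (x + (n + 1)) ^ 2 ≤ 1 / x := by
  rw [← (hasSum_tele x hx).tsum_eq]
  refine (summable_sq x hx).tsum_le_tsum (fun n => ?_) (hasSum_tele x hx).summable
  have : (0:ℝ) < x + n := by positivity
  rw [div_sub_div _ _ (by positivity) (by positivity), div_le_div_iff₀ (by positivity) (by positivity)]
  nlinarith

lemma le_U (x : ℝ) (hx : 0 < x) : 1 / x ≤ 1 / x ^ 2 + ∑' n : ℕ, 1 / (x + (n + 1)) ^ 2 := by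
  have hs : Summable (fun n : ℕ => 1 / (x + n) ^ 2) := by
    rw [← summable_nat_add_iff 1]
    simpa using summable_sq x hx
  have h0 := hs.tsum_eq_zero_add
  push_cast at h0
  rw [add_zero] at h0
  rw [← h0, ← (hasSum_tele x hx).tsum_eq]
  refine (hasSum_tele x hx).summable.tsum_le_tsum (fun n => ?_) hs
  have : (0:ℝ) < x + n := by positivity
  rw [div_sub_div _ _ (by positivity) (by positivity), div_le_div_iff₀ (by positivity) (by positivity)]
  nlinarith

lemma D_neg (x : ℝ) : D (-x) = - D x := by
  have h : ∑' m : ℤ, (Int.sign m : ℝ) / (-x - m) ^ 2 = - ∑' m : ℤ, (Int.sign m : ℝ) / (x - m) ^ 2 := by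
    rw [← (Equiv.neg ℤ).tsum_eq, ← tsum_neg]
    congr 1
    funext m
    simp only [Equiv.neg_apply, Int.sign_neg]
    push_cast
    rw [show (-x - -(m:ℝ)) ^ 2 = (x - m) ^ 2 by ring, neg_div]
  unfold D
  rw [h, Real.sign_neg, mul_neg, Real.sin_neg, div_neg]
  ring

lemma K_neg (x : ℝ) : K (-x) = K x := by
  unfold K
  rw [mul_neg, Real.sin_neg, neg_div_neg_eq]

lemma abs_D_le_pos (x : ℝ) (hx0 : 0 < x) (hx : ∀ m : ℤ, x ≠ m) : |D x| ≤ K x := by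
  have hK := hasSum_K x hx
  set s : ℝ := (Real.sin (π * x) / π) ^ 2 with hs
  have hKe : ∀ m : ℤ, K (x - m) = s * (1 / (x - m) ^ 2) := by
    intro m
    rw [K, div_pow, sin_sq_sub_int, hs]
    field_simp
  simp_rw [hKe] at hK
  have hs0 : s ≠ 0 := by
    intro h; simp [h] at hK
    exact one_ne_zero (hK.unique hasSum_zero)
  have hA : HasSum (fun m : ℤ => 1 / (x - m) ^ 2) (s⁻¹ * 1) := by
    have := hK.mul_left s⁻¹
    simpa [hs0] using this
  have hU := (summable_sq x hx0).hasSum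
  set U := ∑' n : ℕ, 1 / (x + (n + 1)) ^ 2 with hUd
  have hT : HasSum (fun m : ℤ => (1 - (Int.sign m : ℝ)) / (x - m) ^ 2) (1 / x ^ 2 + 2 * U) := by
    apply HasSum.of_nat_of_neg_add_one
    · have := hasSum_single (f := fun n : ℕ => (1 - (Int.sign (n:ℤ) : ℝ)) / (x - ((n : ℤ):ℝ)) ^ 2) 0
        (fun n hn => by
          have : Int.sign (n:ℤ) = 1 := Int.sign_eq_one_of_pos (by omega)
          rw [this]; simp)
      simpa using this
    · have := hU.mul_left 2
      convert! this using 1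
      funext n
      have : Int.sign (-((n:ℤ) + 1)) = -1 := Int.sign_eq_neg_one_of_neg (by omega)
      rw [this]
      push_cast
      ring
  have hS : HasSum (fun m : ℤ => (Int.sign m : ℝ) / (x - m) ^ 2) (s⁻¹ * 1 - (1 / x ^ 2 + 2 * U)) := by
    convert! hA.sub hT using 1
    funext m
    ring
  have hD : D x = s * (2 / x - 1 / x ^ 2 - 2 * U) := by
    rw [D, hS.tsum_eq, Real.sign_of_pos hx0, ← hs]
    field_simp
    ring
  have hKx : K x = s * (1 / x ^ 2) := by simpa using hKe 0
  have hsp : 0 ≤ s := by positivity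
  rw [hD, hKx, abs_mul, abs_of_nonneg hsp]
  refine mul_le_mul_of_nonneg_left ?_ hsp
  have h1 := U_le x hx0
  have h2 := le_U x hx0
  have h3 : 2 / x = 2 * (1 / x) := by ring
  rw [← hUd] at h1 h2
  rw [abs_le, h3]
  constructor <;> linarith

lemma abs_D_le (x : ℝ) (hx : ∀ m : ℤ, x ≠ m) : |D x| ≤ K x := by
  rcases lt_trichotomy x 0 with h | h | h
  · have := abs_D_le_pos (-x) (by linarith) (fun m hm => hx (-m) (by push_cast; linarith))
    rwa [D_neg, K_neg, abs_neg] at this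
  · exact absurd h (by simpa using hx 0)
  · exact abs_D_le_pos x h hx

lemma ae_nonint : ∀ᵐ x : ℝ, ∀ m : ℤ, x ≠ m := by
  rw [ae_all_iff]
  intro m
  exact Measure.ae_ne volume (m:ℝ)

lemma measurable_K : Measurable K := by unfold K; fun_prop

lemma K_nonneg (x : ℝ) : 0 ≤ K x := sq_nonneg _

lemma lintegral_K : ∫⁻ x, ENNReal.ofReal (K x) = 1 := by
  have hm := measurable_K
  rw [← setLIntegral_univ, ← iUnion_Ioc_intCast ℝ,
    lintegral_iUnion (fun _ => measurableSet_Ioc) (Set.pairwise_disjoint_Ioc_intCast ℝ)]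
  have h1 : ∀ n : ℤ, ∫⁻ x in Set.Ioc (n:ℝ) (n + 1), ENNReal.ofReal (K x)
      = ∫⁻ x in Set.Ioc (0:ℝ) 1, ENNReal.ofReal (K (x + n)) := by
    intro n
    have hp := (measurePreserving_add_right (volume : Measure ℝ) (n:ℝ))
    rw [← hp.setLIntegral_comp_preimage measurableSet_Ioc (by fun_prop)]
    congr 2
    simp
  simp_rw [h1]
  rw [← lintegral_tsum (fun n => by fun_prop)]
  have h2 : ∀ᵐ x ∂(volume.restrict (Set.Ioc (0:ℝ) 1)),
      ∑' n : ℤ, ENNReal.ofReal (K (x + n)) = 1 := by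
    apply ae_restrict_of_ae
    filter_upwards [ae_nonint] with x hx
    have h := hasSum_K x hx
    rw [← (Equiv.neg ℤ).hasSum_iff] at h
    have h' : HasSum (fun n : ℤ => K (x + n)) 1 := by
      convert h using 1
      funext n
      simp
    rw [← ENNReal.ofReal_tsum_of_nonneg (fun n => K_nonneg _) h'.summable, h'.tsum_eq]
    simp
  rw [lintegral_congr_ae h2]
  simp

lemma integrable_K : Integrable K := by
  refine ⟨measurable_K.aestronglyMeasurable, ?_⟩
  rw [hasFiniteIntegral_iff_ofReal (ae_of_all _ K_nonneg), lintegral_K]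
  simp

lemma integral_K : ∫ x, K x = 1 := by
  rw [integral_eq_lintegral_of_nonneg_ae (ae_of_all _ K_nonneg) measurable_K.aestronglyMeasurable,
    lintegral_K]
  simp

lemma integral_D : ∫ x, D x = 0 := by
  have h := integral_neg_eq_self D volume
  simp_rw [D_neg] at h
  rw [integral_neg] at h
  linarith

lemma complex_D (x : ℝ) : (Complex.sin (π * x) / π) ^ 2 *
          ((∑' m : ℤ, (Int.sign m : ℂ) / ((x:ℂ) - (m : ℂ)) ^ 2) + 2 / (x:ℂ))
     = ((D x + Real.sign x : ℝ) : ℂ) := by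
  unfold D
  push_cast
  simp

lemma complex_K (x : ℝ) : (Complex.sin (π * x) / (π * x)) ^ 2 = ((K x : ℝ) : ℂ) := by
  unfold K
  push_cast
  rfl


lemma main_aux (H : ℂ → ℂ) (hH : Differentiable ℂ H) (ε : ℝ) (hε : ε = 1 ∨ ε = -1)
    (h : ∀ x : ℝ, (∀ m : ℤ, x ≠ m) → H x = ((D x + Real.sign x + ε * K x : ℝ) : ℂ)) :
    (∫ x : ℝ, ‖H (x : ℂ) - (Real.sign x : ℂ)‖) = 1 := by
  have hm : AEStronglyMeasurable D volume := by
    have h1 : AEStronglyMeasurable (fun x : ℝ => (H x).re - Real.sign x - ε * K x) volume := by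
      have hc : Continuous fun x : ℝ => (H x).re :=
        Complex.continuous_re.comp (hH.continuous.comp Complex.continuous_ofReal)
      have hsg : Measurable Real.sign := by
        unfold Real.sign
        exact Measurable.ite measurableSet_Iio measurable_const
          (Measurable.ite measurableSet_Ioi measurable_const measurable_const)
      have hk := measurable_K
      exact ((hc.measurable.sub hsg).sub (hk.const_mul ε)).aestronglyMeasurable
    refine h1.congr ?_
    filter_upwards [ae_nonint] with x hx
    rw [h x hx, Complex.ofReal_re]
    ring
  have hD : Integrable D := by
    refine integrable_K.mono' hm ?_
    filter_upwards [ae_nonint] with x hx using abs_D_le x hx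
  have h2 : (fun x : ℝ => ‖H (x : ℂ) - (Real.sign x : ℂ)‖) =ᵐ[volume] fun x => ε * D x + K x := by
    filter_upwards [ae_nonint] with x hx
    rw [h x hx, ← Complex.ofReal_sub, Complex.norm_real, Real.norm_eq_abs]
    have := abs_le.mp (abs_D_le x hx)
    rcases hε with rfl | rfl
    · rw [abs_of_nonneg] <;> linarith
    · rw [abs_of_nonpos] <;> linarith
  rw [integral_congr_ae h2, integral_add (hD.const_mul ε) integrable_K, integral_const_mul,
    integral_D, integral_K]
  simp

end Beurling

/-- Beurling's functions H± satisfy ∫_{-∞}^{∞} |H±(x) - sgn(x)| dx = 1. -/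
theorem beurling_L1_distance_one
    (Hp Hm : ℂ → ℂ)
    (hHp_entire : Differentiable ℂ Hp) (hHm_entire : Differentiable ℂ Hm)
    (hHp : ∀ z : ℂ, (∀ m : ℤ, z ≠ (m : ℂ)) →
      Hp z = (Complex.sin (π * z) / π) ^ 2 *
          ((∑' m : ℤ, (Int.sign m : ℂ) / (z - (m : ℂ)) ^ 2) + 2 / z)
        + (Complex.sin (π * z) / (π * z)) ^ 2)
    (hHm : ∀ z : ℂ, (∀ m : ℤ, z ≠ (m : ℂ)) →
      Hm z = (Complex.sin (π * z) / π) ^ 2 *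
          ((∑' m : ℤ, (Int.sign m : ℂ) / (z - (m : ℂ)) ^ 2) + 2 / z)
        - (Complex.sin (π * z) / (π * z)) ^ 2) :
    (∫ x : ℝ, ‖Hp (x : ℂ) - (Real.sign x : ℂ)‖) = 1 ∧
    (∫ x : ℝ, ‖Hm (x : ℂ) - (Real.sign x : ℂ)‖) = 1 := by
  have key : ∀ x : ℝ, (∀ m : ℤ, x ≠ m) → ∀ m : ℤ, (x : ℂ) ≠ (m : ℂ) := by
    intro x hx m h
    exact hx m (by exact_mod_cast h)
  constructor
  · refine Beurling.main_aux Hp hHp_entire 1 (Or.inl rfl) fun x hx => ?_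
    rw [hHp x (key x hx), Beurling.complex_D, Beurling.complex_K]
    push_cast
    ring
  · refine Beurling.main_aux Hm hHm_entire (-1) (Or.inr rfl) fun x hx => ?_
    rw [hHm x (key x hx), Beurling.complex_D, Beurling.complex_K]
    push_cast
    ring
end
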